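/- Let (R,m,k) be a regular local ring (of any characteristic) and let I be an ideal of height d with minimal set of generators x_1,…,x_s. Then for every i ≥ 2 the natural map K_{d+i}(x;R) ⊗_R k → Tor_{d+i}^R(R/I, k) is the zero map. -/

import Mathlib

open IsLocalRing

universe u

variable (R : Type u) [CommRing R]

/-- Index type for the degree-`n` part of the Koszul complex on `s` generators:
`n`-element subsets of `Fin s` (i.e. strictly increasing `n`-tuples). -/
abbrev KIdx (s n : ℕ) : Type := {T : Finset (Fin s) // T.card = n}

/-- The degree-`n` part of the Koszul complex `K_•(x₁,…,x_s; R)`: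
the free `R`-module on `KIdx s n`. -/
abbrev KMod (s n : ℕ) : Type u := KIdx s n →₀ R

/-- The Koszul differential `K_{n+1}(x;R) → K_n(x;R)`,
`e_T ↦ ∑_{j ∈ T} (-1)^{#{i ∈ T : i < j}} x_j e_{T∖{j}}`. -/
noncomputable def koszulD {s : ℕ} (x : Fin s → R) (n : ℕ) :
    KMod R s (n + 1) →ₗ[R] KMod R s n :=
  Finsupp.lsum R fun T => LinearMap.toSpanSingleton R (KMod R s n)
    (∑ j ∈ T.1.attach,
      ((-1 : R) ^ (T.1.filter (fun i => i < j.1)).card * x j.1) •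
        Finsupp.single ⟨T.1.erase j.1, by
          simp [Finset.card_erase_of_mem j.2, T.2]⟩ (1 : R))

/-- A projective resolution `⋯ → F 1 → F 0 → M → 0` of an `R`-module `M`. -/
structure ProjRes (M : Type u) [AddCommGroup M] [Module R M] where
  F : ℕ → ModuleCat.{u} R
  d : ∀ n, F (n + 1) →ₗ[R] F n
  ε : F 0 →ₗ[R] M
  projective : ∀ n, Module.Projective R (F n)
  surj : Function.Surjective ε
  exact0 : LinearMap.ker ε = LinearMap.range (d 0)
  exact : ∀ n, LinearMap.ker (d n) = LinearMap.range (d (n + 1))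

/-- A chain map `ψ : K_•(x;R) → F_•` lifting the natural surjection
`R/(x₁,…,x_s) → R/I` (for `(x) ⊆ I`), where `F_•` is a projective resolution of
`R/I`.  The condition `aug` says that on `K_0 = R·e_∅` the augmentations are
compatible: `ε(ψ₀(r·e_∅)) = r mod I`. -/
structure KoszulLift {s : ℕ} (x : Fin s → R) (I : Ideal R)
    (P : ProjRes R (R ⧸ I)) where
  ψ : ∀ n, KMod R s n →ₗ[R] P.F n
  comm : ∀ n, (ψ n).comp (koszulD R x n) = (P.d n).comp (ψ (n + 1))
  aug : ∀ v : KMod R s 0, P.ε (ψ 0 v) = Ideal.Quotient.mk I (v ⟨∅, rfl⟩)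

/-- The natural map `K_i(x;R) ⊗ k → Tor_i^R(R/I, k)` is the zero map: for every
projective resolution `F_•` of `R/I` and every chain map `ψ : K_•(x;R) → F_•`
lifting the natural surjection `R/(x) → R/I`, every element of `ψ_i(K_i)` lies in
`im(d_{i+1}) + m·F_i`.  (As every element of `K_i ⊗ k` is a cycle, the induced
map on `i`-th homology `K_i ⊗ k → H_i(F_• ⊗ k) = Tor_i^R(R/I,k)` is zero exactly
when `ψ_i(K_i) ⊆ im(d_{i+1}) + m·F_i`.) -/
def KoszulTorMapZero [IsLocalRing R] {s : ℕ} (x : Fin s → R) (I : Ideal R)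
    (i : ℕ) : Prop :=
  ∀ (P : ProjRes R (R ⧸ I)) (L : KoszulLift R x I P) (v : KMod R s i),
    L.ψ i v ∈ LinearMap.range (P.d i) ⊔ (maximalIdeal R) • (⊤ : Submodule R (P.F i))

/-- `R` is a regular local ring: a Noetherian local ring whose maximal ideal is
generated by `dim R` elements. -/
def IsRegularLocal [IsLocalRing R] : Prop :=
  IsNoetherianRing R ∧ ∃ (n : ℕ) (x : Fin n → R),
    Ideal.span (Set.range x) = maximalIdeal R ∧ ringKrullDim R = n

/-- The ideal `I` has height `d`: `d` is the minimum of the heights of the primes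
containing `I`, the height of a prime `P` being `dim R_P`. -/
def HeightEq (I : Ideal R) (d : ℕ) : Prop :=
  (∃ (P : Ideal R) (h : P.IsPrime), I ≤ P ∧
      ringKrullDim (@Localization.AtPrime R _ P h) = d) ∧
    ∀ (P : Ideal R) (h : P.IsPrime), I ≤ P →
      (d : WithBot ℕ∞) ≤ ringKrullDim (@Localization.AtPrime R _ P h)

/-- `x₁, …, x_s` is a minimal set of generators of `I`: the `x_j` generate `I`
and no `x_j` is redundant (over a local ring this says exactly that
`s = dim_k I/mI`). -/
def MinimalGenerators {s : ℕ} (x : Fin s → R) (I : Ideal R) : Prop :=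
  Ideal.span (Set.range x) = I ∧
    ∀ j, x j ∉ Ideal.span (x '' ({j}ᶜ : Set (Fin s)))

/-! ### Koszul families -/

section Koszul

variable {ι R M N : Type*} [LinearOrder ι] [CommRing R] [AddCommGroup M] [Module R M]
  [AddCommGroup N] [Module R N]

/-- The sign with which `j` enters the set `S` in a Koszul complex. -/
def ksgn (R : Type*) [CommRing R] (S : Finset ι) (j : ι) : R :=
  (-1) ^ (S.filter (· < j)).card

theorem ksgn_insert_of_lt {S : Finset ι} {j l : ι} (hl : l ∉ S) (h : l < j) :
    ksgn R (insert l S) j = - ksgn R S j := by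
  rw [ksgn, ksgn, Finset.filter_insert, if_pos h, Finset.card_insert_of_notMem (by simp [hl]),
    pow_succ]
  ring

theorem ksgn_insert_of_not_lt {S : Finset ι} {j l : ι} (h : ¬ l < j) :
    ksgn R (insert l S) j = ksgn R S j := by
  rw [ksgn, ksgn, Finset.filter_insert, if_neg h]

theorem ksgn_insert_comm {S : Finset ι} {j l : ι} (hj : j ∉ S) (hl : l ∉ S) (h : j ≠ l) :
    ksgn R S j * ksgn R (insert j S) l = - (ksgn R S l * ksgn R (insert l S) j) := by
  rcases lt_or_gt_of_ne h with h | h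
  · rw [ksgn_insert_of_lt hj h, ksgn_insert_of_not_lt h.not_gt]; ring
  · rw [ksgn_insert_of_lt hl h, ksgn_insert_of_not_lt h.not_gt]; ring

/-- The Koszul differential on families indexed by subsets of `U`. -/
def kbd (y : ι → R) (U : Finset ι) (f : Finset ι → M) (S : Finset ι) : M :=
  ∑ j ∈ U \ S, (ksgn R S j * y j) • f (insert j S)

theorem kbd_kbd (y : ι → R) (U : Finset ι) (f : Finset ι → M) (S : Finset ι) :
    kbd y U (kbd y U f) S = 0 := by
  simp only [kbd, Finset.smul_sum]
  rw [Finset.sum_sigma']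
  refine Finset.sum_involution (fun p _ => ⟨p.2, p.1⟩) ?_ ?_ ?_ ?_
  · rintro ⟨j, l⟩ h
    simp only [Finset.mem_sigma, Finset.mem_sdiff, Finset.mem_insert, not_or] at h
    obtain ⟨⟨hj, hjS⟩, hl, hlj, hlS⟩ := h
    simp only [smul_smul]
    rw [Finset.insert_comm l j S, ← add_smul]
    have := ksgn_insert_comm (R := R) hjS hlS (Ne.symm hlj)
    have e : ksgn R S j * y j * (ksgn R (insert j S) l * y l) +
      ksgn R S l * y l * (ksgn R (insert l S) j * y j) = 0 := by
      linear_combination y j * y l * this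
    rw [e, zero_smul]
  · rintro ⟨j, l⟩ h _ e
    simp only [Finset.mem_sigma, Finset.mem_sdiff, Finset.mem_insert, not_or] at h
    simp only [Sigma.mk.injEq] at e
    exact h.2.2.1 e.1
  · rintro ⟨j, l⟩ h
    simp only [Finset.mem_sigma, Finset.mem_sdiff, Finset.mem_insert, not_or] at h ⊢
    exact ⟨⟨h.2.1, h.2.2.2⟩, h.1.1, fun e => h.2.2.1 e.symm, h.1.2⟩
  · rintro ⟨j, l⟩ h
    rfl

theorem kbd_add (y : ι → R) (U : Finset ι) (f g : Finset ι → M) (S : Finset ι) :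
    kbd y U (fun S => f S + g S) S = kbd y U f S + kbd y U g S := by
  simp [kbd, Finset.sum_add_distrib]

theorem kbd_sub (y : ι → R) (U : Finset ι) (f g : Finset ι → M) (S : Finset ι) :
    kbd y U (fun S => f S - g S) S = kbd y U f S - kbd y U g S := by
  simp [kbd, smul_sub]

theorem kbd_congr (y : ι → R) (U : Finset ι) {f g : Finset ι → M} (S : Finset ι)
    (h : ∀ j ∈ U \ S, f (insert j S) = g (insert j S)) : kbd y U f S = kbd y U g S := by
  refine Finset.sum_congr rfl fun j hj => ?_
  rw [h j hj]

theorem map_kbd (φ : M →ₗ[R] N) (y : ι → R) (U : Finset ι) (f : Finset ι → M) (S : Finset ι) :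
    φ (kbd y U f S) = kbd y U (fun S => φ (f S)) S := by
  simp [kbd]

theorem kbd_mem (y : ι → R) (U : Finset ι) (f : Finset ι → M) (S : Finset ι) :
    kbd y U f S ∈ Ideal.span (y '' U) • (⊤ : Submodule R M) := by
  refine Submodule.sum_mem _ fun j hj => Submodule.smul_mem_smul ?_ trivial
  exact Ideal.mul_mem_left _ _ (Ideal.subset_span ⟨j, by simpa using (Finset.mem_sdiff.1 hj).1,
      rfl⟩)

/-- `y` is weakly regular on `M`. -/
def WeakReg {g : ℕ} (y : Fin g → R) (M : Type*) [AddCommGroup M] [Module R M] : Prop :=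
  ∀ i, ∀ m : M, y i • m ∈ Ideal.span (y '' {j | j < i}) • (⊤ : Submodule R M) →
    m ∈ Ideal.span (y '' {j | j < i}) • (⊤ : Submodule R M)

theorem exists_sum_smul_of_mem_span_image {y : ι → R} {U : Finset ι} {m : M}
    (h : m ∈ Ideal.span (y '' U) • (⊤ : Submodule R M)) :
    ∃ c : ι → M, m = ∑ j ∈ U, y j • c j := by
  classical
  refine Submodule.smul_induction_on h ?_ ?_
  · intro r hr n _
    obtain ⟨a, ha⟩ := (Submodule.mem_span_image_finset_iff_exists_fun R).1 hr
    refine ⟨fun j => if h : j ∈ U then a ⟨j, h⟩ • n else 0, ?_⟩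
    rw [← ha, Finset.sum_smul, ← Finset.sum_coe_sort U]
    refine Finset.sum_congr rfl fun j _ => ?_
    simp [smul_smul, mul_comm]
  · rintro a b ⟨c, rfl⟩ ⟨d, rfl⟩
    exact ⟨fun j => c j + d j, by simp [Finset.sum_add_distrib]⟩

theorem koszul_exact_aux {g : ℕ} {y : Fin g → R} (hy : WeakReg y M) (k : ℕ) (hk : k ≤ g) :
    ∀ f : Finset (Fin g) → M,
      (∀ S ⊆ Finset.univ.filter (fun j : Fin g => j.1 < k),
        kbd y (Finset.univ.filter (fun j : Fin g => j.1 < k)) f S = 0) →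
      f ∅ ∈ Ideal.span (y '' (Finset.univ.filter (fun j : Fin g => j.1 < k))) •
        (⊤ : Submodule R M) →
      ∃ v : Finset (Fin g) → M, ∀ S ⊆ Finset.univ.filter (fun j : Fin g => j.1 < k),
        f S = kbd y (Finset.univ.filter (fun j : Fin g => j.1 < k)) v S := by
  classical
  induction k with
  | zero =>
    intro f _ h0
    refine ⟨0, fun S hS => ?_⟩
    have : S = ∅ := by simpa using hS
    subst this
    simpa [kbd] using h0
  | succ k ih =>
    intro f hf h0
    set a : Fin g := ⟨k, hk⟩ with ha
    set U := Finset.univ.filter (fun j : Fin g => j.1 < k) with hU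
    have hU' : Finset.univ.filter (fun j : Fin g => j.1 < k + 1) = insert a U := by
      ext j
      simp only [hU, Finset.mem_filter, Finset.mem_univ, true_and, Finset.mem_insert, ha,
        Fin.ext_iff]
      omega
    have haU : a ∉ U := by simp [hU, ha]
    have hlt : ∀ j ∈ U, j < a := by
      intro j hj
      simp only [hU, Finset.mem_filter] at hj
      exact hj.2
    rw [hU'] at hf h0 ⊢
    have hUset : (U : Set (Fin g)) = {j | j < a} := by
      ext j; simp [hU, ha, Fin.lt_def]
    have naS : ∀ S ⊆ U, a ∉ S := fun S hS h => haU (hS h)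
    have sd1 : ∀ S ⊆ U, insert a U \ S = insert a (U \ S) := fun S hS => by
      rw [Finset.insert_sdiff_of_notMem _ (naS S hS)]
    have sd2 : ∀ S ⊆ U, insert a U \ insert a S = U \ S := fun S hS => by
      rw [Finset.insert_sdiff_insert, Finset.sdiff_insert_of_notMem haU]
    have e1 : ∀ (h : Finset (Fin g) → M), ∀ S ⊆ U,
        kbd y (insert a U) h S = (ksgn R S a * y a) • h (insert a S) + kbd y U h S := by
      intro h S hS
      rw [kbd, sd1 S hS, Finset.sum_insert (by simp [haU])]
      rfl
    have e2 : ∀ (h : Finset (Fin g) → M), ∀ S ⊆ U,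
        kbd y (insert a U) h (insert a S) = kbd y U (fun S => h (insert a S)) S := by
      intro h S hS
      rw [kbd, sd2 S hS, kbd]
      refine Finset.sum_congr rfl fun j hj => ?_
      rw [ksgn_insert_of_not_lt (hlt j (Finset.mem_sdiff.1 hj).1).not_gt, Finset.insert_comm]
    have anti : ∀ (h : Finset (Fin g) → M), ∀ S ⊆ U,
        kbd y U (fun S => (ksgn R S a * y a) • h S) S = -((ksgn R S a * y a) • kbd y U h S) := by
      intro h S hS
      rw [kbd, kbd, Finset.smul_sum, ← Finset.sum_neg_distrib]
      refine Finset.sum_congr rfl fun j hj => ?_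
      rw [Finset.mem_sdiff] at hj
      rw [ksgn_insert_of_lt hj.2 (hlt j hj.1), smul_smul, smul_smul, ← neg_smul]
      congr 1
      ring
    have hmono : U ⊆ insert a U := Finset.subset_insert _ _
    have c1 : ∀ S ⊆ U, kbd y U (fun S => f (insert a S)) S = 0 := by
      intro S hS
      rw [← e2 f S hS]
      exact hf _ (Finset.insert_subset_insert _ hS)
    have c0 : ∀ S ⊆ U, (ksgn R S a * y a) • f (insert a S) + kbd y U f S = 0 := by
      intro S hS
      rw [← e1 f S hS]
      exact hf _ (hS.trans hmono)
    have h1 : f (insert a ∅) ∈ Ideal.span (y '' U) • (⊤ : Submodule R M) := by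
      have := c0 ∅ (by simp)
      have h2 := kbd_mem y U f ∅
      rw [hUset] at h2 ⊢
      refine hy a _ ?_
      have h3 : y a • f (insert a ∅) = - kbd y U f ∅ := by
        rw [← add_eq_zero_iff_eq_neg, ← this]
        simp [ksgn]
      rw [h3]
      exact neg_mem h2
    obtain ⟨v1, hv1⟩ := ih (by omega) (fun S => f (insert a S)) c1 h1
    obtain ⟨c, hc⟩ := exists_sum_smul_of_mem_span_image h0
    rw [Finset.sum_insert haU] at hc
    set v1' : Finset (Fin g) → M := fun S => if S = ∅ then c a else v1 S with hv1'
    have hv1'' : ∀ S ⊆ U, f (insert a S) = kbd y U v1' S := by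
      intro S hS
      rw [hv1 S hS]
      refine kbd_congr _ _ _ fun j hj => ?_
      simp [hv1']
    obtain ⟨v0, hv0⟩ := ih (by omega) (fun S => f S - (ksgn R S a * y a) • v1' S) (by
      intro S hS
      rw [kbd_sub, anti _ S hS, ← hv1'' S hS, sub_neg_eq_add, add_comm]
      exact c0 S hS) (by
      have : f ∅ - (ksgn R ∅ a * y a) • v1' ∅ = ∑ j ∈ U, y j • c j := by
        rw [hc]; simp [ksgn, hv1']
      rw [this]
      refine Submodule.sum_mem _ fun j hj => Submodule.smul_mem_smul ?_ trivial
      exact Ideal.subset_span ⟨j, hj, rfl⟩)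
    refine ⟨fun S => if a ∈ S then v1' (S.erase a) else v0 S, fun S hS => ?_⟩
    by_cases haS : a ∈ S
    · have hS' : S.erase a ⊆ U := by
        intro j hj
        rw [Finset.mem_erase] at hj
        exact (Finset.mem_insert.1 (hS hj.2)).resolve_left hj.1
      rw [← Finset.insert_erase haS, e2 _ _ hS', hv1'' _ hS']
      refine kbd_congr _ _ _ fun j hj => ?_
      rw [Finset.mem_sdiff] at hj
      have : a ∉ insert j (S.erase a) := by
        simp only [Finset.mem_insert, Finset.mem_erase, ne_eq, not_true_eq_false, false_and,
          or_false]
        rintro rfl; exact haU hj.1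
      simp [Finset.erase_insert this]
    · have hS' : S ⊆ U := fun j hj =>
        (Finset.mem_insert.1 (hS hj)).resolve_left (fun h => haS (h ▸ hj))
      rw [e1 _ _ hS']
      have := hv0 S hS'
      rw [sub_eq_iff_eq_add] at this
      rw [this, add_comm]
      congr 1
      · simp [Finset.erase_insert haS]
      · refine kbd_congr _ _ _ fun j hj => ?_
        rw [Finset.mem_sdiff] at hj
        have : a ∉ insert j S := by
          simp only [Finset.mem_insert, not_or]
          exact ⟨fun h => haU (h ▸ hj.1), haS⟩
        simp [this]

/-- The Koszul complex of a weakly regular sequence is exact in positive degrees. -/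
theorem koszul_exact {g : ℕ} {y : Fin g → R} (hy : WeakReg y M) (f : Finset (Fin g) → M)
    (hf : ∀ S, kbd y Finset.univ f S = 0)
    (h0 : f ∅ ∈ Ideal.span (Set.range y) • (⊤ : Submodule R M)) :
    ∃ v : Finset (Fin g) → M, ∀ S, f S = kbd y Finset.univ v S := by
  have hU : Finset.univ.filter (fun j : Fin g => j.1 < g) = Finset.univ := by
    ext j; simp
  have := koszul_exact_aux hy g le_rfl f
  rw [hU] at this
  obtain ⟨v, hv⟩ := this (fun S _ => hf S) (by simpa using h0)
  exact ⟨v, fun S => hv S (Finset.subset_univ _)⟩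

/-- Graded version of `koszul_exact`. -/
theorem koszul_exact_card {g : ℕ} {y : Fin g → R} (hy : WeakReg y M) (i : ℕ)
    (f : Finset (Fin g) → M)
    (hf : ∀ S, S.card + 1 = i → kbd y Finset.univ f S = 0)
    (h0 : i = 0 → f ∅ ∈ Ideal.span (Set.range y) • (⊤ : Submodule R M)) :
    ∃ v : Finset (Fin g) → M, ∀ S, S.card = i → f S = kbd y Finset.univ v S := by
  obtain ⟨v, hv⟩ := koszul_exact hy (fun S => if S.card = i then f S else 0) (by
    intro S
    by_cases h : S.card + 1 = i
    · rw [← hf S h]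
      refine kbd_congr _ _ _ fun j hj => ?_
      rw [Finset.mem_sdiff] at hj
      rw [Finset.card_insert_of_notMem hj.2, if_pos h]
    · refine Finset.sum_eq_zero fun j hj => ?_
      rw [Finset.mem_sdiff] at hj
      simp only
      rw [Finset.card_insert_of_notMem hj.2, if_neg h, smul_zero]) (by
    by_cases h : i = 0
    · subst h; simpa using h0 rfl
    · simp [Ne.symm h])
  exact ⟨v, fun S hS => by rw [← hv S, if_pos hS]⟩

end Koszul

section Zigzag

variable {R : Type*} [CommRing R] {g : ℕ} {F : ℕ → Type*} [∀ i, AddCommGroup (F i)]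
  [∀ i, Module R (F i)]

/-- `ρ` is a chain map from the cochain Koszul complex `K^i(y)` to `F_{r-i}`. -/
def IsCoKoszul (y : Fin g → R) (d : ∀ i, F (i + 1) →ₗ[R] F i) (r : ℕ)
    (ρ : ∀ i, Finset (Fin g) → F i) : Prop :=
  ∀ i S, S.card + i + 1 = r → d i (ρ (i + 1) S) = kbd y Finset.univ (ρ i) S

variable {y : Fin g → R} {d : ∀ i, F (i + 1) →ₗ[R] F i} {r : ℕ}
  {ρ : ∀ i, Finset (Fin g) → F i}

/-- A null-homotopy of a Koszul family in low degree propagates upwards along exactness of `F`. -/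
theorem IsCoKoszul.homotopy_up (hρ : IsCoKoszul y d r ρ) {i₀ i : ℕ}
    (hex : ∀ i ≥ i₀, ∀ z, d i z = 0 → ∃ w, d (i + 1) w = z)
    (h0 : ∃ (s : Finset (Fin g) → F i₀) (s' : Finset (Fin g) → F (i₀ + 1)),
      ∀ S, S.card + i₀ = r → ρ i₀ S = d i₀ (s' S) + kbd y Finset.univ s S)
    (hi : i₀ ≤ i) :
    ∃ (s : Finset (Fin g) → F i) (s' : Finset (Fin g) → F (i + 1)),
      ∀ S, S.card + i = r → ρ i S = d i (s' S) + kbd y Finset.univ s S := by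
  induction i, hi using Nat.le_induction with
  | base => exact h0
  | succ i hi ih =>
    obtain ⟨s, s', h⟩ := ih
    have key : ∀ S : Finset (Fin g), ∃ w, S.card + (i + 1) = r →
        ρ (i + 1) S = d (i + 1) w + kbd y Finset.univ s' S := by
      intro S
      by_cases hS : S.card + (i + 1) = r
      · obtain ⟨w, hw⟩ := hex i hi (ρ (i + 1) S - kbd y Finset.univ s' S) (by
          rw [map_sub, hρ i S hS, map_kbd, ← kbd_sub]
          rw [← kbd_kbd y Finset.univ s S]
          refine kbd_congr _ _ _ fun j hj => ?_
          rw [Finset.mem_sdiff] at hj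
          rw [h (insert j S) (by rw [Finset.card_insert_of_notMem hj.2]; omega)]
          abel)
        exact ⟨w, fun _ => by rw [hw]; abel⟩
      · exact ⟨0, fun h => absurd h hS⟩
    choose s'' hs'' using key
    exact ⟨s', s'', hs''⟩

/-- A null-homotopy of a Koszul family in high degree propagates downwards along exactness of the
Koszul complexes `K(y; F_i)`. -/
theorem IsCoKoszul.homotopy_down (hρ : IsCoKoszul y d r ρ)
    (hdd : ∀ i z, d i (d (i + 1) z) = 0) (hy : ∀ i, WeakReg y (F i))
    (h0 : ∃ (s : Finset (Fin g) → F r) (s' : Finset (Fin g) → F (r + 1)),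
      ρ r ∅ = d r (s' ∅) + kbd y Finset.univ s ∅) (k i : ℕ) (hk : i + k = r) :
    ∃ (s : Finset (Fin g) → F i) (s' : Finset (Fin g) → F (i + 1)),
      ∀ S, S.card + i = r → ρ i S = d i (s' S) + kbd y Finset.univ s S := by
  induction k generalizing i with
  | zero =>
    obtain rfl : i = r := by omega
    obtain ⟨s, s', h⟩ := h0
    refine ⟨s, s', fun S hS => ?_⟩
    obtain rfl : S = ∅ := Finset.card_eq_zero.1 (by omega)
    exact h
  | succ k ih =>
    obtain ⟨s, s', h⟩ := ih (i + 1) (by omega)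
    obtain ⟨t, ht⟩ := koszul_exact_card (hy i) (k + 1) (fun S => ρ i S - d i (s S)) (by
      intro S hS
      rw [kbd_sub, ← hρ i S (by omega), ← map_kbd, h S (by omega), map_add, hdd]
      simp) (by simp)
    refine ⟨t, s, fun S hS => ?_⟩
    rw [← ht S (by omega)]
    abel

/-- Extend an element of `F_r` whose boundary lies in `(y) F_{r-1}` to a Koszul family. -/
theorem exists_isCoKoszul (hdd : ∀ i z, d i (d (i + 1) z) = 0) (hy : ∀ i, WeakReg y (F i))
    (v : F r) (hv : ∀ i (h : i + 1 = r),
      d i (h ▸ v) ∈ Ideal.span (Set.range y) • (⊤ : Submodule R (F i))) :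
    ∃ ρ : ∀ i, Finset (Fin g) → F i, ρ r ∅ = v ∧ IsCoKoszul y d r ρ := by
  suffices H : ∀ k ≤ r, ∃ ρ : ∀ i, Finset (Fin g) → F i, ρ r ∅ = v ∧
      ∀ i, r ≤ i + k → ∀ S, S.card + i + 1 = r →
        d i (ρ (i + 1) S) = kbd y Finset.univ (ρ i) S by
    obtain ⟨ρ, h1, h2⟩ := H r le_rfl
    exact ⟨ρ, h1, fun i S hS => h2 i (by omega) S hS⟩
  intro k
  induction k with
  | zero =>
    intro _
    refine ⟨fun i _ => if h : i = r then h ▸ v else 0, by simp, fun i hi S hS => by omega⟩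
  | succ k ih =>
    intro hk
    obtain ⟨ρ, h1, h2⟩ := ih (by omega)
    obtain ⟨i, hi⟩ : ∃ i, i + k + 1 = r := ⟨r - (k + 1), by omega⟩
    obtain ⟨t, ht⟩ := koszul_exact_card (hy i) k (fun S => d i (ρ (i + 1) S)) (by
      intro S hS
      rw [← map_kbd, ← h2 (i + 1) (by omega) S (by omega), hdd]) (by
      intro h0
      subst h0
      have e : i + 1 = r := by omega
      have := hv i e
      subst e
      rwa [h1])
    refine ⟨Function.update ρ i t, ?_, ?_⟩
    · rw [Function.update_of_ne (by omega)]
      exact h1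
    · intro l hl S hS
      by_cases hli : l = i
      · subst hli
        rw [Function.update_self, Function.update_of_ne (by omega)]
        exact ht S (by omega)
      · rw [Function.update_of_ne (by omega), Function.update_of_ne hli]
        exact h2 l (by omega) S hS

variable {s : ℕ}

/-- `ψ` is a chain map from the Koszul complex on `x_j`, `j ∈ U`, to `F`, in coordinates. -/
def IsKoszulMap (U : Finset (Fin s)) (x : Fin s → R) (d : ∀ i, F (i + 1) →ₗ[R] F i)
    (ψ : ∀ i, Finset (Fin s) → F i) : Prop :=
  ∀ i T, T ⊆ U → T.card = i + 1 →
    d i (ψ (i + 1) T) = ∑ j ∈ T, (ksgn R (T.erase j) j * x j) • ψ i (T.erase j)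

theorem IsKoszulMap.mem_span {U : Finset (Fin s)} {x : Fin s → R}
    {ψ : ∀ i, Finset (Fin s) → F i}
    (hψ : IsKoszulMap U x d ψ) {a : Ideal R} (hx : ∀ j ∈ U, x j ∈ a) {i : ℕ}
    (hU : U.card = i + 1) : d i (ψ (i + 1) U) ∈ a • (⊤ : Submodule R (F i)) := by
  rw [hψ i U subset_rfl hU]
  exact Submodule.sum_mem _ fun j hj =>
    Submodule.smul_mem_smul (a.mul_mem_left _ (hx j hj)) trivial

/-- Compose a Koszul family valued in `K_•(x)` with a map `K_•(x) → F`. -/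
theorem IsKoszulMap.comp_coKoszul {U : Finset (Fin s)} {x : Fin s → R}
    {ψ : ∀ i, Finset (Fin s) → F i} (hψ : IsKoszulMap U x d ψ)
        (χ : ℕ → Finset (Fin g) → Finset (Fin s) → R)
    (hχ : ∀ i S T, S.card + i + 1 = r → T.card = i → T ⊆ U →
      kbd x U (χ (i + 1) S) T = kbd y Finset.univ (fun S => χ i S T) S) :
    IsCoKoszul y d r (fun i S => ∑ T ∈ U.powersetCard i, χ i S T • ψ i T) := by
  intro i S hS
  have e1 : kbd y Finset.univ (fun S => ∑ T ∈ U.powersetCard i, χ i S T • ψ i T) S =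
      ∑ T ∈ U.powersetCard i, kbd x U (χ (i + 1) S) T • ψ i T := by
    simp only [kbd, Finset.smul_sum]
    rw [Finset.sum_comm]
    refine Finset.sum_congr rfl fun T hT => ?_
    rw [Finset.mem_powersetCard] at hT
    have := hχ i S T hS hT.2 hT.1
    simp only [kbd] at this
    rw [this, Finset.sum_smul]
    refine Finset.sum_congr rfl fun j _ => ?_
    rw [smul_smul, smul_eq_mul]
  rw [e1, map_sum]
  simp only [map_smul]
  have e2 : ∀ T ∈ U.powersetCard (i + 1), χ (i + 1) S T • d i (ψ (i + 1) T) =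
      ∑ j ∈ T, χ (i + 1) S T • (ksgn R (T.erase j) j * x j) • ψ i (T.erase j) := by
    intro T hT
    rw [Finset.mem_powersetCard] at hT
    rw [hψ i T hT.1 hT.2, Finset.smul_sum]
  rw [Finset.sum_congr rfl e2]
  simp only [kbd, Finset.sum_smul]
  rw [Finset.sum_sigma', Finset.sum_sigma']
  refine Finset.sum_bij' (fun p _ => ⟨p.1.erase p.2, p.2⟩) (fun p _ => ⟨insert p.2 p.1, p.2⟩)
    ?_ ?_ ?_ ?_ ?_
  · rintro ⟨T, j⟩ h
    simp only [Finset.mem_sigma, Finset.mem_powersetCard, Finset.mem_sdiff] at h ⊢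
    refine ⟨⟨(Finset.erase_subset _ _).trans h.1.1, ?_⟩, h.1.1 h.2, by simp⟩
    rw [Finset.card_erase_of_mem h.2, h.1.2]; rfl
  · rintro ⟨T, j⟩ h
    simp only [Finset.mem_sigma, Finset.mem_powersetCard, Finset.mem_sdiff] at h ⊢
    refine ⟨⟨Finset.insert_subset h.2.1 h.1.1, ?_⟩, by simp⟩
    rw [Finset.card_insert_of_notMem h.2.2, h.1.2]
  · rintro ⟨T, j⟩ h
    simp only [Finset.mem_sigma, Finset.mem_powersetCard] at h
    simp [Finset.insert_erase h.2]
  · rintro ⟨T, j⟩ h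
    simp only [Finset.mem_sigma, Finset.mem_powersetCard, Finset.mem_sdiff] at h ⊢
    simp [Finset.erase_insert h.2.2]
  · rintro ⟨T, j⟩ h
    simp only [Finset.mem_sigma, Finset.mem_powersetCard] at h
    rw [Finset.insert_erase h.2, smul_smul, smul_eq_mul, mul_comm]

theorem WeakReg.pi {ι : Type*} {M : ι → Type*} [Finite ι] [∀ i, AddCommGroup (M i)]
    [∀ i, Module R (M i)] (h : ∀ i, WeakReg y (M i)) : WeakReg y (∀ i, M i) := by
  classical
  cases nonempty_fintype ι
  have key : ∀ (a : Ideal R) (m : ∀ i, M i), m ∈ a • (⊤ : Submodule R (∀ i, M i)) ↔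
      ∀ i, m i ∈ a • (⊤ : Submodule R (M i)) := by
    intro a m
    constructor
    · intro hm i
      have := Submodule.mem_map_of_mem (f := LinearMap.proj i) hm
      rw [Submodule.map_smul''] at this
      exact Submodule.smul_mono le_rfl le_top this
    · intro hm
      have : m = ∑ i, LinearMap.single R M i (m i) := by
        ext j; simp [Finset.sum_apply]
      rw [this]
      refine Submodule.sum_mem _ fun i _ => ?_
      have := Submodule.mem_map_of_mem (f := LinearMap.single R M i) (hm i)
      rw [Submodule.map_smul''] at this
      exact Submodule.smul_mono le_rfl le_top this
  intro i m hm
  rw [key] at hm ⊢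
  exact fun j => h j i _ (hm j)

theorem WeakReg.of_retract {M N : Type*} [AddCommGroup M] [Module R M] [AddCommGroup N]
    [Module R N] (f : M →ₗ[R] N) (p : N →ₗ[R] M) (h : ∀ m, p (f m) = m) (hN : WeakReg y N) :
    WeakReg y M := by
  intro i m hm
  have h1 := Submodule.mem_map_of_mem (f := f) hm
  rw [Submodule.map_smul'', map_smul] at h1
  have h2 := Submodule.mem_map_of_mem (f := p) (hN i _ (Submodule.smul_mono le_rfl le_top h1))
  rw [Submodule.map_smul'', h] at h2
  exact Submodule.smul_mono le_rfl le_top h2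

theorem WeakReg.finsupp {ι : Type*} (h : WeakReg y R) : WeakReg y (ι →₀ R) := by
  classical
  have key : ∀ (a : Ideal R) (m : ι →₀ R), m ∈ a • (⊤ : Submodule R (ι →₀ R)) ↔
      ∀ i, m i ∈ a • (⊤ : Submodule R R) := by
    intro a m
    constructor
    · intro hm i
      have := Submodule.mem_map_of_mem (f := Finsupp.lapply i) hm
      rw [Submodule.map_smul''] at this
      exact Submodule.smul_mono le_rfl le_top this
    · intro hm
      rw [← Finsupp.sum_single m]
      refine Submodule.sum_mem _ fun i _ => ?_
      have := Submodule.mem_map_of_mem (f := Finsupp.lsingle (R := R) i) (hm i)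
      rw [Submodule.map_smul''] at this
      exact Submodule.smul_mono le_rfl le_top this
  intro i m hm
  rw [key] at hm ⊢
  exact fun j => h i _ (hm j)

theorem WeakReg.projective {P : Type*} [AddCommGroup P] [Module R P] [Module.Projective R P]
    (h : WeakReg y R) : WeakReg y P := by
  obtain ⟨s, hs⟩ := (Module.projective_def' (R := R) (P := P)).1 inferInstance
  exact WeakReg.of_retract s (Finsupp.linearCombination R id) (fun m => LinearMap.congr_fun hs m)
      (WeakReg.finsupp h)

end Zigzag

section Acyclicity

open RingTheory.Sequence

variable {R : Type*} [CommRing R]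

theorem weakReg_iff_isWeaklyRegular {g : ℕ} {y : Fin g → R} {M : Type*} [AddCommGroup M]
    [Module R M] : WeakReg y M ↔ IsWeaklyRegular M (List.ofFn y) := by
  have e : ∀ i : Fin g, Ideal.ofList ((List.ofFn y).take i) = Ideal.span (y '' {j | j < i}) := by
    intro i
    rw [Ideal.ofList]
    congr 1
    ext a
    simp only [Set.mem_ofPred_eq, Set.mem_image, List.mem_take_iff_getElem]
    constructor
    · rintro ⟨l, hl, rfl⟩
      simp only [List.length_ofFn, lt_min_iff] at hl
      exact ⟨⟨l, hl.2⟩, hl.1, by simp⟩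
    · rintro ⟨j, hj, rfl⟩
      exact ⟨j, by simp only [List.length_ofFn, lt_min_iff]; exact ⟨hj, j.2⟩, by simp⟩
  constructor
  · intro h
    refine ⟨fun i hi => ?_⟩
    have hi' : i < g := by simpa using hi
    rw [isSMulRegular_quotient_iff_mem_of_smul_mem]
    intro m hm
    rw [e ⟨i, hi'⟩] at hm ⊢
    refine h ⟨i, hi'⟩ m ?_
    simpa using hm
  · intro h i m hm
    have := h.regular_mod_prev i (by simp)
    rw [isSMulRegular_quotient_iff_mem_of_smul_mem] at this
    rw [← e i] at hm ⊢
    exact this m (by simpa using hm)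

/-- The acyclicity lemma: a complex of modules of large depth whose homology is killed by powers
of a regular sequence is exact. -/
theorem exact_of_isWeaklyRegular (ws : List R) {F : ℕ → Type*} [∀ i, AddCommGroup (F i)]
    [∀ i, Module R (F i)] (d : ∀ i, F (i + 1) →ₗ[R] F i) (hdd : ∀ i z, d i (d (i + 1) z) = 0)
    (p : ℕ) (hreg : ∀ i, IsWeaklyRegular (F i) ws)
    (h0 : ∀ i ≥ p + 1 + ws.length, ∀ z : F i, z = 0)
    (ht : ∀ w ∈ ws, ∃ t : ℕ, ∀ i ≥ p, ∀ z, d i z = 0 → ∃ u, d (i + 1) u = w ^ t • z) :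
    ∀ i ≥ p, ∀ z, d i z = 0 → ∃ u, d (i + 1) u = z := by
  induction ws generalizing F p with
  | nil =>
    intro i hi z _
    exact ⟨0, by rw [map_zero, h0 (i + 1) (by simp; omega) z]⟩
  | cons w ws ih =>
    simp only [isWeaklyRegular_cons_iff] at hreg
    have hmk : ∀ i (z : F i), (Submodule.Quotient.mk z : QuotSMulTop w (F i)) = 0 ↔
        ∃ a, w • a = z := by
      intro i z
      rw [Submodule.Quotient.mk_eq_zero, Submodule.mem_smul_pointwise_iff_exists]
      simp
    have hC : ∀ i ≥ p + 1, ∀ z : QuotSMulTop w (F (i + 1)),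
        QuotSMulTop.map w (d i) z = 0 → ∃ u, QuotSMulTop.map w (d (i + 1)) u = z := by
      refine ih (fun i => QuotSMulTop.map w (d i)) ?_ (p + 1) (fun i => (hreg i).2) ?_ ?_
      · intro i z
        obtain ⟨z, rfl⟩ := Submodule.Quotient.mk_surjective _ z
        rw [QuotSMulTop.map_apply_mk, QuotSMulTop.map_apply_mk, hdd]
        rfl
      · intro i hi z
        obtain ⟨z, rfl⟩ := Submodule.Quotient.mk_surjective _ z
        rw [h0 i (by simp; omega) z]
        rfl
      · intro v hv
        obtain ⟨t, ht⟩ := ht v (List.mem_cons_of_mem _ hv)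
        refine ⟨2 * t, fun i hi z hz => ?_⟩
        obtain ⟨z, rfl⟩ := Submodule.Quotient.mk_surjective _ z
        rw [QuotSMulTop.map_apply_mk, hmk] at hz
        obtain ⟨a, ha⟩ := hz
        obtain ⟨i, rfl⟩ : ∃ l, i = l + 1 := ⟨i - 1, by omega⟩
        have hda : d i a = 0 := by
          apply (hreg i).1
          change w • d i a = w • 0
          rw [← map_smul, ha, hdd, smul_zero]
        obtain ⟨b, hb⟩ := ht i (by omega) a hda
        obtain ⟨u, hu⟩ := ht (i + 1) (by omega)
          (v ^ t • z - w • b) (by rw [map_sub, map_smul, map_smul, hb, ← ha, smul_comm, sub_self])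
        refine ⟨Submodule.Quotient.mk u, ?_⟩
        rw [QuotSMulTop.map_apply_mk, hu, ← sub_eq_zero, ← Submodule.Quotient.mk_smul,
          ← Submodule.Quotient.mk_sub, hmk]
        exact ⟨-(v ^ t • b), by
          rw [smul_sub, smul_smul, ← pow_add, ← two_mul, smul_neg, smul_comm]; abel⟩
    have step : ∀ i ≥ p, ∀ z u, d (i + 1) u = w • z → ∃ u', d (i + 1) u' = z := by
      intro i hi z u hu
      obtain ⟨u', hu'⟩ := hC (i + 1) (by omega) (Submodule.Quotient.mk u) (by
        rw [QuotSMulTop.map_apply_mk, hmk]; exact ⟨z, hu.symm⟩)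
      obtain ⟨u', rfl⟩ := Submodule.Quotient.mk_surjective _ u'
      rw [QuotSMulTop.map_apply_mk, ← sub_eq_zero, ← Submodule.Quotient.mk_sub, hmk] at hu'
      obtain ⟨a, ha⟩ := hu'
      refine ⟨-a, ?_⟩
      apply (hreg (i + 1)).1
      change w • d (i + 1) (-a) = w • z
      rw [← map_smul, smul_neg, ha, ← hu]
      simp [hdd]
    intro i hi z hz
    obtain ⟨t, ht⟩ := ht w List.mem_cons_self
    obtain ⟨u, hu⟩ := ht i hi z hz
    clear ht
    induction t generalizing u with
    | zero => exact ⟨u, by rw [hu, pow_zero, one_smul]⟩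
    | succ t iht =>
      obtain ⟨u', hu'⟩ := step i hi (w ^ t • z) u (by rw [hu, smul_smul, pow_succ'])
      exact iht u' hu'

end Acyclicity

section Certificate

open RingTheory.Sequence Matrix

/-- A finite free complex in coordinates, with null-homotopies for powers of `z`, a map from a
Koszul complex on `x`, and a functional witnessing that the image of `e_U` is not in
`im d + (z)`. -/
structure KoszulCert (B : Type*) [CommRing B] (n r s M : ℕ) (b : ℕ → ℕ) (U : Finset (Fin s)) where
  z : Fin n → B
  x : Fin s → B
  D : ∀ i, Matrix (Fin (b i)) (Fin (b (i + 1))) B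
  h : Fin n → ∀ i, Matrix (Fin (b (i + 1))) (Fin (b i)) B
  ψ : ∀ i, Finset (Fin s) → Fin (b i) → B
  lam : Fin (b r) → B
  mu : Fin n → Fin (b (r + 1)) → B
  b_eq : ∀ i > n, b i = 0
  DD : ∀ i, D i * D (i + 1) = 0
  homotopy : ∀ j i, D (i + 1) * h j (i + 1) + h j i * D i = z j ^ M • 1
  koszul : ∀ i T, T ⊆ U → T.card = i + 1 →
    D i *ᵥ ψ (i + 1) T = ∑ j ∈ T, (ksgn B (T.erase j) j * x j) • ψ i (T.erase j)
  lam_ψ : lam ⬝ᵥ ψ r U = 1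
  lam_D : lam ᵥ* D r = ∑ j, z j • mu j

namespace KoszulCert

variable {B B' : Type*} [CommRing B] [CommRing B'] {n r s M : ℕ} {b : ℕ → ℕ} {U : Finset (Fin s)}

/-- Base change of a certificate. -/
def map (C : KoszulCert B n r s M b U) (f : B →+* B') : KoszulCert B' n r s M b U where
  z j := f (C.z j)
  x j := f (C.x j)
  D i := (C.D i).map f
  h j i := (C.h j i).map f
  ψ i T a := f (C.ψ i T a)
  lam a := f (C.lam a)
  mu j a := f (C.mu j a)
  b_eq := C.b_eq
  DD i := by rw [← Matrix.map_mul, C.DD, Matrix.map_zero _ (map_zero f)]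
  homotopy j i := by
    rw [← Matrix.map_mul, ← Matrix.map_mul, ← Matrix.map_add _ (map_add f), C.homotopy]
    ext a c
    simp [Matrix.one_apply, apply_ite f]
  koszul i T hT hc := by
    ext a
    have := congrArg f (congrFun (C.koszul i T hT hc) a)
    simpa [Matrix.mulVec, dotProduct, ksgn] using this
  lam_ψ := by
    have := congrArg f C.lam_ψ
    simpa [dotProduct] using this
  lam_D := by
    ext a
    have := congrArg f (congrFun C.lam_D a)
    simpa [Matrix.vecMul, dotProduct] using this

/-- Descend a certificate along an injective ring homomorphism hitting all its entries. -/
theorem exists_map_eq (C : KoszulCert B' n r s M b U) (f : B →+* B')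
    (hf : Function.Injective f) (hz : ∀ j, C.z j ∈ f.range) (hx : ∀ j, C.x j ∈ f.range)
    (hD : ∀ i a c, C.D i a c ∈ f.range) (hh : ∀ j i a c, C.h j i a c ∈ f.range)
    (hψ : ∀ i T a, C.ψ i T a ∈ f.range) (hl : ∀ a, C.lam a ∈ f.range)
    (hm : ∀ j a, C.mu j a ∈ f.range) : ∃ C' : KoszulCert B n r s M b U,
      (∀ j, f (C'.z j) = C.z j) ∧ (∀ j, f (C'.x j) = C.x j) := by
  choose z hz using hz
  choose x hx using hx
  choose D hD using hD
  choose h hh using hh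
  choose ψ hψ using hψ
  choose lam hl using hl
  choose mu hm using hm
  refine ⟨⟨z, x, fun i => Matrix.of (D i), fun j i => Matrix.of (h j i), ψ, lam, mu, C.b_eq,
    ?_, ?_, ?_, ?_, ?_⟩, hz, hx⟩
  · intro i
    ext a c
    apply hf
    have := congrFun (congrFun (C.DD i) a) c
    simpa [Matrix.mul_apply, hD] using this
  · intro j i
    ext a c
    apply hf
    have := congrFun (congrFun (C.homotopy j i) a) c
    simpa [Matrix.mul_apply, hD, hh, hz, Matrix.one_apply, apply_ite f] using this
  · intro i T hT hc
    ext a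
    apply hf
    have := congrFun (C.koszul i T hT hc) a
    simpa [Matrix.mulVec, dotProduct, ksgn, hD, hψ, hx] using this
  · apply hf
    have := C.lam_ψ
    simpa [dotProduct, hl, hψ] using this
  · ext a
    apply hf
    have := congrFun C.lam_D a
    simpa [Matrix.vecMul, dotProduct, hl, hD, hz, hm] using this

/-- The complex underlying a certificate is exact in high degrees over a ring of large depth. -/
theorem exact (C : KoszulCert B n r s M b U) (ws : List B) (hws : IsWeaklyRegular B ws)
    (p : ℕ) (hlen : n ≤ p + ws.length)
    (hw : ∀ w ∈ ws, ∃ t : ℕ, w ^ t ∈ Ideal.span (Set.range C.z)) :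
    ∀ i ≥ p, ∀ v, C.D i *ᵥ v = 0 → ∃ u, C.D (i + 1) *ᵥ u = v := by
  refine exact_of_isWeaklyRegular ws (F := fun i => Fin (b i) → B) (fun i => (C.D i).mulVecLin)
    (fun i v => ?_) p (fun i => ?_) (fun i hi v => ?_) (fun w hwm => ?_)
  · simp [C.DD]
  · have : WeakReg (fun i => ws.get i) B := by
      rw [weakReg_iff_isWeaklyRegular, List.ofFn_get]; exact hws
    have := weakReg_iff_isWeaklyRegular.1 (WeakReg.pi (fun _ : Fin (b i) => this))
    rwa [List.ofFn_get] at this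
  · have := C.b_eq i (by omega)
    ext a
    exact (Fin.cast this a).elim0
  · obtain ⟨t, ht⟩ := hw w hwm
    have h1 : Ideal.span (Set.range C.z) ≤
        (Ideal.span (Set.range fun j => C.z j ^ M)).radical := by
      rw [Ideal.span_le]
      rintro _ ⟨j, rfl⟩
      exact ⟨M, Ideal.subset_span ⟨j, rfl⟩⟩
    obtain ⟨t', ht'⟩ := h1 ht
    rw [← pow_mul, Ideal.mem_span_range_iff_exists_fun] at ht'
    obtain ⟨a, ha⟩ := ht'
    refine ⟨t * t', fun i _ v hv => ⟨∑ j, a j • C.h j (i + 1) *ᵥ v, ?_⟩⟩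
    have e : ∀ j, C.D (i + 1) *ᵥ (C.h j (i + 1) *ᵥ v) = C.z j ^ M • v := by
      intro j
      have := congrArg (· *ᵥ v) (C.homotopy j i)
      simp only [Matrix.add_mulVec, ← Matrix.mulVec_mulVec, Matrix.smul_mulVec,
        Matrix.one_mulVec] at this
      change C.D i *ᵥ v = 0 at hv
      rw [hv, Matrix.mulVec_zero, add_zero] at this
      exact this
    rw [map_sum, ← ha, Finset.sum_smul]
    refine Finset.sum_congr rfl fun j _ => ?_
    rw [map_smul, Matrix.mulVecLin_apply, e, smul_smul]

end KoszulCert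

/-- A chain map from the cochain Koszul complex on `y` to the chain Koszul complex on `x_j`,
`j ∈ U`, which is multiplication by `c` in top degree. -/
structure IsColonFamily {B : Type*} [CommRing B] {g s : ℕ} (y : Fin g → B) (x : Fin s → B)
    (U : Finset (Fin s)) (c : B) (χ : ℕ → Finset (Fin g) → Finset (Fin s) → B) : Prop where
  comm : ∀ i S T, S.card + i + 1 = U.card → T.card = i → T ⊆ U →
    kbd x U (χ (i + 1) S) T = kbd y Finset.univ (fun S => χ i S T) S
  top : χ U.card ∅ U = c

section

variable {B : Type*} [CommRing B] {g s : ℕ}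

theorem exists_isColonFamily {y : Fin g → B} {x : Fin s → B} {U : Finset (Fin s)} {c : B}
    (hy : WeakReg y B) (hc : ∀ j ∈ U, c * x j ∈ Ideal.span (Set.range y)) :
    ∃ χ, IsColonFamily y x U c χ := by
  classical
  let D : (Finset (Fin s) → B) →ₗ[B] (Finset (Fin s) → B) :=
    { toFun := fun w => kbd x U w
      map_add' := fun v w => by ext S; exact kbd_add x U v w S
      map_smul' := fun a w => by
        ext S
        exact (map_kbd (LinearMap.lsmul B B a) x U w S).symm }
  obtain ⟨ρ, h1, h2⟩ := exists_isCoKoszul (F := fun _ => Finset (Fin s) → B) (d := fun _ => D)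
    (r := U.card) (fun i z => by ext S; exact kbd_kbd x U z S) (fun i => WeakReg.pi fun _ => hy)
    (Pi.single U c) (by
      intro i hi
      rw [eq_rec_constant]
      have : D (Pi.single U c) = ∑ j ∈ U, Pi.single (U.erase j) (ksgn B (U.erase j) j * x j * c) :=
          by
        ext S
        change kbd x U _ S = _
        rw [kbd, Finset.sum_apply]
        by_cases hS : ∃ j ∈ U, S = U.erase j
        · obtain ⟨j, hj, rfl⟩ := hS
          rw [Finset.sum_eq_single j, Finset.sum_eq_single j]
          · simp [Finset.insert_erase hj]
          · intro l hl hlj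
            rw [Pi.single_eq_of_ne]
            intro h
            have : j ∉ U.erase j := by simp
            rw [h] at this
            exact this (Finset.mem_erase.2 ⟨hlj.symm, hj⟩)
          · exact fun h => absurd hj h
          · intro l hl hlj
            simp only [Finset.mem_sdiff, Finset.mem_erase] at hl
            tauto
          · simp [hj]
        · rw [Finset.sum_eq_zero, Finset.sum_eq_zero]
          · intro j hj
            rw [Pi.single_eq_of_ne]
            rintro rfl
            exact hS ⟨j, hj, rfl⟩
          · intro j hj
            rw [Finset.mem_sdiff] at hj
            rw [Pi.single_eq_of_ne, smul_zero]
            intro h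
            exact hS ⟨j, hj.1, by rw [← h, Finset.erase_insert hj.2]⟩
      rw [this]
      refine Submodule.sum_mem _ fun j hj => ?_
      have e2 : (Pi.single (U.erase j) (ksgn B (U.erase j) j * x j * c) : Finset (Fin s) → B) =
          (c * x j) • Pi.single (U.erase j) (ksgn B (U.erase j) j) := by
        rw [← Pi.single_smul, smul_eq_mul]
        congr 1
        ring
      rw [e2]
      exact Submodule.smul_mem_smul (hc j hj) trivial)
  refine ⟨ρ, ⟨fun i S T hS hT hTU => ?_, by rw [h1, Pi.single_eq_same]⟩⟩
  have := congrFun (h2 i S hS) T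
  change kbd x U (ρ (i + 1) S) T = _ at this
  rw [this]
  exact map_kbd (LinearMap.proj T : (Finset (Fin s) → B) →ₗ[B] B) y Finset.univ (ρ i) S

theorem IsColonFamily.map {B' : Type*} [CommRing B'] {y : Fin g → B} {x : Fin s → B}
    {U : Finset (Fin s)} {c : B} {χ : ℕ → Finset (Fin g) → Finset (Fin s) → B}
    (h : IsColonFamily y x U c χ) (f : B →+* B') :
    IsColonFamily (fun j => f (y j)) (fun j => f (x j)) U (f c) (fun i S T => f (χ i S T)) where
  comm i S T hS hT hU := by
    have := congrArg f (h.comm i S T hS hT hU)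
    simpa [kbd, ksgn] using this
  top := by rw [h.top]

variable {n r M : ℕ} {b : ℕ → ℕ} {U : Finset (Fin s)}

open RingTheory.Sequence in
/-- If `x = t ^ q`, then the colon multiplier of the `t`'s lies in `(z) + (y)`. -/
theorem KoszulCert.mem_of_isColonFamily (C : KoszulCert B n r s M b U) (hU : U.card = r)
    (x : Fin s → B) {q : ℕ} (hq : 0 < q) (hx : ∀ j, C.x j = x j ^ q)
    (ws : List B) (hws : IsWeaklyRegular B ws) (hlen : n ≤ 1 + ws.length)
    (hw : ∀ w ∈ ws, ∃ t : ℕ, w ^ t ∈ Ideal.span (Set.range C.z))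
    {y : Fin g → B} {c : B} {χ : ℕ → Finset (Fin g) → Finset (Fin s) → B}
    (hχ : IsColonFamily y x U c χ) (hg : g + 2 ≤ r) :
    c ∈ Ideal.span (Set.range C.z) ⊔ Ideal.span (Set.range y) := by
  classical
  set ψ : ∀ i, Finset (Fin s) → Fin (b i) → B :=
    fun i T => (∏ j ∈ U \ T, x j ^ (q - 1)) • C.ψ i T with hψ
  have hk : IsKoszulMap U x (fun i => (C.D i).mulVecLin) ψ := by
    intro i T hT hc
    rw [hψ]
    simp only [map_smul, Matrix.mulVecLin_apply]
    rw [C.koszul i T hT hc, Finset.smul_sum]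
    refine Finset.sum_congr rfl fun j hj => ?_
    rw [smul_smul, smul_smul]
    have : U \ T.erase j = insert j (U \ T) := by
      ext l
      simp only [Finset.mem_sdiff, Finset.mem_erase, Finset.mem_insert]
      by_cases hl : l = j
      · subst hl; simp [hT hj]
      · tauto
    rw [this, Finset.prod_insert (by simp [hj]), hx]
    congr 1
    obtain ⟨q, rfl⟩ : ∃ l, q = l + 1 := ⟨q - 1, by omega⟩
    simp only [Nat.add_sub_cancel]
    ring
  have hρ := hk.comp_coKoszul (r := r) χ (fun i S T hS => hχ.comm i S T (by omega))
  obtain ⟨v, u, hvu⟩ := hρ.homotopy_up (i₀ := r - g - 1) (i := r)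
    (fun i hi z hz => C.exact ws hws 1 hlen hw i (by omega) z hz)
    ⟨0, 0, fun S hS => absurd (Finset.card_le_univ S) (by simp; omega)⟩ (by omega)
  have h1 := hvu ∅ (by simp)
  rw [Finset.sum_eq_single_of_mem U (by simp [hU])] at h1
  swap
  · intro T hT hne
    rw [Finset.mem_powersetCard] at hT
    exact absurd (Finset.eq_of_subset_of_card_le hT.1 (by omega)) hne
  have h2 : χ r ∅ U = c := by rw [← hU]; exact hχ.top
  have h3 := congrArg (fun w => C.lam ⬝ᵥ w) h1
  simp only [h2, hψ, Finset.sdiff_self, Finset.prod_empty, one_smul, dotProduct_smul, C.lam_ψ,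
    Matrix.mulVecLin_apply, dotProduct_add, Matrix.dotProduct_mulVec, C.lam_D, smul_eq_mul,
    mul_one] at h3
  rw [h3]
  refine Submodule.add_mem_sup ?_ ?_
  · rw [sum_dotProduct]
    refine Submodule.sum_mem _ fun j _ => ?_
    rw [smul_dotProduct]
    exact Ideal.mul_mem_right _ _ (Ideal.subset_span ⟨j, rfl⟩)
  · rw [kbd, dotProduct_sum]
    refine Submodule.sum_mem _ fun j _ => ?_
    rw [dotProduct_smul, smul_eq_mul]
    exact Ideal.mul_mem_right _ _ (Ideal.mul_mem_left _ _ (Ideal.subset_span ⟨j, rfl⟩))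

open RingTheory.Sequence in
theorem KoszulCert.mem_of_expChar (C : KoszulCert B n r s M b U) (hU : U.card = r)
    (p : ℕ) [ExpChar B p] (ws : List B) (hws : IsWeaklyRegular B ws) (hlen : n ≤ 1 + ws.length)
    (hw : ∀ w ∈ ws, w ∈ Ideal.span (Set.range C.z))
    {y : Fin g → B} {c : B} {χ : ℕ → Finset (Fin g) → Finset (Fin s) → B}
    (hχ : IsColonFamily y C.x U c χ) (hg : g + 2 ≤ r) (e : ℕ) :
    c ∈ Ideal.span (Set.range fun j => C.z j ^ p ^ e) ⊔ Ideal.span (Set.range y) := by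
  have hp := expChar_pos B p
  have e1 : ∀ j, (C.map (iterateFrobenius B p e)).z j = C.z j ^ p ^ e := fun j => by
    simp [KoszulCert.map, iterateFrobenius_def]
  have e2 : (C.map (iterateFrobenius B p e)).z = fun j => C.z j ^ p ^ e := funext e1
  rw [← e2]
  refine (C.map (iterateFrobenius B p e)).mem_of_isColonFamily hU C.x (q := p ^ e) (by positivity)
    (fun j => by simp [KoszulCert.map, iterateFrobenius_def]) ws hws hlen (fun w hwm => ?_) hχ hg
  refine ⟨p ^ e, ?_⟩
  have := Ideal.mem_map_of_mem (iterateFrobenius B p e) (hw w hwm)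
  rw [Ideal.map_span, ← Set.range_comp, iterateFrobenius_def] at this
  exact this

end

end Certificate

section RegularLocal

open IsLocalRing RingTheory.Sequence

universe v

theorem isLocalRing_quotient_span_singleton {R : Type v} [CommRing R] [IsLocalRing R] {w : R}
    (hw : w ∈ maximalIdeal R) : IsLocalRing (R ⧸ Ideal.span {w}) := by
  have : Nontrivial (R ⧸ Ideal.span {w}) := Ideal.Quotient.nontrivial_iff.2 fun h =>
    (Ideal.IsMaximal.ne_top inferInstance : maximalIdeal R ≠ ⊤)
      (top_le_iff.1 (h ▸ (Ideal.span_singleton_le_iff_mem _).2 hw))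
  exact IsLocalRing.of_surjective' _ Ideal.Quotient.mk_surjective

theorem maximalIdeal_quotient_eq_map {R : Type v} [CommRing R] [IsLocalRing R] (a : Ideal R)
    [IsLocalRing (R ⧸ a)] : maximalIdeal (R ⧸ a) = (maximalIdeal R).map (Ideal.Quotient.mk a) := by
  refine le_antisymm ?_ ?_
  · intro u hu
    obtain ⟨u, rfl⟩ := Ideal.Quotient.mk_surjective u
    exact Ideal.mem_map_of_mem _ fun h => hu (h.map _)
  · exact ((IsLocalRing.local_hom_TFAE (Ideal.Quotient.mk a)).out 0 2).1
      (IsLocalHom.of_surjective _ Ideal.Quotient.mk_surjective)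

theorem regular_quotient {R : Type v} [CommRing R] [IsLocalRing R] [IsNoetherianRing R] {n : ℕ}
    {w : R} {z : Fin n → R} (hz : Ideal.span (insert w (Set.range z)) = maximalIdeal R)
    (hdim : ringKrullDim R = (n + 1 : ℕ)) [IsLocalRing (R ⧸ Ideal.span {w})] :
    Ideal.span (Set.range fun i => Ideal.Quotient.mk (Ideal.span {w}) (z i)) =
      maximalIdeal (R ⧸ Ideal.span {w}) ∧ ringKrullDim (R ⧸ Ideal.span {w}) = n := by
  have h1 : Ideal.span (Set.range fun i => Ideal.Quotient.mk (Ideal.span {w}) (z i)) =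
      maximalIdeal (R ⧸ Ideal.span {w}) := by
    rw [maximalIdeal_quotient_eq_map, ← hz, Ideal.map_span, Set.image_insert_eq,
      ← Set.range_comp]
    have : Ideal.Quotient.mk (Ideal.span {w}) w = 0 :=
      Ideal.Quotient.eq_zero_iff_mem.2 (Ideal.mem_span_singleton_self w)
    rw [this, Ideal.span_insert_zero]
    rfl
  have hw : w ∈ maximalIdeal R := hz ▸ Ideal.subset_span (Set.mem_insert _ _)
  refine ⟨h1, le_antisymm ?_ ?_⟩
  · refine (ringKrullDim_le_spanFinrank_maximalIdeal _).trans ?_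
    rw [← h1]
    have := (Submodule.spanFinrank_span_le_ncard_of_finite (R := R ⧸ Ideal.span {w})
      (Set.finite_range fun i => Ideal.Quotient.mk (Ideal.span {w}) (z i))).trans
        ((Finite.card_range_le _).trans (Nat.card_fin n).le)
    exact Nat.cast_le.2 this
  · have := ringKrullDim_le_ringKrullDim_quotient_add_card (s := {w})
      (by simpa [IsLocalRing.ringJacobson_eq_maximalIdeal] using hw)
    rw [hdim] at this
    rw [Finset.card_singleton, Finset.coe_singleton] at this
    push_cast at this
    exact (ENat.WithBot.add_le_add_natCast_right_iff (c := 1)).1 (by simpa using this)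

theorem isDomain_and_weakReg_of_regular {n : ℕ} : ∀ {R : Type v} [CommRing R] [IsLocalRing R]
    [IsNoetherianRing R] (z : Fin n → R), Ideal.span (Set.range z) = maximalIdeal R →
    ringKrullDim R = n → IsDomain R ∧ WeakReg z R := by
  induction n with
  | zero =>
    intro R _ _ _ z hz _
    refine ⟨?_, fun i => i.elim0⟩
    have : maximalIdeal R = ⊥ := by rw [← hz, Set.range_eq_empty, Ideal.span_empty]
    exact (IsLocalRing.isField_iff_maximalIdeal_eq.2 this).isDomain
  | succ n ih =>
    intro R _ _ _ z hz hdim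
    have hins : ∀ i : Fin (n + 1), Ideal.span (insert (z i) (Set.range (z ∘ i.succAbove))) =
        maximalIdeal R := by
      intro i
      rw [← hz, Set.range_comp, Fin.range_succAbove, ← Set.image_insert_eq, Set.insert_eq,
        Set.union_compl_self, Set.image_univ]
    have hmin : maximalIdeal R ∉ minimalPrimes R := by
      intro h
      have := Ideal.height_eq_zero_iff.2 h
      rw [← IsLocalRing.maximalIdeal_height_eq_ringKrullDim, this] at hdim
      norm_cast at hdim
    have hdom : IsDomain R := by
      have hf := Ideal.finite_minimalPrimes_of_isNoetherianRing R ⊥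
      obtain ⟨w, hw, hw'⟩ : ∃ w ∈ maximalIdeal R,
          w ∉ ⋃ i ∈ (↑(insert (maximalIdeal R ^ 2) hf.toFinset) : Set (Ideal R)),
            ((id i : Ideal R) : Set R) := by
        refine Set.not_subset.1 ?_
        rw [Ideal.subset_union_prime (maximalIdeal R ^ 2) (maximalIdeal R ^ 2)
          (f := id)]
        · rintro ⟨a, ha, hle⟩
          rw [Finset.mem_insert, Set.Finite.mem_toFinset] at ha
          rcases ha with rfl | ha
          · have := Submodule.eq_bot_of_le_smul_of_le_jacobson_bot (maximalIdeal R)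
              (maximalIdeal R) (IsNoetherian.noetherian _)
              (by simpa [pow_two] using hle) (maximalIdeal_le_jacobson _)
            exact hmin ⟨⟨inferInstance, bot_le⟩, fun P _ _ => this ▸ bot_le⟩
          · have h2 : maximalIdeal R = a := le_antisymm hle (IsLocalRing.le_maximalIdeal
                ha.1.1.ne_top)
            exact hmin (h2 ▸ ha)
        · intro a ha hne _
          rw [Finset.mem_insert, Set.Finite.mem_toFinset] at ha
          exact (ha.resolve_left hne).1.1
      simp only [Set.mem_iUnion, id, SetLike.mem_coe, Finset.coe_insert, Set.mem_insert_iff,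
        Set.Finite.coe_toFinset, exists_prop, not_exists, not_and] at hw'
      have hw2 : w ∉ maximalIdeal R ^ 2 := hw' _ (Or.inl rfl)
      have hwP : ∀ P ∈ (⊥ : Ideal R).minimalPrimes, w ∉ P := fun P hP => hw' _ (Or.inr hP)
      obtain ⟨a, ha⟩ := Ideal.mem_span_range_iff_exists_fun.1 (hz ▸ hw)
      obtain ⟨i, hi⟩ : ∃ i, IsUnit (a i) := by
        by_contra! h
        refine hw2 (ha ▸ Submodule.sum_mem _ fun i _ => ?_)
        rw [pow_two]
        exact Ideal.mul_mem_mul (h i) (hz ▸ Ideal.subset_span ⟨i, rfl⟩)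
      have hspan : Ideal.span (insert w (Set.range (z ∘ i.succAbove))) = maximalIdeal R := by
        refine le_antisymm ?_ ?_
        · rw [Ideal.span_le, Set.insert_subset_iff]
          refine ⟨hw, ?_⟩
          rintro _ ⟨j, rfl⟩
          exact hz ▸ Ideal.subset_span ⟨_, rfl⟩
        · rw [← hins i, Ideal.span_le, Set.insert_subset_iff]
          refine ⟨?_, fun j hj => Ideal.subset_span (Set.mem_insert_of_mem _ hj)⟩
          rw [SetLike.mem_coe, ← Ideal.unit_mul_mem_iff_mem _ hi]
          have : a i * z i = w - ∑ j, a (i.succAbove j) * z (i.succAbove j) := by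
            rw [← ha, Fin.sum_univ_succAbove _ i]
            ring
          rw [this]
          refine Ideal.sub_mem _ (Ideal.subset_span (Set.mem_insert _ _))
            (Submodule.sum_mem _ fun j _ => Ideal.mul_mem_left _ _ (Ideal.subset_span
              (Set.mem_insert_of_mem _ ⟨j, rfl⟩)))
      have := isLocalRing_quotient_span_singleton hw
      obtain ⟨h1, h2⟩ := regular_quotient hspan (by exact_mod_cast hdim)
      have hdq := (ih _ h1 h2).1
      have hprime : (Ideal.span {w}).IsPrime := (Ideal.Quotient.isDomain_iff_prime _).1 hdq
      obtain ⟨P, hP, hPw⟩ := Ideal.exists_minimalPrimes_le (I := ⊥) (J := Ideal.span {w}) bot_le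
      have hP0 : P = ⊥ := by
        refine Submodule.eq_bot_of_le_smul_of_le_jacobson_bot (Ideal.span {w}) P
          (IsNoetherian.noetherian _) (fun u hu => ?_)
          (((Ideal.span_singleton_le_iff_mem _).2 hw).trans (maximalIdeal_le_jacobson _))
        obtain ⟨v, rfl⟩ := Ideal.mem_span_singleton'.1 (hPw hu)
        rw [mul_comm]
        exact Submodule.smul_mem_smul (Ideal.mem_span_singleton_self w)
          ((hP.1.1.mem_or_mem hu).resolve_right (hwP P hP))
      have := hP.1.1
      rw [hP0] at this
      exact IsDomain.of_bot_isPrime R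
    have h0 : z 0 ≠ 0 := by
      intro h0
      have h1 := hins 0
      rw [h0, Ideal.span_insert_zero] at h1
      have h2 := ringKrullDim_le_spanFinrank_maximalIdeal R
      have h3 := (Submodule.spanFinrank_span_le_ncard_of_finite (R := R)
        (Set.finite_range (z ∘ (0 : Fin (n + 1)).succAbove))).trans
          ((Finite.card_range_le _).trans (Nat.card_fin n).le)
      rw [show Submodule.span R (Set.range (z ∘ (0 : Fin (n + 1)).succAbove)) = maximalIdeal R
        from h1] at h3
      rw [hdim] at h2
      have : n + 1 ≤ (maximalIdeal R).spanFinrank := by exact_mod_cast h2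
      omega
    have hz0 : z 0 ∈ maximalIdeal R := hz ▸ Ideal.subset_span ⟨0, rfl⟩
    have := isLocalRing_quotient_span_singleton hz0
    obtain ⟨h1, h2⟩ := regular_quotient (hins 0) (by exact_mod_cast hdim)
    refine ⟨hdom, ?_⟩
    rw [weakReg_iff_isWeaklyRegular, List.ofFn_succ, isWeaklyRegular_cons_iff]
    refine ⟨?_, ?_⟩
    · exact IsSMulRegular.of_right_eq_zero_of_smul fun x hx => by
        simpa [h0] using hx
    · have h3 := weakReg_iff_isWeaklyRegular.1 (ih _ h1 h2).2
      have e : QuotSMulTop (z 0) R ≃ₗ[R] R ⧸ Ideal.span {z 0} :=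
        Submodule.quotEquivOfEq _ _ (by rw [← Submodule.ideal_span_singleton_smul]; simp)
      rw [e.isWeaklyRegular_congr, ← isWeaklyRegular_map_algebraMap_iff (R ⧸ Ideal.span {z 0}),
        List.map_ofFn]
      exact h3

/-- A ring with a weakly regular sequence `z` of length `n` has no socle modulo a shorter weakly
regular sequence. -/
theorem WeakReg.mem_of_forall_mul_mem {R : Type*} [CommRing R] {n l : ℕ} {z : Fin n → R}
    {w : Fin l → R} (hz : WeakReg z R) (hw : WeakReg w R) (hl : l < n) {u : R}
    (hu : ∀ j, u * z j ∈ Ideal.span (Set.range w)) : u ∈ Ideal.span (Set.range w) := by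
  classical
  obtain ⟨χ, hχ⟩ := exists_isColonFamily (x := z) (U := Finset.univ) hw (fun j _ => hu j)
  let F : ℕ → Submodule R (Finset (Fin n) → R) := fun i =>
    { carrier := {f | ∀ T, T.card ≠ i → f T = 0}
      add_mem' := fun ha hb T hT => by simp [ha T hT, hb T hT]
      zero_mem' := fun T _ => rfl
      smul_mem' := fun a f hf T hT => by simp [hf T hT] }
  let d : ∀ i, F (i + 1) →ₗ[R] F i := fun i =>
    { toFun := fun f => ⟨kbd z Finset.univ f.1, fun T hT => by
        refine Finset.sum_eq_zero fun j hj => ?_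
        rw [Finset.mem_sdiff] at hj
        rw [f.2 _ (by rw [Finset.card_insert_of_notMem hj.2]; omega), smul_zero]⟩
      map_add' := fun f g => Subtype.ext (funext fun T => kbd_add z _ f.1 g.1 T)
      map_smul' := fun a f => Subtype.ext (funext fun T =>
        (map_kbd (LinearMap.lsmul R R a) z Finset.univ f.1 T).symm) }
  let ρ : ∀ i, Finset (Fin l) → F i := fun i S =>
    ⟨fun T => if T.card = i then χ i S T else 0, fun T hT => if_neg hT⟩
  have hρ : IsCoKoszul (F := fun i => F i) w d n ρ := by
    intro i S hS
    ext T
    rw [← (F i).subtype_apply (kbd w Finset.univ (ρ i) S), map_kbd,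
      ← LinearMap.proj_apply (R := R) (φ := fun _ => R) T (kbd w _ _ S), map_kbd]
    change kbd z Finset.univ (fun T => if T.card = i + 1 then χ (i + 1) S T else 0) T =
      kbd w Finset.univ (fun S => if T.card = i then χ i S T else 0) S
    by_cases hT : T.card = i
    · simp only [hT, if_true]
      rw [← hχ.comm i S T (by simpa using hS) hT (Finset.subset_univ _)]
      refine kbd_congr _ _ _ fun j hj => ?_
      rw [Finset.mem_sdiff] at hj
      rw [Finset.card_insert_of_notMem hj.2, hT, if_pos rfl]
    · simp only [hT, if_false]
      rw [kbd, kbd, Finset.sum_eq_zero, Finset.sum_eq_zero]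
      · simp
      · intro j hj
        rw [Finset.mem_sdiff] at hj
        rw [Finset.card_insert_of_notMem hj.2, if_neg (by omega), smul_zero]
  obtain ⟨s, s', h⟩ := hρ.homotopy_up (i₀ := n - l - 1) (i := n) (fun i _ f hf => by
      obtain ⟨v, hv⟩ := koszul_exact_card hz (i + 1) f.1
        (fun S _ => congrFun (congrArg Subtype.val hf) S) (by simp)
      refine ⟨⟨fun T => if T.card = i + 1 + 1 then v T else 0, fun T hT => if_neg hT⟩,
        Subtype.ext (funext fun T => ?_)⟩
      change kbd z Finset.univ (fun T => if T.card = i + 1 + 1 then v T else 0) T = f.1 T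
      by_cases hT : T.card = i + 1
      · rw [hv T hT]
        refine kbd_congr _ _ _ fun j hj => ?_
        rw [Finset.mem_sdiff] at hj
        rw [Finset.card_insert_of_notMem hj.2, hT, if_pos rfl]
      · rw [f.2 T hT]
        refine Finset.sum_eq_zero fun j hj => ?_
        rw [Finset.mem_sdiff] at hj
        beta_reduce
        rw [Finset.card_insert_of_notMem hj.2, if_neg (by omega), smul_zero])
    ⟨0, 0, fun S hS => absurd (Finset.card_le_univ S) (by simp; omega)⟩ (by omega)
  have h1 := congrFun (congrArg Subtype.val (h ∅ (by simp))) Finset.univ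
  change (if Finset.univ.card = n then χ n ∅ Finset.univ else 0) =
    kbd z Finset.univ (s' ∅).1 Finset.univ + (kbd w Finset.univ s ∅).1 Finset.univ at h1
  have h2 := hχ.top
  rw [Finset.card_fin] at h1 h2
  rw [if_pos rfl, h2, kbd, Finset.sdiff_self, Finset.sum_empty, zero_add,
    ← (F n).subtype_apply (kbd w Finset.univ s ∅), map_kbd,
    ← LinearMap.proj_apply (R := R) (φ := fun _ => R) Finset.univ (kbd w _ _ ∅), map_kbd] at h1
  rw [h1]
  simpa using kbd_mem w Finset.univ (fun S => (s S).1 Finset.univ) ∅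

theorem exists_isSMulRegular_of_forall {R M : Type*} [CommRing R] [IsNoetherianRing R]
    [AddCommGroup M] [Module R M] [Module.Finite R M] (a : Ideal R)
    (h : ∀ u : M, (∀ x ∈ a, x • u = 0) → u = 0) : ∃ w ∈ a, IsSMulRegular M w := by
  have : Subsingleton ((R ⧸ a) →ₗ[R] M) := by
    refine subsingleton_of_forall_eq 0 fun f => ?_
    ext
    refine h _ fun x hx => ?_
    have hx0 : x • (Submodule.Quotient.mk 1 : R ⧸ a) = 0 := by
      rw [← Submodule.Quotient.mk_smul, Submodule.Quotient.mk_eq_zero]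
      simpa using hx
    simp only [LinearMap.comp_apply, Submodule.mkQ_apply]
    rw [← map_smul, hx0, map_zero]
  simpa [Ideal.annihilator_quotient] using IsSMulRegular.subsingleton_linearMap_iff.1 this

theorem WeakReg.exists_isWeaklyRegular_append {R : Type*} [CommRing R] [IsNoetherianRing R]
    {n : ℕ} {z : Fin n → R} (hz : WeakReg z R) (ws : List R) (hws : IsWeaklyRegular R ws)
    (hlen : ws.length < n) : ∃ w ∈ Ideal.span (Set.range z), IsWeaklyRegular R (ws ++ [w]) := by
  have hw : WeakReg (fun i => ws.get i) R := by
    rw [weakReg_iff_isWeaklyRegular, List.ofFn_get]; exact hws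
  have hr : Ideal.span (Set.range fun i => ws.get i) = Ideal.ofList ws := by
    rw [Ideal.ofList]; congr 1; ext; simp [List.mem_iff_get]
  obtain ⟨w, hw1, hw2⟩ := exists_isSMulRegular_of_forall (M := R ⧸ Ideal.ofList ws • (⊤ : Ideal R))
    (Ideal.span (Set.range z)) (fun u hu => by
      obtain ⟨u, rfl⟩ := Submodule.mkQ_surjective _ u
      simp only [Submodule.mkQ_apply, ← Submodule.Quotient.mk_smul,
        Submodule.Quotient.mk_eq_zero] at hu ⊢
      simp only [smul_eq_mul, Ideal.mul_top] at hu ⊢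
      rw [← hr] at hu ⊢
      exact hz.mem_of_forall_mul_mem hw hlen fun j => by
        rw [mul_comm]; exact hu _ (Ideal.subset_span ⟨j, rfl⟩))
  exact ⟨w, hw1, (isWeaklyRegular_append_iff R ws [w]).2 ⟨hws, by simpa using hw2⟩⟩

/-- Over a regular local ring, every weakly regular sequence extends to one of length `n`. -/
theorem WeakReg.exists_isWeaklyRegular_extend {R : Type*} [CommRing R] [IsNoetherianRing R]
    {n : ℕ} {z : Fin n → R} (hz : WeakReg z R) (ws : List R) (hws : IsWeaklyRegular R ws)
    (hlen : ws.length ≤ n) : ∃ ws' : List R, IsWeaklyRegular R (ws ++ ws') ∧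
      (∀ w ∈ ws', w ∈ Ideal.span (Set.range z)) ∧ ws.length + ws'.length = n := by
  obtain ⟨k, hk⟩ : ∃ k, ws.length + k = n := ⟨n - ws.length, by omega⟩
  induction k generalizing ws with
  | zero => exact ⟨[], by simpa using hws, by simp, by simpa using hk⟩
  | succ k ih =>
    obtain ⟨w, hw, h⟩ := hz.exists_isWeaklyRegular_append ws hws (by omega)
    obtain ⟨ws', h1, h2, h3⟩ := ih (ws ++ [w]) h (by simp; omega) (by simp; omega)
    refine ⟨w :: ws', by simpa using h1, ?_, by simp at h3 ⊢; omega⟩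
    intro v hv
    rcases List.mem_cons.1 hv with rfl | hv
    · exact hw
    · exact h2 v hv

end RegularLocal

section MinimalResolution

open IsLocalRing

theorem Submodule.mem_ideal_smul_top_pi {R ι : Type*} [CommRing R] [Finite ι] {a : Ideal R}
    {f : ι → R} : f ∈ a • (⊤ : Submodule R (ι → R)) ↔ ∀ i, f i ∈ a := by
  classical
  cases nonempty_fintype ι
  constructor
  · intro hf i
    have := Submodule.mem_map_of_mem (f := LinearMap.proj i) hf
    rw [Submodule.map_smul''] at this
    have h2 := Submodule.smul_mono (le_refl a) (le_top (a := Submodule.map (LinearMap.proj i :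
      (ι → R) →ₗ[R] R) ⊤)) this
    simpa using h2
  · intro h
    have : f = ∑ i, f i • Pi.single i (1 : R) := by
      ext j
      simp [Finset.sum_apply, Pi.single_apply]
    rw [this]
    exact Submodule.sum_mem _ fun i _ => Submodule.smul_mem_smul (h i) trivial

variable {R : Type*} [CommRing R] [IsLocalRing R]

/-- A finitely generated module has a minimal free cover. -/
theorem exists_minimal_cover {M : Type*} [AddCommGroup M] [Module R M] (K : Submodule R M)
    (hK : K.FG) : ∃ (b : ℕ) (f : (Fin b → R) →ₗ[R] M), LinearMap.range f = K ∧
      LinearMap.ker f ≤ maximalIdeal R • ⊤ := by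
  classical
  have hex : ∃ b, ∃ g : Fin b → M, Submodule.span R (Set.range g) = K := by
    obtain ⟨b, g, hg⟩ := Submodule.fg_iff_exists_fin_generating_family.1 hK
    exact ⟨b, g, hg⟩
  obtain ⟨g, hg⟩ := Nat.find_spec hex
  refine ⟨Nat.find hex, Fintype.linearCombination R g, ?_, ?_⟩
  · rw [Fintype.range_linearCombination, hg]
  · intro c hc
    rw [Submodule.mem_ideal_smul_top_pi]
    by_contra! h
    obtain ⟨i, hi⟩ := h
    have hi : IsUnit (c i) := by simpa using hi
    obtain ⟨b, hb⟩ : ∃ b, Nat.find hex = b + 1 := ⟨Nat.find hex - 1, by have := i.2; omega⟩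
    refine Nat.find_min hex (m := b) (by omega) ?_
    generalize Nat.find hex = b' at *
    subst hb
    refine ⟨g ∘ i.succAbove, ?_⟩
    rw [← hg]
    refine le_antisymm (Submodule.span_mono (Set.range_comp_subset_range _ _)) ?_
    rw [Submodule.span_le]
    rintro _ ⟨j, rfl⟩
    rcases Fin.eq_self_or_eq_succAbove i j with rfl | ⟨j, rfl⟩
    · rw [SetLike.mem_coe, ← Submodule.smul_mem_iff_of_isUnit _ hi]
      rw [LinearMap.mem_ker, Fintype.linearCombination_apply, Fin.sum_univ_succAbove _ j] at hc
      rw [eq_neg_of_add_eq_zero_left hc]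
      exact Submodule.neg_mem _ (Submodule.sum_mem _ fun l _ =>
        Submodule.smul_mem _ _ (Submodule.subset_span ⟨l, rfl⟩))
    · exact Submodule.subset_span ⟨j, rfl⟩

/-- A cyclic module over a Noetherian local ring has a minimal free resolution. -/
theorem exists_minimal_resolution [IsNoetherianRing R] (I : Ideal R) (hI : I ≠ ⊤) :
    ∃ (b : ℕ → ℕ) (d : ∀ i, (Fin (b (i + 1)) → R) →ₗ[R] (Fin (b i) → R))
      (e : (Fin (b 0) → R) →ₗ[R] R ⧸ I), Function.Surjective e ∧
      LinearMap.range (d 0) = LinearMap.ker e ∧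
      (∀ i, LinearMap.range (d (i + 1)) = LinearMap.ker (d i)) ∧
      ∀ i, LinearMap.range (d i) ≤ maximalIdeal R • ⊤ := by
  let St := Σ b : ℕ, Submodule R (Fin b → R)
  have hcov : ∀ S : St, ∃ (b : ℕ) (f : (Fin b → R) →ₗ[R] (Fin S.1 → R)), LinearMap.range f = S.2 ∧
      LinearMap.ker f ≤ maximalIdeal R • ⊤ := fun S =>
    exists_minimal_cover S.2 (IsNoetherian.noetherian _)
  choose nb f hf1 hf2 using hcov
  let S : ℕ → St := fun i => Nat.rec ⟨1, Submodule.comap (LinearMap.proj (R := R) (φ := fun _ => R)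
      (0 : Fin 1)) I⟩
    (fun _ S => ⟨nb S, LinearMap.ker (f S)⟩) i
  refine ⟨fun i => (S i).1, fun i => f (S i), (Submodule.mkQ I).comp
    (LinearMap.proj (R := R) (φ := fun _ => R) (0 : Fin 1)), ?_, ?_, ?_, ?_⟩
  · intro u
    obtain ⟨u, rfl⟩ := Submodule.mkQ_surjective _ u
    exact ⟨fun _ => u, rfl⟩
  · rw [hf1, LinearMap.ker_comp, Submodule.ker_mkQ]
    rfl
  · intro i
    rw [hf1]
  · intro i
    rw [hf1]
    cases i with
    | zero =>
      intro u hu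
      rw [Submodule.mem_ideal_smul_top_pi]
      intro i
      have : i = (0 : Fin 1) := Subsingleton.elim (α := Fin 1) _ _
      rw [this]
      exact IsLocalRing.le_maximalIdeal hI hu
    | succ i => exact hf2 _

/-- A minimal free resolution over a regular local ring is finite. -/
theorem minimal_resolution_eq_zero {n : ℕ} {z : Fin n → R} (hz : WeakReg z R)
    (hm : Ideal.span (Set.range z) = maximalIdeal R) {b : ℕ → ℕ}
    {d : ∀ i, (Fin (b (i + 1)) → R) →ₗ[R] (Fin (b i) → R)}
    (hd : ∀ i, LinearMap.range (d (i + 1)) = LinearMap.ker (d i))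
    (hmin : ∀ i, LinearMap.range (d i) ≤ maximalIdeal R • ⊤) {i : ℕ} (hi : n < i) : b i = 0 := by
  classical
  by_contra hb
  let a : Fin (b i) := ⟨0, Nat.pos_of_ne_zero hb⟩
  have hdd : ∀ i z, d i (d (i + 1) z) = 0 := fun i z => by
    have : d (i + 1) z ∈ LinearMap.ker (d i) := hd i ▸ ⟨z, rfl⟩
    exact this
  obtain ⟨ρ, h1, h2⟩ := exists_isCoKoszul (F := fun i => Fin (b i) → R) hdd
    (fun i => WeakReg.pi fun _ => hz) (r := i) (Pi.single a 1) (fun j hj => by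
      rw [hm]; exact hmin j ⟨_, rfl⟩)
  obtain ⟨s, s', h3⟩ := h2.homotopy_up (i₀ := 0) (i := i)
    (fun j _ u hu => by
      have : u ∈ LinearMap.range (d (j + 1)) := by rw [hd]; exact hu
      exact this)
    ⟨0, 0, fun S hS => absurd (Finset.card_le_univ S) (by simp; omega)⟩ (by omega)
  have h4 := h3 ∅ (by simp)
  have h5 : (Pi.single a 1 : Fin (b i) → R) ∈ maximalIdeal R • (⊤ : Submodule R (Fin (b i) → R)) :=
      by
    rw [← h1, h4]
    refine Submodule.add_mem _ (hmin i ⟨_, rfl⟩) ?_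
    have := kbd_mem z Finset.univ s ∅
    rw [← hm]
    simpa using this
  have := Submodule.mem_ideal_smul_top_pi.1 h5 a
  rw [Pi.single_eq_same] at this
  exact (maximalIdeal R).one_notMem this

end MinimalResolution

section Reduction

open IsLocalRing

/-- A Krull-intersection argument: the failure of a Koszul null-homotopy is already visible modulo
a power of the maximal ideal. -/
theorem exists_pow_forall_not_homotopy {R : Type*} [CommRing R] [IsLocalRing R]
    [IsNoetherianRing R] {n : ℕ} (z : Fin n → R) (I : Ideal R) (r : ℕ)
    (w : Finset (Fin n) → R)
    (h : ¬ ∃ t : Finset (Fin n) → R, ∀ S, S.card = r → w S - kbd z Finset.univ t S ∈ I) :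
    ∃ M, ¬ ∃ t : Finset (Fin n) → R, ∀ S, S.card = r →
      w S - kbd z Finset.univ t S ∈ I ⊔ maximalIdeal R ^ M := by
  classical
  by_contra! hM
  let W : Submodule R (Finset (Fin n) → R) :=
    { carrier := {f | ∃ t : Finset (Fin n) → R, ∀ S, S.card = r →
        f S - kbd z Finset.univ t S ∈ I}
      add_mem' := by
        rintro f g ⟨t, ht⟩ ⟨t', ht'⟩
        refine ⟨fun S => t S + t' S, fun S hS => ?_⟩
        rw [kbd_add]
        convert I.add_mem (ht S hS) (ht' S hS) using 1
        simp only [Pi.add_apply]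
        ring
      zero_mem' := ⟨0, fun S _ => by simp [kbd]⟩
      smul_mem' := by
        rintro a f ⟨t, ht⟩
        refine ⟨fun S => a * t S, fun S hS => ?_⟩
        have := map_kbd (LinearMap.lsmul R R a) z Finset.univ t S
        simp only [LinearMap.lsmul_apply, smul_eq_mul] at this
        rw [← this]
        convert I.mul_mem_left a (ht S hS) using 1
        simp only [Pi.smul_apply, smul_eq_mul]
        ring }
  have hw : W.mkQ w ∈ ⨅ i : ℕ, maximalIdeal R ^ i • (⊤ : Submodule R (_ ⧸ W)) := by
    rw [Submodule.mem_iInf]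
    intro M
    obtain ⟨t, ht⟩ := hM M
    have ht' : ∀ S, ∃ c ∈ maximalIdeal R ^ M, S.card = r →
        w S - kbd z Finset.univ t S - c ∈ I := by
      intro S
      by_cases hS : S.card = r
      · obtain ⟨a, ha, c, hc, hac⟩ := Submodule.mem_sup.1 (ht S hS)
        exact ⟨c, hc, fun _ => by rw [← hac]; simpa using ha⟩
      · exact ⟨0, zero_mem _, fun h => absurd h hS⟩
    choose c hc1 hc2 using ht'
    have h1 : w - c ∈ W := ⟨t, fun S hS => by
      convert hc2 S hS using 1
      simp only [Pi.sub_apply]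
      ring⟩
    have h2 : W.mkQ w = W.mkQ c := by
      exact (Submodule.Quotient.eq W).2 h1
    have h3 := Submodule.mem_map_of_mem (f := W.mkQ)
      ((Submodule.mem_ideal_smul_top_pi (a := maximalIdeal R ^ M)).2 hc1)
    rw [h2]
    rw [Submodule.map_smul''] at h3
    exact Submodule.smul_mono le_rfl le_top h3
  rw [Ideal.iInf_pow_smul_eq_bot_of_isLocalRing _ (Ideal.IsPrime.ne_top inferInstance)] at hw
  have hw' : w ∈ W := (Submodule.Quotient.mk_eq_zero W).1 hw
  exact h hw'

theorem Module.Projective.exists_lift_of_mem_range {R X Y Z : Type*} [CommRing R] [AddCommGroup X]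
    [Module R X] [AddCommGroup Y] [Module R Y] [AddCommGroup Z] [Module R Z]
    [Module.Projective R X] (g : Y →ₗ[R] Z) (h : X →ₗ[R] Z)
    (hgh : ∀ u, h u ∈ LinearMap.range g) : ∃ k : X →ₗ[R] Y, ∀ u, g (k u) = h u := by
  obtain ⟨k, hk⟩ := Module.projective_lifting_property g.rangeRestrict
    (h.codRestrict _ hgh) g.surjective_rangeRestrict
  exact ⟨k, fun u => congrArg Subtype.val (LinearMap.congr_fun hk u)⟩

theorem exists_seq_of_step {α : ℕ → Type*} (p : ∀ i, α i → α (i + 1) → Prop) (q : ∀ i, α i → Prop)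
    (a : α 0) (ha : q 0 a) (h : ∀ i a, q i a → ∃ a', p i a a' ∧ q (i + 1) a') :
    ∃ f : ∀ i, α i, f 0 = a ∧ ∀ i, p i (f i) (f (i + 1)) := by
  choose F hF using fun i (a : {a : α i // q i a}) => h i a.1 a.2
  let f : ∀ i, {a : α i // q i a} := fun i => Nat.rec ⟨a, ha⟩ (fun i a => ⟨F i a, (hF i a).2⟩) i
  exact ⟨fun i => (f i).1, rfl, fun i => (hF i (f i)).1⟩

/-- The comparison theorem for a projective complex and a resolution. -/
theorem exists_comparison {R : Type*} [CommRing R] {F G : ℕ → Type*} [∀ i, AddCommGroup (F i)]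
    [∀ i, Module R (F i)] [∀ i, AddCommGroup (G i)] [∀ i, Module R (G i)]
    [∀ i, Module.Projective R (F i)] (d : ∀ i, F (i + 1) →ₗ[R] F i)
    (d' : ∀ i, G (i + 1) →ₗ[R] G i) {A B : Type*} [AddCommGroup A] [Module R A] [AddCommGroup B]
    [Module R B] (e : F 0 →ₗ[R] A) (e' : G 0 →ₗ[R] B) (f : A →ₗ[R] B)
    (hed : ∀ u, e (d 0 u) = 0) (hdd : ∀ i u, d i (d (i + 1) u) = 0)
    (he' : Function.Surjective e') (h0 : LinearMap.range (d' 0) = LinearMap.ker e')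
    (hex : ∀ i, LinearMap.range (d' (i + 1)) = LinearMap.ker (d' i)) :
    ∃ γ : ∀ i, F i →ₗ[R] G i, (∀ u, e' (γ 0 u) = f (e u)) ∧
      ∀ i u, d' i (γ (i + 1) u) = γ i (d i u) := by
  obtain ⟨γ0, hγ0⟩ := Module.Projective.exists_lift_of_mem_range e' (f ∘ₗ e)
    fun u => LinearMap.mem_range.2 (he' _)
  obtain ⟨γ1, hγ1⟩ := Module.Projective.exists_lift_of_mem_range (d' 0) (γ0 ∘ₗ d 0)
    fun u => by rw [h0, LinearMap.mem_ker]; simp [hγ0, hed]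
  obtain ⟨γ, hγ, h⟩ := exists_seq_of_step
    (α := fun i => (F i →ₗ[R] G i) × (F (i + 1) →ₗ[R] G (i + 1)))
    (fun i a a' => a.2 = a'.1 ∧ ∀ u, d' i (a.2 u) = a.1 (d i u))
        (fun i a => ∀ u, d' i (a.2 u) = a.1 (d i u)) (γ0, γ1) hγ1
    (by
      rintro i ⟨a, b⟩ hab
      obtain ⟨c, hc⟩ := Module.Projective.exists_lift_of_mem_range (d' (i + 1)) (b ∘ₗ d (i + 1))
        fun u => by
          rw [hex, LinearMap.mem_ker]
          simp only [LinearMap.comp_apply]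
          rw [hab, hdd, map_zero]
      exact ⟨(b, c), ⟨rfl, hab⟩, hc⟩)
  refine ⟨fun i => (γ i).1, fun u => ?_, fun i u => ?_⟩
  · simp [hγ, hγ0]
  · change d' i ((γ (i + 1)).1 u) = _
    rw [← (h i).1, (h i).2]

end Reduction

section CertificateExistence

open IsLocalRing Matrix

theorem exists_koszulCert {R : Type*} [CommRing R] [IsLocalRing R] [IsNoetherianRing R]
    {n r s : ℕ} {z : Fin n → R} (hz : WeakReg z R)
    (hm : Ideal.span (Set.range z) = maximalIdeal R) {I : Ideal R} {F : ℕ → Type*}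
    [∀ i, AddCommGroup (F i)] [∀ i, Module R (F i)] [∀ i, Module.Projective R (F i)]
    {d : ∀ i, F (i + 1) →ₗ[R] F i} {e : F 0 →ₗ[R] R ⧸ I} (he : Function.Surjective e)
    (h0 : LinearMap.range (d 0) = LinearMap.ker e)
    (hex : ∀ i, LinearMap.range (d (i + 1)) = LinearMap.ker (d i)) {x : Fin s → R}
    {U : Finset (Fin s)} {ψ : ∀ i, Finset (Fin s) → F i} (hψ : IsKoszulMap U x d ψ)
    (hx : ∀ j ∈ U, x j ∈ maximalIdeal R) (hU : U.card = r)
    (hv : ψ r U ∉ LinearMap.range (d r) ⊔ maximalIdeal R • (⊤ : Submodule R (F r))) :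
    ∃ (M : ℕ) (b : ℕ → ℕ) (C : KoszulCert R n r s M b U), C.z = z ∧ C.x = x := by
  classical
  have hdd : ∀ i u, d i (d (i + 1) u) = 0 := fun i u => by
    have : d (i + 1) u ∈ LinearMap.ker (d i) := hex i ▸ ⟨u, rfl⟩
    exact this
  have hed : ∀ u, e (d 0 u) = 0 := fun u => by
    have : d 0 u ∈ LinearMap.ker e := h0 ▸ ⟨u, rfl⟩
    exact this
  obtain ⟨ρ, hρv, hρ⟩ := exists_isCoKoszul hdd (fun i => hz.projective (P := F i)) (r := r) (ψ r U)
    (fun i h => by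
      subst h
      rw [hm]
      exact hψ.mem_span hx hU)
  choose w hw using fun S => Ideal.Quotient.mk_surjective (e (ρ 0 S))
  have hno : ¬ ∃ t : Finset (Fin n) → R, ∀ S, S.card = r →
      w S - kbd z Finset.univ t S ∈ I := by
    rintro ⟨t, ht⟩
    choose t' ht' using fun S => he (Ideal.Quotient.mk I (t S))
    have : ∀ S : Finset (Fin n), ∃ u, S.card = r → ρ 0 S = d 0 u + kbd z Finset.univ t' S := by
      intro S
      by_cases hS : S.card = r
      · have : ρ 0 S - kbd z Finset.univ t' S ∈ LinearMap.ker e := by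
          rw [LinearMap.mem_ker, map_sub, map_kbd, sub_eq_zero, ← hw, ← sub_eq_zero]
          have h1 := Ideal.Quotient.eq_zero_iff_mem.2 (ht S hS)
          rw [map_sub] at h1
          rw [← h1]
          congr 1
          rw [kbd_congr z Finset.univ (g := fun S => (Submodule.mkQ I) (t S)) S
            (fun j _ => ht' _), ← map_kbd]
          rfl
        rw [← h0] at this
        obtain ⟨u, hu⟩ := this
        exact ⟨u, fun _ => by rw [hu]; abel⟩
      · exact ⟨0, fun h => absurd h hS⟩
    choose u hu using this
    obtain ⟨σ, σ', hσ⟩ := hρ.homotopy_up (i₀ := 0) (i := r)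
      (fun i _ u hu => by
        have : u ∈ LinearMap.range (d (i + 1)) := by rw [hex]; exact hu
        exact this) ⟨t', u, fun S hS => hu S (by omega)⟩ (Nat.zero_le _)
    apply hv
    rw [← hρv, hσ ∅ (by simp)]
    refine Submodule.add_mem_sup ⟨_, rfl⟩ ?_
    have := kbd_mem z Finset.univ σ ∅
    rw [← hm]
    simpa using this
  obtain ⟨M, hM⟩ := exists_pow_forall_not_homotopy z I r w hno
  have hI' : I ⊔ maximalIdeal R ^ M ≠ ⊤ := by
    intro h
    rw [h] at hM
    exact hM ⟨0, fun _ _ => trivial⟩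
  obtain ⟨b, D, e', he', hD0, hDex, hDmin⟩ := exists_minimal_resolution _ hI'
  have hDD : ∀ i u, D i (D (i + 1) u) = 0 := fun i u => by
    have : D (i + 1) u ∈ LinearMap.ker (D i) := hDex i ▸ ⟨u, rfl⟩
    exact this
  obtain ⟨γ, hγ0, hγ⟩ := exists_comparison (G := fun i => Fin (b i) → R) d D e e'
    (Submodule.factor (le_sup_left : I ≤ I ⊔ maximalIdeal R ^ M)) hed hdd he' hD0 hDex
  have hγρ : IsCoKoszul z D r (fun i S => γ i (ρ i S)) := by
    intro i S hS
    rw [hγ, hρ i S hS, map_kbd]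
  have hγv : γ r (ψ r U) ∉ maximalIdeal R • (⊤ : Submodule R (Fin (b r) → R)) := by
    intro h
    rw [← hm, ← Set.image_univ, ← Finset.coe_univ] at h
    obtain ⟨c, hc⟩ := exists_sum_smul_of_mem_span_image h
    obtain ⟨σ, σ', hσ⟩ := hγρ.homotopy_down (F := fun i => Fin (b i) → R) hDD
      (fun i => WeakReg.pi fun _ => hz) ⟨fun S => ∑ j ∈ S, c j, 0, by
        rw [hρv, hc]
        simp [kbd, ksgn]⟩ r 0 (by omega)
    choose t ht using fun S => Ideal.Quotient.mk_surjective (e' (σ S))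
    refine hM ⟨t, fun S hS => ?_⟩
    rw [← Ideal.Quotient.eq_zero_iff_mem, map_sub, sub_eq_zero]
    have h1 := congrArg e' (hσ S (by omega))
    have h2 : e' (D 0 (σ' S)) = 0 := by
      have : D 0 (σ' S) ∈ LinearMap.ker e' := hD0 ▸ ⟨_, rfl⟩
      exact this
    rw [hγ0, ← hw, map_add, h2, zero_add, map_kbd] at h1
    refine h1.trans ?_
    rw [kbd_congr z Finset.univ (g := fun S => (Submodule.mkQ _) (t S)) S
      (fun j _ => (ht _).symm), ← map_kbd]
    rfl
  rw [Submodule.mem_ideal_smul_top_pi] at hγv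
  push Not at hγv
  obtain ⟨a, ha⟩ := hγv
  have ha : IsUnit (γ r (ψ r U) a) := by simpa using ha
  obtain ⟨a', ha'⟩ := ha.exists_left_inv
  have hmu : ∀ q, ∃ c : Fin n → R, a' * D r (Pi.single q 1) a = ∑ j, z j * c j := by
    intro q
    have h1 := Submodule.mem_ideal_smul_top_pi.1 (hDmin r ⟨Pi.single q 1, rfl⟩) a
    rw [← hm, Ideal.mem_span_range_iff_exists_fun] at h1
    obtain ⟨c, hc⟩ := h1
    exact ⟨fun j => a' * c j, by
      rw [← hc, Finset.mul_sum]
      exact Finset.sum_congr rfl fun j _ => by ring⟩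
  choose mu hmu using hmu
  have hhom : ∀ j, ∃ h : ∀ i, (Fin (b i) → R) →ₗ[R] (Fin (b (i + 1)) → R),
      ∀ i u, D (i + 1) (h (i + 1) u) + h i (D i u) = z j ^ M • u := by
    intro j
    have hzM : z j ^ M ∈ I ⊔ maximalIdeal R ^ M :=
      Submodule.mem_sup_right (Ideal.pow_mem_pow (hm ▸ Ideal.subset_span ⟨j, rfl⟩) M)
    obtain ⟨h0, hh0⟩ := Module.Projective.exists_lift_of_mem_range (D 0)
      (z j ^ M • (LinearMap.id : (Fin (b 0) → R) →ₗ[R] _)) (fun u => by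
        rw [hD0, LinearMap.mem_ker]
        simp only [LinearMap.smul_apply, LinearMap.id_apply, map_smul]
        obtain ⟨v, hv⟩ := Ideal.Quotient.mk_surjective (e' u)
        rw [← hv, ← Ideal.Quotient.mk_eq_mk, ← Submodule.Quotient.mk_smul,
          Submodule.Quotient.mk_eq_zero]
        exact Ideal.mul_mem_right _ _ hzM)
    obtain ⟨h, -, hh⟩ := exists_seq_of_step
      (α := fun i => (Fin (b i) → R) →ₗ[R] (Fin (b (i + 1)) → R))
      (fun i a a' => ∀ u, D (i + 1) (a' u) + a (D i u) = z j ^ M • u)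
      (fun i a => ∀ u, D i (a (D i u)) = z j ^ M • D i u) h0 (fun u => hh0 _) (by
        intro i a ha
        obtain ⟨a', ha'⟩ := Module.Projective.exists_lift_of_mem_range (D (i + 1))
          (z j ^ M • LinearMap.id - a ∘ₗ D i) (fun u => by
            rw [hDex, LinearMap.mem_ker]
            simp [ha])
        refine ⟨a', fun u => ?_, fun u => ?_⟩
        · rw [ha']
          simp
        · rw [ha']
          simp [hDD])
    exact ⟨h, hh⟩
  choose h hh using hhom
  refine ⟨M, b, ⟨z, x, fun i => LinearMap.toMatrix' (D i), fun j i => LinearMap.toMatrix' (h j i),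
    fun i T => γ i (ψ i T), Pi.single a a', fun j q => mu q j,
    fun i hi => minimal_resolution_eq_zero hz hm hDex hDmin hi, ?_, ?_, ?_, ?_, ?_⟩, rfl, rfl⟩
  · intro i
    rw [← LinearMap.toMatrix'_comp]
    rw [show D i ∘ₗ D (i + 1) = 0 from LinearMap.ext fun u => hDD i u, map_zero]
  · intro j i
    rw [← LinearMap.toMatrix'_comp, ← LinearMap.toMatrix'_comp, ← map_add,
      ← LinearMap.toMatrix'_id, ← map_smul]
    congr 1
    ext1 u
    ext1
    simp [hh]
  · intro i T hT hTc
    rw [LinearMap.toMatrix'_mulVec, hγ, hψ i T hT hTc, map_sum]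
    simp
  · rw [single_dotProduct, ha']
  · ext q
    rw [Finset.sum_apply]
    simp only [Pi.smul_apply, smul_eq_mul]
    rw [← hmu, single_vecMul]
    simp [LinearMap.toMatrix'_apply]

theorem KoszulLift.isKoszulMap {R : Type u} [CommRing R] {s : ℕ} {x : Fin s → R} {I : Ideal R}
    {P : ProjRes R (R ⧸ I)} (L : KoszulLift R x I P) (U : Finset (Fin s)) :
    IsKoszulMap (F := fun i => P.F i) U x P.d fun i T =>
      if h : T.card = i then L.ψ i (Finsupp.single ⟨T, h⟩ 1) else 0 := by
  intro i T _ hT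
  have := LinearMap.congr_fun (L.comm i) (Finsupp.single ⟨T, hT⟩ 1)
  simp only [LinearMap.comp_apply] at this
  beta_reduce
  rw [dif_pos hT, ← this, ← Finset.sum_attach T]
  simp only [koszulD, Finsupp.lsum_single, LinearMap.toSpanSingleton_apply, one_smul, map_sum,
    map_smul]
  refine Finset.sum_congr rfl fun j _ => ?_
  rw [dif_pos (by simp [Finset.card_erase_of_mem j.2, hT])]
  congr 2
  rw [ksgn, Finset.filter_erase, Finset.erase_eq_of_notMem (by simp)]

theorem koszulTorMapZero_of_forall_koszulCert {R : Type u} [CommRing R] [IsLocalRing R]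
    [IsNoetherianRing R] {n r s : ℕ} {z : Fin n → R} (hz : WeakReg z R)
    (hm : Ideal.span (Set.range z) = maximalIdeal R) {I : Ideal R} {x : Fin s → R}
    (hx : ∀ j, x j ∈ maximalIdeal R)
    (H : ∀ (M : ℕ) (b : ℕ → ℕ) (U : Finset (Fin s)) (C : KoszulCert R n r s M b U),
      U.card = r → C.z = z → C.x = x → False) : KoszulTorMapZero R x I r := by
  intro P L v
  induction v using Finsupp.induction_linear with
  | zero => rw [map_zero]; exact zero_mem _
  | add f g hf hg => rw [map_add]; exact add_mem hf hg
  | single U a =>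
    rw [← mul_one a, ← smul_eq_mul, ← Finsupp.smul_single, map_smul]
    refine Submodule.smul_mem _ _ ?_
    by_contra hv
    have := P.projective
    obtain ⟨M, b, C, h1, h2⟩ := exists_koszulCert (F := fun i => P.F i) hz hm P.surj
      P.exact0.symm (fun i => (P.exact i).symm) (L.isKoszulMap U.1) (fun j _ => hx j) U.2
      (by rwa [dif_pos U.2])
    exact H M b U.1 C U.2 h1 h2

end CertificateExistence

section ResidueCharP

open IsLocalRing RingTheory.Sequence

theorem length_le_ringKrullDim_localization {R : Type*} [CommRing R] [IsNoetherianRing R]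
    {ys : List R} (hys : IsWeaklyRegular R ys) (P : Ideal R) [P.IsPrime] (hP : ∀ y ∈ ys, y ∈ P) :
    (ys.length : WithBot ℕ∞) ≤ ringKrullDim (Localization.AtPrime P) := by
  have h1 := hys.isRegular_of_isLocalization_of_mem (Localization.AtPrime P) P hP
  have h2 := ringKrullDim_add_length_eq_ringKrullDim_of_isRegular _ h1
  rw [List.length_map] at h2
  rw [← h2]
  have : Nontrivial (Localization.AtPrime P ⧸
      Ideal.ofList (ys.map (algebraMap R (Localization.AtPrime P)))) := by
    rw [Ideal.Quotient.nontrivial_iff]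
    intro h
    exact h1.top_ne_smul (by rw [h]; simp)
  exact le_add_of_nonneg_left ringKrullDim_nonneg_of_nontrivial

theorem exists_colon_multiplier {B : Type*} [CommRing B] [IsNoetherianRing B] (J : Ideal B) (d : ℕ)
    (hlen : ∀ ys : List B, IsWeaklyRegular B ys → (∀ y ∈ ys, y ∈ J) → ys.length ≤ d) :
    ∃ (g : ℕ) (y : Fin g → B) (c : B), g ≤ d ∧ WeakReg y B ∧ c ∉ Ideal.span (Set.range y) ∧
      ∀ a ∈ J, c * a ∈ Ideal.span (Set.range y) := by
  by_contra! H
  have key : ∀ k : ℕ, ∃ ys : List B, IsWeaklyRegular B ys ∧ (∀ y ∈ ys, y ∈ J) ∧ ys.length = k := by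
    intro k
    induction k with
    | zero => exact ⟨[], by simp, by simp, rfl⟩
    | succ k ih =>
      obtain ⟨ys, h1, h2, h3⟩ := ih
      have hr : Ideal.span (Set.range fun i => ys.get i) = Ideal.ofList ys := by
        rw [Ideal.ofList]; congr 1; ext; simp [List.mem_iff_get]
      obtain ⟨w, hw1, hw2⟩ := exists_isSMulRegular_of_forall
        (M := B ⧸ Ideal.ofList ys • (⊤ : Ideal B)) J (fun u hu => by
          obtain ⟨u, rfl⟩ := Submodule.mkQ_surjective _ u
          simp only [Submodule.mkQ_apply, ← Submodule.Quotient.mk_smul,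
            Submodule.Quotient.mk_eq_zero] at hu ⊢
          simp only [smul_eq_mul, Ideal.mul_top] at hu ⊢
          by_contra hc
          obtain ⟨a, ha, hca⟩ := H _ (fun i => ys.get i) u (hlen ys h1 h2)
            (by rw [weakReg_iff_isWeaklyRegular, List.ofFn_get]; exact h1) (by rwa [hr])
          rw [hr, mul_comm] at hca
          exact hca (hu a ha))
      refine ⟨ys ++ [w], (isWeaklyRegular_append_iff B ys [w]).2 ⟨h1, by simpa using hw2⟩, ?_,
        by simp [h3]⟩
      intro y hy
      rcases List.mem_append.1 hy with hy | hy
      · exact h2 y hy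
      · rw [List.mem_singleton.1 hy]; exact hw1
  obtain ⟨ys, h1, h2, h3⟩ := key (d + 1)
  have := hlen ys h1 h2
  omega

theorem exists_pow_notMem_sup {B : Type*} [CommRing B] [IsLocalRing B] [IsNoetherianRing B]
    {a : Ideal B} {c : B} (hc : c ∉ a) : ∃ L, c ∉ maximalIdeal B ^ L ⊔ a := by
  by_contra! H
  have h : a.mkQ c ∈ ⨅ i : ℕ, maximalIdeal B ^ i • (⊤ : Submodule B (B ⧸ a)) := by
    rw [Submodule.mem_iInf]
    intro L
    obtain ⟨u, hu, v, hv, huv⟩ := Submodule.mem_sup.1 (H L)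
    rw [← huv, map_add, (Submodule.Quotient.mk_eq_zero a).2 hv |> (id : _ → a.mkQ v = 0), add_zero,
      ← mul_one u, ← smul_eq_mul, map_smul]
    exact Submodule.smul_mem_smul hu trivial
  rw [Ideal.iInf_pow_smul_eq_bot_of_isLocalRing _ (Ideal.IsPrime.ne_top inferInstance)] at h
  exact hc ((Submodule.Quotient.mk_eq_zero a).1 h)

theorem KoszulCert.false_of_expChar {B : Type*} [CommRing B] [IsLocalRing B] [IsNoetherianRing B]
    {n r s M d : ℕ} {b : ℕ → ℕ} {U : Finset (Fin s)} (C : KoszulCert B n r s M b U)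
    (hU : U.card = r) (p : ℕ) [ExpChar B p] (hp : 1 < p) (ws : List B)
    (hws : IsWeaklyRegular B ws) (hlen : n ≤ 1 + ws.length)
    (hw : ∀ w ∈ ws, w ∈ Ideal.span (Set.range C.z)) (hz : ∀ j, C.z j ∈ maximalIdeal B)
    (hd : ∀ ys : List B, IsWeaklyRegular B ys → (∀ y ∈ ys, y ∈ Ideal.span (Set.range C.x)) →
      ys.length ≤ d) (hdr : d + 2 ≤ r) : False := by
  obtain ⟨g, y, c, hg, hy, hc, hcx⟩ := exists_colon_multiplier _ d hd
  obtain ⟨χ, hχ⟩ := exists_isColonFamily (x := C.x) (U := U) hy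
    (fun j _ => hcx _ (Ideal.subset_span ⟨j, rfl⟩))
  obtain ⟨L, hL⟩ := exists_pow_notMem_sup hc
  have hq : Ideal.span (Set.range fun j => C.z j ^ p ^ L) ≤ maximalIdeal B ^ L := by
    rw [Ideal.span_le]
    rintro _ ⟨j, rfl⟩
    exact Ideal.pow_le_pow_right (Nat.lt_pow_self hp).le (Ideal.pow_mem_pow (hz j) _)
  exact hL (SetLike.le_def.1 (sup_le_sup_right hq _)
    (C.mem_of_expChar hU p ws hws hlen hw hχ (by omega) L))

theorem charP_of_prime_of_cast_eq_zero {R : Type*} [CommRing R] [Nontrivial R] {p : ℕ}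
    [hp : Fact p.Prime] (h : (p : R) = 0) : CharP R p :=
  ringChar.of_eq (((Nat.dvd_prime hp.out).1 (ringChar.dvd h)).resolve_left
    CharP.ringChar_ne_one)

theorem exists_list_map_eq {α β : Type*} (f : α → β) {p : α → Prop} {ys : List β}
    (h : ∀ y ∈ ys, ∃ x, p x ∧ f x = y) : ∃ xs : List α, xs.map f = ys ∧ ∀ x ∈ xs, p x := by
  induction ys with
  | nil => exact ⟨[], rfl, by simp⟩
  | cons y ys ih =>
    obtain ⟨xs, h1, h2⟩ := ih fun y hy => h y (List.mem_cons_of_mem _ hy)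
    obtain ⟨x, hx, rfl⟩ := h y List.mem_cons_self
    exact ⟨x :: xs, by simp [h1], by simpa using ⟨hx, h2⟩⟩

theorem isWeaklyRegular_cons_iff_quotient {R : Type*} [CommRing R] (p : R) (ws : List R) :
    IsWeaklyRegular R (p :: ws) ↔ IsSMulRegular R p ∧
      IsWeaklyRegular (R ⧸ Ideal.span {p}) (ws.map (Ideal.Quotient.mk (Ideal.span {p}))) := by
  have e : QuotSMulTop p R ≃ₗ[R] R ⧸ Ideal.span {p} :=
    Submodule.quotEquivOfEq _ _ (by rw [← Submodule.ideal_span_singleton_smul]; simp)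
  rw [isWeaklyRegular_cons_iff, e.isWeaklyRegular_congr,
    ← isWeaklyRegular_map_algebraMap_iff (R ⧸ Ideal.span {p})]
  rfl

/-- Over a regular local ring of positive residue characteristic there is no certificate of a
nonzero Koszul map two steps above the height. -/
theorem KoszulCert.false_of_residue_charP {R : Type*} [CommRing R] [IsLocalRing R]
    [IsNoetherianRing R] {n r s M d : ℕ} {b : ℕ → ℕ} {U : Finset (Fin s)}
    (C : KoszulCert R n r s M b U) (hU : U.card = r)
    (hz : Ideal.span (Set.range C.z) = maximalIdeal R) (hdim : ringKrullDim R = n) (P : Ideal R)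
    [P.IsPrime] (hx : ∀ j, C.x j ∈ P) (hP : ringKrullDim (Localization.AtPrime P) = d)
    (hdr : d + 2 ≤ r) (p : ℕ) [hp : Fact p.Prime] (hpm : (p : R) ∈ maximalIdeal R) : False := by
  obtain ⟨hdom, hreg⟩ := isDomain_and_weakReg_of_regular C.z hz hdim
  have hd : ∀ ys : List R, IsWeaklyRegular R ys → (∀ y ∈ ys, y ∈ Ideal.span (Set.range C.x)) →
      ys.length ≤ d := by
    intro ys h1 h2
    have := length_le_ringKrullDim_localization h1 P fun y hy =>
      (Ideal.span_le (I := P)).2 (by rintro _ ⟨j, rfl⟩; exact hx j) (h2 y hy)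
    rw [hP] at this
    exact_mod_cast this
  have hzm : ∀ j, C.z j ∈ maximalIdeal R := fun j => hz ▸ Ideal.subset_span ⟨j, rfl⟩
  by_cases hp0 : (p : R) = 0
  · have : CharP R p := charP_of_prime_of_cast_eq_zero hp0
    obtain ⟨ws, h1, h2, h3⟩ := hreg.exists_isWeaklyRegular_extend [] (by simp) (by simp)
    exact C.false_of_expChar hU p hp.out.one_lt ws (by simpa using h1) (by simp at h3; omega) h2
      hzm hd hdr
  · have hsm : IsSMulRegular R (p : R) := IsSMulRegular.of_right_eq_zero_of_smul fun x hx => by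
      simpa [hp0] using hx
    obtain ⟨ws, h1, h2, h3⟩ := hreg.exists_isWeaklyRegular_extend [(p : R)]
      ((isWeaklyRegular_singleton_iff _ _).2 hsm) (by
        by_contra hn
        obtain rfl : n = 0 := by simpa using hn
        rw [Set.range_eq_empty, Ideal.span_empty] at hz
        rw [← hz] at hpm
        exact hp0 hpm)
    rw [List.singleton_append, isWeaklyRegular_cons_iff_quotient] at h1
    set π := Ideal.Quotient.mk (Ideal.span {(p : R)}) with hπ
    have hloc := isLocalRing_quotient_span_singleton hpm
    have : CharP (R ⧸ Ideal.span {(p : R)}) p := by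
      refine charP_of_prime_of_cast_eq_zero ?_
      rw [← map_natCast π, hπ, Ideal.Quotient.eq_zero_iff_mem]
      exact Ideal.subset_span rfl
    have hCz : (C.map π).z = π ∘ C.z := rfl
    have hCx : (C.map π).x = π ∘ C.x := rfl
    refine (C.map π).false_of_expChar hU p hp.out.one_lt (ws.map π) h1.2 ?_ ?_ ?_ (d := d) ?_ hdr
    · simp at h3 ⊢
      omega
    · intro w hw
      obtain ⟨w, hw', rfl⟩ := List.mem_map.1 hw
      rw [hCz, Set.range_comp, ← Ideal.map_span]
      exact Ideal.mem_map_of_mem _ (h2 w hw')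
    · intro j
      rw [maximalIdeal_quotient_eq_map]
      exact Ideal.mem_map_of_mem _ (hzm j)
    · intro ys h4 h5
      obtain ⟨ys, rfl, h6⟩ := exists_list_map_eq π (p := (· ∈ Ideal.span (Set.range C.x)))
        (ys := ys) fun y hy => by
          have := h5 y hy
          rw [hCx, Set.range_comp, ← Ideal.map_span,
            Ideal.mem_map_iff_of_surjective _ Ideal.Quotient.mk_surjective] at this
          exact this
      have h7 : IsWeaklyRegular R ((p : R) :: ys) :=
        (isWeaklyRegular_cons_iff_quotient _ _).2 ⟨hsm, h4⟩
      have h8 := IsLocalRing.isWeaklyRegular_of_perm_of_subset_maximalIdeal h7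
        (List.perm_append_singleton (p : R) ys).symm (by
          intro y hy
          rcases List.mem_cons.1 hy with rfl | hy
          · exact hpm
          · exact le_maximalIdeal (Ideal.IsPrime.ne_top ‹_›)
              ((Ideal.span_le (I := P)).2 (by rintro _ ⟨j, rfl⟩; exact hx j) (h6 y hy)))
      rw [List.length_map]
      exact hd ys ((isWeaklyRegular_append_iff R ys [(p : R)]).1 h8).1 h6

end ResidueCharP

/-- Pseudo-division: after multiplication by a power of the leading coefficient of `f`, every
polynomial has a division with remainder by `f`. -/
theorem Polynomial.exists_leadingCoeff_pow_mul_eq {Q : Type*} [CommRing Q] (f g : Polynomial Q)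
    (hf : f ≠ 0) :
    ∃ (N : ℕ) (q r : Polynomial Q), C (f.leadingCoeff ^ N) * g = f * q + r ∧
      r.degree < f.degree := by
  induction h : g.natDegree using Nat.strong_induction_on generalizing g with
  | _ m ih =>
    by_cases hlt : g.degree < f.degree
    · exact ⟨0, 0, g, by simp, hlt⟩
    push Not at hlt
    have hle : f.natDegree ≤ g.natDegree := natDegree_le_natDegree hlt
    by_cases hg0 : g = 0
    · exact ⟨0, 0, 0, by simp [hg0], by rw [degree_zero, bot_lt_iff_ne_bot]; simpa using hf⟩
    set g' := C f.leadingCoeff * g - f * (C g.leadingCoeff * X ^ (g.natDegree - f.natDegree))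
      with hg'
    by_cases hm : g'.degree < f.degree
    · refine ⟨1, C g.leadingCoeff * X ^ (g.natDegree - f.natDegree), g', ?_, hm⟩
      rw [hg']; simp
    have hdeg : g'.degree < g.degree := by
      rw [degree_eq_natDegree hg0]
      refine (degree_lt_iff_coeff_zero _ _).2 fun j hj ↦ ?_
      rw [hg', coeff_sub, coeff_C_mul, ← mul_assoc, coeff_mul_X_pow']
      rcases hj.eq_or_lt with rfl | hj
      · rw [if_pos (by omega), Nat.sub_sub_self hle, coeff_mul_C]
        simp
      · rw [coeff_eq_zero_of_natDegree_lt hj, if_pos (by omega), coeff_mul_C,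
          coeff_eq_zero_of_natDegree_lt (by omega)]
        simp
    have hg'0 : g' ≠ 0 := by
      rintro h0
      rw [h0, degree_zero] at hm
      exact hm (bot_lt_iff_ne_bot.2 (by simpa using hf))
    obtain ⟨N, q, r, hq, hr⟩ := ih g'.natDegree
      (h ▸ natDegree_lt_natDegree hg'0 hdeg) g' rfl
    refine ⟨N + 1, q + C (f.leadingCoeff ^ N) * (C g.leadingCoeff * X ^
        (g.natDegree - f.natDegree)), r, ?_, hr⟩
    have : C (f.leadingCoeff ^ N) * g' = C (f.leadingCoeff ^ (N + 1)) * g - f *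
        (C (f.leadingCoeff ^ N) * (C g.leadingCoeff * X ^ (g.natDegree - f.natDegree))) := by
      rw [hg', pow_succ, C_mul]; ring
    rw [this] at hq
    linear_combination hq

/-- A finitely generated algebraic extension of domains of characteristic zero is, after inverting
one element, generated by a root of a polynomial with nonvanishing derivative. -/
theorem exists_primitive_presentation {Q D : Type*} [CommRing Q] [IsDomain Q] [CharZero Q]
    [CommRing D] [IsDomain D] [Algebra Q D] (hinj : Function.Injective (algebraMap Q D))
    (V : Finset D) (hV : ∀ v ∈ V, IsAlgebraic Q v) :
    ∃ (α : D) (f : Polynomial Q) (h : Q) (G : D → Polynomial Q),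
      f.aeval α = 0 ∧ f.derivative.aeval α ≠ 0 ∧ h ≠ 0 ∧
      (∀ v ∈ V, algebraMap Q D h * v = (G v).aeval α) ∧
      ∀ g : Polynomial Q, g.aeval α = 0 → ∃ (N : ℕ) (q : Polynomial Q),
        Polynomial.C (h ^ N) * g = f * q := by
  classical
  have : FaithfulSMul Q D := (faithfulSMul_iff_algebraMap_injective Q D).2 hinj
  let K := FractionRing D
  let F := FractionRing Q
  let _ : Algebra F K := FractionRing.liftAlgebra Q K
  have : IsScalarTower Q F K := FractionRing.isScalarTower_liftAlgebra Q K
  have : CharZero F := charZero_of_injective_algebraMap (IsFractionRing.injective Q F)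
  have hDK : Function.Injective (algebraMap D K) := IsFractionRing.injective D K
  have hQF : Function.Injective (algebraMap Q F) := IsFractionRing.injective Q F
  let S : Set K := algebraMap D K '' (V : Set D)
  have hSfin : S.Finite := V.finite_toSet.image _
  have halg : ∀ x ∈ S, IsAlgebraic F x := by
    rintro _ ⟨v, hv, rfl⟩
    have h1 : IsAlgebraic Q (algebraMap D K v) := (hV v hv).algebraMap
    exact h1.extendScalars hQF
  let E := IntermediateField.adjoin F S
  have : FiniteDimensional F E :=
    have : Finite S := hSfin
    IntermediateField.finiteDimensional_adjoin fun x hx ↦ (halg x hx).isIntegral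
  obtain ⟨β, hβ⟩ := Field.exists_primitive_element F E
  have hβE : IntermediateField.adjoin F {(β : K)} = E := by
    have := congrArg IntermediateField.lift hβ
    simpa only [IntermediateField.lift_adjoin_simple, IntermediateField.lift_top] using this
  -- elements with a denominator in `Q`
  let W : Subalgebra F K :=
    { carrier := {x | ∃ q : Q, q ≠ 0 ∧ ∃ d : D, q • x = algebraMap D K d}
      mul_mem' := by
        rintro x y ⟨q, hq, d, hd⟩ ⟨q', hq', d', hd'⟩
        refine ⟨q * q', mul_ne_zero hq hq', d * d', ?_⟩
        rw [map_mul, ← hd, ← hd', smul_mul_smul_comm]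
      add_mem' := by
        rintro x y ⟨q, hq, d, hd⟩ ⟨q', hq', d', hd'⟩
        refine ⟨q * q', mul_ne_zero hq hq', q' • d + q • d', ?_⟩
        have key (a : Q) (z : D) : algebraMap D K (a • z) = a • algebraMap D K z := by
          rw [Algebra.smul_def, map_mul, ← IsScalarTower.algebraMap_apply, Algebra.smul_def]
        rw [map_add, key, key, ← hd, ← hd', smul_add, smul_smul, smul_smul, mul_comm q']
      algebraMap_mem' := by
        intro a
        obtain ⟨p, q, hq, rfl⟩ := IsFractionRing.div_surjective (A := Q) a
        refine ⟨q, nonZeroDivisors.ne_zero hq, algebraMap Q D p, ?_⟩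
        rw [Algebra.smul_def, ← IsScalarTower.algebraMap_apply, IsScalarTower.algebraMap_apply Q F
            K,
          ← map_mul, mul_div_cancel₀, IsScalarTower.algebraMap_apply Q F K]
        exact fun h0 ↦ nonZeroDivisors.ne_zero hq (hQF (by rw [h0, map_zero])) }
  have hE : E.toSubalgebra = Algebra.adjoin F S :=
    IntermediateField.adjoin_toSubalgebra_of_isAlgebraic halg
  have hEW : E.toSubalgebra ≤ W := by
    rw [hE, Algebra.adjoin_le_iff]
    rintro _ ⟨v, -, rfl⟩
    exact ⟨1, one_ne_zero, v, one_smul _ _⟩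
  obtain ⟨q₀, hq₀, α, hα⟩ := hEW β.2
  set a : K := algebraMap D K α with ha
  have hq₀F : algebraMap Q F q₀ ≠ 0 := fun h0 ↦ hq₀ (hQF (by rw [h0, map_zero]))
  have haβ : a = algebraMap F K (algebraMap Q F q₀) * (β : K) := by
    rw [← hα, Algebra.smul_def, IsScalarTower.algebraMap_apply Q F K]
  have haE : a ∈ E := haβ ▸ mul_mem (E.algebraMap_mem _) β.2
  have haint : IsIntegral F a := by
    have := (Algebra.IsIntegral.isIntegral (R := F) (⟨a, haE⟩ : E)).map E.val
    simpa using this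
  have hEa : E.toSubalgebra ≤ Algebra.adjoin F {a} := by
    rw [← IntermediateField.adjoin_simple_toSubalgebra_of_isAlgebraic haint.isAlgebraic]
    change E ≤ IntermediateField.adjoin F {a}
    rw [← hβE, IntermediateField.adjoin_simple_le_iff]
    have : (β : K) = algebraMap F K (algebraMap Q F q₀)⁻¹ * a := by
      rw [haβ, ← mul_assoc, ← map_mul, inv_mul_cancel₀ hq₀F, map_one, one_mul]
    rw [this]
    exact mul_mem (IntermediateField.algebraMap_mem _ _)
      (IntermediateField.mem_adjoin_simple_self F a)
  have hclear (g : Polynomial F) : ∃ (b : Q) (G : Polynomial Q), b ≠ 0 ∧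
      G.map (algebraMap Q F) = Polynomial.C (algebraMap Q F b) * g := by
    obtain ⟨b, hbm, hb⟩ := IsLocalization.integerNormalization_spec (nonZeroDivisors Q) g
    refine ⟨b, _, nonZeroDivisors.ne_zero hbm, hb.trans ?_⟩
    rw [Algebra.smul_def]
    rfl
  have haeval (g : Polynomial Q) :
      algebraMap D K (g.aeval α) = (g.map (algebraMap Q F)).aeval a := by
    rw [Polynomial.aeval_map_algebraMap, ha, Polynomial.aeval_algebraMap_apply]
  obtain ⟨b, f, hb, hf⟩ := hclear (minpoly F a)
  have hbF : algebraMap Q F b ≠ 0 := fun h0 ↦ hb (hQF (by rw [h0, map_zero]))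
  have hfdeg : f.degree = (minpoly F a).degree := by
    rw [← Polynomial.degree_map_eq_of_injective hQF, hf, Polynomial.degree_C_mul hbF]
  have hf0 : f ≠ 0 := by
    rintro rfl
    rw [Polynomial.degree_zero, eq_comm, Polynomial.degree_eq_bot] at hfdeg
    exact minpoly.ne_zero haint hfdeg
  have hv (v : D) : ∃ (c : Q) (G : Polynomial Q), c ≠ 0 ∧
      (v ∈ V → algebraMap Q D c * v = G.aeval α) := by
    by_cases hvV : v ∈ V
    · have hvE : algebraMap D K v ∈ Algebra.adjoin F {a} :=
        hEa (IntermediateField.subset_adjoin F S ⟨v, hvV, rfl⟩)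
      rw [Algebra.adjoin_singleton_eq_range_aeval] at hvE
      obtain ⟨g, hg⟩ := hvE
      obtain ⟨c, G, hc, hG⟩ := hclear g
      refine ⟨c, G, hc, fun _ ↦ hDK ?_⟩
      rw [haeval, hG, map_mul, map_mul, Polynomial.aeval_C]
      erw [hg]
      rw [← IsScalarTower.algebraMap_apply, ← IsScalarTower.algebraMap_apply]
    · exact ⟨1, 0, one_ne_zero, fun h ↦ absurd h hvV⟩
  choose c G hc hG using hv
  refine ⟨α, f, f.leadingCoeff * ∏ v ∈ V, c v,
    fun v ↦ Polynomial.C (f.leadingCoeff * ∏ w ∈ V.erase v, c w) * G v, ?_, ?_, ?_, ?_, ?_⟩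
  · apply hDK
    rw [haeval, hf, map_mul, minpoly.aeval, mul_zero, map_zero]
  · intro h0
    have := congrArg (algebraMap D K) h0
    rw [haeval, ← Polynomial.derivative_map, hf, Polynomial.derivative_C_mul, map_mul,
      Polynomial.aeval_C, map_zero, mul_eq_zero, map_eq_zero] at this
    exact (minpoly.irreducible haint).separable.aeval_derivative_ne_zero (minpoly.aeval F a)
      (this.resolve_left hbF)
  · exact mul_ne_zero (Polynomial.leadingCoeff_ne_zero.2 hf0)
      (Finset.prod_ne_zero_iff.2 fun v _ ↦ hc v)
  · intro v hv
    dsimp only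
    rw [map_mul, map_mul (Polynomial.aeval α), Polynomial.aeval_C, ← hG v hv, ←
        Finset.mul_prod_erase V c hv, map_mul, map_mul]
    ring
  · intro g hg
    obtain ⟨N, q, r, hqr, hr⟩ := f.exists_leadingCoeff_pow_mul_eq g hf0
    have hfα : f.aeval α = 0 := by
      apply hDK
      rw [haeval, hf, map_mul, minpoly.aeval, mul_zero, map_zero]
    have hrα : r.aeval α = 0 := by
      have := congrArg (Polynomial.aeval α) hqr
      simpa [hg, hfα] using this.symm
    have hr0 : r = 0 := by
      by_contra hr0
      have h1 : (r.map (algebraMap Q F)).aeval a = 0 := by rw [← haeval, hrα, map_zero]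
      have h2 := minpoly.degree_le_of_ne_zero F a
        ((Polynomial.map_ne_zero_iff hQF).2 hr0) h1
      rw [Polynomial.degree_map_eq_of_injective hQF, ← hfdeg] at h2
      exact absurd hr h2.not_gt
    refine ⟨N, Polynomial.C ((∏ v ∈ V, c v) ^ N) * q, ?_⟩
    rw [hr0, add_zero] at hqr
    rw [mul_pow, Polynomial.C_mul]
    linear_combination Polynomial.C ((∏ v ∈ V, c v) ^ N) * hqr

/-- A point satisfying the equations of a primitive presentation gives a ring homomorphism from
the subring generated by the presented elements. -/
theorem exists_ringHom_of_presentation {Q D E : Type*} [CommRing Q] [CommRing D]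
    [CommRing E] [IsDomain E] (d : Q →+* D) (e : Q →+* E) (V : Finset D) {α : D}
    {f : Polynomial Q} {h : Q} {G : D → Polynomial Q} (he : e h ≠ 0)
    (hG : ∀ v ∈ V, d h * v = (G v).eval₂ d α)
    (hmin : ∀ g : Polynomial Q, g.eval₂ d α = 0 → ∃ (N : ℕ) (q : Polynomial Q),
        Polynomial.C (h ^ N) * g = f * q)
    {α' : E} {y : D → E} (hf : f.eval₂ e α' = 0) (hy : ∀ v ∈ V, e h * y v = (G v).eval₂ e α') :
    ∃ (A : Subring D) (φ : A →+* E), (∀ v ∈ V, ∃ hv : v ∈ A, φ ⟨v, hv⟩ = y v) ∧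
      ∀ q : Q, ∃ hq : d q ∈ A, φ ⟨d q, hq⟩ = e q := by
  classical
  let evD : MvPolynomial V Q →+* D := MvPolynomial.eval₂Hom d (fun v ↦ v)
  let evE : MvPolynomial V Q →+* E := MvPolynomial.eval₂Hom e (fun v ↦ y v)
  have key (p : MvPolynomial V Q) : ∃ (N : ℕ) (g : Polynomial Q),
      d h ^ N * evD p = g.eval₂ d α ∧ e h ^ N * evE p = g.eval₂ e α' := by
    induction p using MvPolynomial.induction_on with
    | C a => exact ⟨0, Polynomial.C a, by simp [evD], by simp [evE]⟩
    | add p q hp hq =>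
      obtain ⟨N, g, h1, h2⟩ := hp
      obtain ⟨M, g', h1', h2'⟩ := hq
      refine ⟨N + M, Polynomial.C (h ^ M) * g + Polynomial.C (h ^ N) * g', ?_, ?_⟩
      · rw [Polynomial.eval₂_add, Polynomial.eval₂_mul, Polynomial.eval₂_mul, Polynomial.eval₂_C,
          Polynomial.eval₂_C, map_pow, map_pow, map_add, ← h1, ← h1']
        ring
      · rw [Polynomial.eval₂_add, Polynomial.eval₂_mul, Polynomial.eval₂_mul, Polynomial.eval₂_C,
          Polynomial.eval₂_C, map_pow, map_pow, map_add, ← h2, ← h2']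
        ring
    | mul_X p v hp =>
      obtain ⟨N, g, h1, h2⟩ := hp
      refine ⟨N + 1, g * G v, ?_, ?_⟩
      · rw [Polynomial.eval₂_mul, ← h1, ← hG v v.2, map_mul]
        simp only [evD, MvPolynomial.coe_eval₂Hom, MvPolynomial.eval₂_X]
        ring
      · rw [Polynomial.eval₂_mul, ← h2, ← hy v v.2, map_mul]
        simp only [evE, MvPolynomial.coe_eval₂Hom, MvPolynomial.eval₂_X]
        ring
  have hker : RingHom.ker evD.rangeRestrict ≤ RingHom.ker evE := by
    intro p hp
    rw [RingHom.mem_ker] at hp ⊢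
    have hp : evD p = 0 := congrArg Subtype.val hp
    obtain ⟨N, g, h1, h2⟩ := key p
    rw [hp, mul_zero] at h1
    obtain ⟨M, q, hq⟩ := hmin g h1.symm
    have h3 := congrArg (Polynomial.eval₂ e α') hq
    rw [Polynomial.eval₂_mul, Polynomial.eval₂_mul, hf, zero_mul, Polynomial.eval₂_C, ← h2,
      map_pow] at h3
    exact (mul_eq_zero.1 ((mul_eq_zero.1 h3).resolve_left (pow_ne_zero _ he))).resolve_left
      (pow_ne_zero _ he)
  refine ⟨evD.range, RingHom.liftOfSurjective evD.rangeRestrict evD.rangeRestrict_surjective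
    ⟨evE, hker⟩, fun v hv ↦ ?_, fun q ↦ ?_⟩
  · have hX : evD (MvPolynomial.X ⟨v, hv⟩) = v := by simp [evD]
    refine ⟨⟨_, hX⟩, ?_⟩
    have : (⟨v, ⟨_, hX⟩⟩ : evD.range) = evD.rangeRestrict (MvPolynomial.X ⟨v, hv⟩) :=
      Subtype.ext hX.symm
    rw [this, RingHom.liftOfRightInverse_comp_apply]
    simp [evE]
  · have hX : evD (MvPolynomial.C q) = d q := by simp [evD]
    refine ⟨⟨_, hX⟩, ?_⟩
    have : (⟨d q, ⟨_, hX⟩⟩ : evD.range) = evD.rangeRestrict (MvPolynomial.C q) :=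
      Subtype.ext hX.symm
    rw [this, RingHom.liftOfRightInverse_comp_apply]
    simp [evE]

/-- An ideal along which Newton's method converges: `1 + 𝔫` consists of units, and perturbations of
`e + u = 0` by terms of order at least two in `u` have a solution divisible by `e`. -/
structure IsNewtonIdeal {B : Type*} [CommRing B] (𝔫 : Ideal B) : Prop where
  isUnit_one_add : ∀ x ∈ 𝔫, IsUnit (1 + x)
  exists_root : ∀ (k : Polynomial B), ∀ e ∈ 𝔫, ∃ c, e + e * c + k.eval (e * c) * (e * c) ^ 2 = 0

theorem IsNewtonIdeal.exists_eval_eq_zero {B : Type*} [CommRing B] {𝔫 : Ideal B}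
    (h𝔫 : IsNewtonIdeal 𝔫) (f : Polynomial B) (a e : B) (he : e ∈ 𝔫)
    (hf : f.eval a = f.derivative.eval a ^ 2 * e) :
    ∃ c, f.eval (a + f.derivative.eval a * (e * c)) = 0 := by
  set δ := f.derivative.eval a with hδ
  obtain ⟨k, hk⟩ := (f.map Polynomial.C).binomExpansion (Polynomial.C a)
    (Polynomial.C δ * Polynomial.X)
  obtain ⟨c, hc⟩ := h𝔫.exists_root k e he
  refine ⟨c, ?_⟩
  have h1 := congrArg (Polynomial.eval (e * c)) hk
  have h2 : Polynomial.eval (e * c) ((f.map Polynomial.C).eval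
      (Polynomial.C a + Polynomial.C δ * Polynomial.X)) = f.eval (a + δ * (e * c)) := by
    rw [Polynomial.eval_map, ← Polynomial.coe_evalRingHom, Polynomial.hom_eval₂,
      show (Polynomial.evalRingHom (e * c)).comp Polynomial.C = RingHom.id B by ext; simp]
    simp [Polynomial.eval₂_id]
  rw [h2] at h1
  rw [h1]
  simp only [Polynomial.eval_add, Polynomial.eval_mul, Polynomial.eval_pow, Polynomial.eval_C,
    Polynomial.eval_X, Polynomial.derivative_map, Polynomial.eval_map, Polynomial.eval₂_at_apply,
    ← hδ, hf]
  linear_combination δ ^ 2 * hc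

theorem isNewtonIdeal_maximalIdeal (B : Type*) [CommRing B] [HenselianLocalRing B] :
    IsNewtonIdeal (maximalIdeal B) := by
  refine ⟨fun x hx ↦ ?_, fun k e he ↦ ?_⟩
  · by_contra h
    have := Ideal.sub_mem _ ((mem_maximalIdeal _).2 h) hx
    simp at this
  -- the reciprocal polynomial of the equation satisfied by `-u / e`
  set d := k.natDegree with hd
  let p : Polynomial B := Polynomial.X ^ (d + 2) - Polynomial.X ^ (d + 1) +
    ∑ j ∈ Finset.range (d + 1), Polynomial.C (k.coeff j * (-1) ^ j * e ^ (j + 1)) *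
      Polynomial.X ^ (d - j)
  have hp : p.Monic := by
    have hlt : (-Polynomial.X ^ (d + 1) +
        ∑ j ∈ Finset.range (d + 1), Polynomial.C (k.coeff j * (-1) ^ j * e ^ (j + 1)) *
          Polynomial.X ^ (d - j) : Polynomial B).degree < ((d + 2 : ℕ) : WithBot ℕ) := by
      refine (Polynomial.degree_add_le _ _).trans_lt (max_lt ?_ ?_)
      · rw [Polynomial.degree_neg]
        exact (Polynomial.degree_X_pow_le _).trans_lt (by exact_mod_cast Nat.lt_succ_self _)
      · refine (Polynomial.degree_sum_le _ _).trans_lt ?_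
        refine (Finset.sup_lt_iff (WithBot.bot_lt_coe _)).2 fun j hj ↦ ?_
        exact (Polynomial.degree_C_mul_X_pow_le _ _).trans_lt (by exact_mod_cast (by omega))
    have := Polynomial.monic_X_pow_add hlt
    rwa [← add_assoc, ← sub_eq_add_neg] at this
  have hsum (y : B) : p.eval y = y ^ (d + 2) - y ^ (d + 1) +
      ∑ j ∈ Finset.range (d + 1), k.coeff j * (-1) ^ j * e ^ (j + 1) * y ^ (d - j) := by
    simp [p, Polynomial.eval_finsetSum]
  have h1 : p.eval 1 ∈ maximalIdeal B := by
    rw [hsum]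
    simp only [one_pow, sub_self, zero_add, mul_one]
    exact Ideal.sum_mem _ fun j _ ↦ Ideal.mul_mem_left _ _ (Ideal.pow_mem_of_mem _ he _ j.succ_pos)
  have h2 : IsUnit (p.derivative.eval 1) := by
    have h3 : p.derivative.eval 1 = 1 + ∑ j ∈ Finset.range (d + 1),
        k.coeff j * (-1) ^ j * e ^ (j + 1) * ((d - j : ℕ) : B) := by
      simp only [p, Polynomial.derivative_add, Polynomial.derivative_sub,
          Polynomial.derivative_X_pow,
        Polynomial.derivative_sum, Polynomial.derivative_C_mul, Polynomial.eval_add,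
        Polynomial.eval_sub, Polynomial.eval_mul, Polynomial.eval_C, Polynomial.eval_pow,
        Polynomial.eval_X, Polynomial.eval_finsetSum, one_pow, mul_one]
      push_cast
      ring
    rw [h3]
    by_contra hu
    have hmem : ∑ j ∈ Finset.range (d + 1), k.coeff j * (-1) ^ j * e ^ (j + 1) * ((d - j : ℕ) : B) ∈
        maximalIdeal B := Ideal.sum_mem _ fun j _ ↦ Ideal.mul_mem_right _ _
          (Ideal.mul_mem_left _ _ (Ideal.pow_mem_of_mem _ he _ j.succ_pos))
    have := Ideal.sub_mem _ ((mem_maximalIdeal _).2 hu) hmem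
    rw [add_sub_cancel_right] at this
    exact (Ideal.ne_top_iff_one _).1 (maximalIdeal.isMaximal B).ne_top this
  obtain ⟨y, hy, hy1⟩ := HenselianLocalRing.is_henselian p hp 1 h1 h2
  have hyu : IsUnit y := by
    by_contra hu
    have := Ideal.sub_mem _ ((mem_maximalIdeal _).2 hu) hy1
    rw [sub_sub_cancel] at this
    exact (Ideal.ne_top_iff_one _).1 (maximalIdeal.isMaximal B).ne_top this
  obtain ⟨z, hz⟩ := hyu.exists_right_inv
  refine ⟨-z, ?_⟩
  rw [Polynomial.IsRoot, hsum] at hy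
  have hk : k.eval (e * -z) = ∑ j ∈ Finset.range (d + 1), k.coeff j * (e * -z) ^ j :=
    Polynomial.eval_eq_sum_range _
  have key : ∑ j ∈ Finset.range (d + 1), k.coeff j * (-1) ^ j * e ^ (j + 1) * y ^ (d - j) * z ^
      (d + 2) =
      e * z ^ 2 * k.eval (e * -z) := by
    rw [hk, Finset.mul_sum]
    refine Finset.sum_congr rfl fun j hj ↦ ?_
    have hjd : j ≤ d := by simpa [Nat.lt_succ_iff] using hj
    have : y ^ (d - j) * z ^ (d + 2) = z ^ (j + 2) := by
      rw [show d + 2 = (d - j) + (j + 2) by omega, pow_add z, ← mul_assoc, ← mul_pow, hz, one_pow,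
        one_mul]
    rw [mul_assoc, this, show e * -z = (-1) * (e * z) by ring, mul_pow, mul_pow]
    ring
  have h5 : y ^ (d + 2) * z ^ (d + 2) = 1 := by rw [← mul_pow, hz, one_pow]
  have h6 : y ^ (d + 1) * z ^ (d + 2) = z := by
    rw [pow_succ z (d + 1), ← mul_assoc, ← mul_pow, hz, one_pow, one_mul]
  have h7 := congrArg (fun t ↦ t * z ^ (d + 2)) hy
  simp only [add_mul, sub_mul, Finset.sum_mul, zero_mul, h5, h6, key] at h7
  linear_combination e * h7

/-- Newton's method for a system in primitive form. -/
theorem IsNewtonIdeal.exists_point {Q B D : Type*} [CommRing Q] [CommRing B] [IsDomain B]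
    {𝔫 : Ideal B} (h𝔫 : IsNewtonIdeal 𝔫) (e : Q →+* B) {f : Polynomial Q} {h : Q}
    {G : D → Polynomial Q} {V : Finset D} {W w q x a : B} {y v : D → B} (hx : x ∈ 𝔫) (hW : W ≠ 0)
    (hq : IsUnit q) (hf : f.eval₂ e a = W ^ 2 * w)
    (hd : x * e h * f.derivative.eval₂ e a ^ 2 = W * q)
    (hG : ∀ d ∈ V, (G d).eval₂ e a = e h * y d + W * v d) :
    e h ≠ 0 ∧ ∃ (a' : B) (y' : D → B), f.eval₂ e a' = 0 ∧
      ∀ d ∈ V, e h * y' d = (G d).eval₂ e a' := by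
  obtain ⟨q', hq'⟩ := hq.exists_right_inv
  set δ := f.derivative.eval₂ e a with hδ
  have hW' : W = x * e h * δ ^ 2 * q' := by linear_combination -W * hq' - q' * hd
  set ε := x * e h * q' * W * w with hε
  have hεn : ε ∈ 𝔫 := by
    rw [hε, mul_assoc, mul_assoc, mul_assoc]
    exact Ideal.mul_mem_right _ _ hx
  have hfe : (f.map e).eval a = (f.map e).derivative.eval a ^ 2 * ε := by
    rw [Polynomial.derivative_map, Polynomial.eval_map, Polynomial.eval_map, ← hδ, hf, hε]
    linear_combination W * w * hW'
  obtain ⟨c, hc⟩ := h𝔫.exists_eval_eq_zero (f.map e) a ε hεn hfe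
  refine ⟨fun h0 ↦ hW (by rw [hW', h0]; ring), ?_⟩
  set a' := a + (f.map e).derivative.eval a * (ε * c) with ha'
  have hdvd (d : D) : ∃ r, (G d).eval₂ e a' = (G d).eval₂ e a + e h * r := by
    obtain ⟨r, hr⟩ := ((G d).map e).sub_dvd_eval_sub a' a
    rw [Polynomial.eval_map, Polynomial.eval_map] at hr
    refine ⟨(f.map e).derivative.eval a * (x * q' * W * w * c) * r, ?_⟩
    rw [sub_eq_iff_eq_add'.1 hr, ha', hε]
    ring
  choose r hr using hdvd
  refine ⟨a', fun d ↦ y d + x * δ ^ 2 * q' * v d + r d, by rwa [← Polynomial.eval_map], ?_⟩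
  intro d hdV
  rw [hr, hG d hdV]
  linear_combination -v d * hW'

theorem Polynomial.IsDistinguishedAt.exists_dvd_coe_sub {A : Type*} [CommRing A] {I : Ideal A}
    [IsAdicComplete I A] {g : Polynomial A} (hg : g.IsDistinguishedAt I) (f : PowerSeries A) :
    ∃ p : Polynomial A, (g : PowerSeries A) ∣ (p : PowerSeries A) - f := by
  obtain ⟨x, hx⟩ := hg.algEquivQuotient.surjective (Ideal.Quotient.mk _ f)
  obtain ⟨p, rfl⟩ := Ideal.Quotient.mk_surjective x
  have : Ideal.Quotient.mk (Ideal.span {(g : PowerSeries A)}) (p : PowerSeries A) =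
    Ideal.Quotient.mk _ f := hx
  exact ⟨p, Ideal.mem_span_singleton.1 (Ideal.Quotient.eq.1 this)⟩

theorem Polynomial.IsDistinguishedAt.dvd_of_coe_dvd {A : Type*} [CommRing A] {I : Ideal A}
    [IsAdicComplete I A] {g : Polynomial A} (hg : g.IsDistinguishedAt I) {p : Polynomial A}
    (h : (g : PowerSeries A) ∣ (p : PowerSeries A)) : g ∣ p := by
  rw [← Ideal.mem_span_singleton, ← Ideal.Quotient.eq_zero_iff_mem]
  apply hg.algEquivQuotient.injective
  rw [map_zero]
  have : Ideal.Quotient.mk (Ideal.span {(g : PowerSeries A)}) (p : PowerSeries A) = 0 :=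
    Ideal.Quotient.eq_zero_iff_mem.2 (Ideal.mem_span_singleton.2 h)
  exact this

/-- Weierstrass preparation replaces a power series solution of a system in primitive form by a
polynomial approximate solution. -/
theorem exists_polynomial_approximation {A k J D : Type*} [CommRing A] [IsDomain A]
    [IsLocalRing A] [IsAdicComplete (maximalIdeal A) A] [CommRing k] (ι : k →+* A)
    (s : J → PowerSeries A) {V : Finset D} {val : D → PowerSeries A}
    {f : Polynomial (MvPolynomial J k)} {h : MvPolynomial J k}
    {G : D → Polynomial (MvPolynomial J k)} {α : PowerSeries A}
        {d : MvPolynomial J k →+* PowerSeries A}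
    (hd : d = MvPolynomial.eval₂Hom ((PowerSeries.C (R := A)).comp ι) s) (hf : f.eval₂ d α = 0)
    (hG : ∀ v ∈ V, (G v).eval₂ d α = d h * val v)
    (hH : (PowerSeries.X * d h * f.derivative.eval₂ d α ^ 2).map (residue A) ≠ 0) :
    ∃ (W w q a : Polynomial A) (s' : J → Polynomial A) (y v : D → Polynomial A),
      W.Monic ∧ IsUnit (q.coeff 0) ∧ (∀ j p, s j = ((p : Polynomial A) : PowerSeries A) → s' j = p)
          ∧
      ∀ e, e = MvPolynomial.eval₂Hom ((Polynomial.C (R := A)).comp ι) s' →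
        f.eval₂ e a = W ^ 2 * w ∧
        Polynomial.X * e h * f.derivative.eval₂ e a ^ 2 = W * q ∧
        ∀ d ∈ V, (G d).eval₂ e a = e h * y d + W * v d := by
  classical
  obtain ⟨W, u, hW, hu, hHW⟩ := PowerSeries.exists_isWeierstrassFactorization hH
  have hW2 : (W ^ 2).IsDistinguishedAt (maximalIdeal A) := by rw [pow_two]; exact hW.mul hW
  choose P hP using fun g ↦ hW2.exists_dvd_coe_sub g
  let s' : J → Polynomial A := fun j ↦
    if hj : ∃ p : Polynomial A, s j = (p : PowerSeries A) then hj.choose else P (s j)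
  have hs' (j) : ((W ^ 2 : Polynomial A) : PowerSeries A) ∣ (s' j : PowerSeries A) - s j := by
    by_cases hj : ∃ p : Polynomial A, s j = (p : PowerSeries A)
    · simp only [s', dif_pos hj]
      rw [← hj.choose_spec, sub_self]
      exact dvd_zero _
    · simp only [s', dif_neg hj]
      exact hP _
  have hs'c (j) (p : Polynomial A) (hp : s j = (p : PowerSeries A)) : s' j = p := by
    have hj : ∃ p : Polynomial A, s j = (p : PowerSeries A) := ⟨p, hp⟩
    simp only [s', dif_pos hj]
    exact Polynomial.coe_injective _ (hj.choose_spec.symm.trans hp)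
  set e := MvPolynomial.eval₂Hom ((Polynomial.C (R := A)).comp ι) s' with he
  let c := Polynomial.coeToPowerSeries.ringHom (R := A)
  let π := Ideal.Quotient.mk (Ideal.span {((W ^ 2 : Polynomial A) : PowerSeries A)})
  have hπ {a b : PowerSeries A} :
      π a = π b ↔ ((W ^ 2 : Polynomial A) : PowerSeries A) ∣ a - b := by
    rw [Ideal.Quotient.eq, Ideal.mem_span_singleton]
  have hπe : (π.comp c).comp e = π.comp d := by
    refine MvPolynomial.ringHom_ext (fun r ↦ ?_) (fun j ↦ ?_)
    · simp [he, hd, c]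
    · simp only [RingHom.comp_apply, he, hd, MvPolynomial.coe_eval₂Hom, MvPolynomial.eval₂_X]
      exact hπ.2 (hs' j)
  have hα : π (c (P α)) = π α := hπ.2 (hP α)
  have heval (g : Polynomial (MvPolynomial J k)) :
      π (c (g.eval₂ e (P α))) = π (g.eval₂ d α) := by
    rw [← RingHom.comp_apply, Polynomial.hom_eval₂, hπe, RingHom.comp_apply, hα,
      ← Polynomial.hom_eval₂]
  have hWdvd {p : Polynomial A} (h0 : π (c p) = 0) : W ^ 2 ∣ p :=
    hW2.dvd_of_coe_dvd (Ideal.mem_span_singleton.1 (Ideal.Quotient.eq_zero_iff_mem.1 h0))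
  have hhe : π (c (e h)) = π (d h) := congr($hπe h)
  obtain ⟨w, hw⟩ := hWdvd (p := f.eval₂ e (P α)) (by rw [heval, hf, map_zero])
  have hWX : π (c (Polynomial.X * e h * f.derivative.eval₂ e (P α) ^ 2)) =
      π ((W : PowerSeries A) * u) := by
    rw [← hHW]
    simp only [map_mul, map_pow, heval, hhe]
    simp [c]
  obtain ⟨v₀, hv₀⟩ := hπ.1 hWX
  have hval (b : D) (hb : b ∈ V) :
      W ^ 2 ∣ (G b).eval₂ e (P α) - e h * P (val b) := by
    apply hWdvd
    have : π (c (P (val b))) = π (val b) := hπ.2 (hP _)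
    rw [map_sub, map_sub, heval, hG b hb, map_mul, map_mul, map_mul, hhe, this, sub_self]
  choose! v hv using hval
  have hv₀' : c (Polynomial.X * e h * f.derivative.eval₂ e (P α) ^ 2) =
      (W : PowerSeries A) * (u + W * v₀) := by
    rw [Polynomial.coe_pow] at hv₀
    linear_combination hv₀
  obtain ⟨q, hq⟩ : W ∣ Polynomial.X * e h * f.derivative.eval₂ e (P α) ^ 2 :=
    hW.dvd_of_coe_dvd (Dvd.intro _ hv₀'.symm)
  have hW0 : (W : PowerSeries A) ≠ 0 := by
    rw [Ne, Polynomial.coe_eq_zero_iff]; exact hW.monic.ne_zero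
  have hqu : (q : PowerSeries A) = u + W * v₀ := by
    apply mul_left_cancel₀ hW0
    rw [← hv₀', hq]
    simp [c]
  have hu0 : IsUnit (PowerSeries.constantCoeff u) := hu.map _
  have hWc : W.coeff 0 = 0 := by
    have h1 := congrArg PowerSeries.constantCoeff hHW
    simp only [map_mul, PowerSeries.constantCoeff_X, zero_mul] at h1
    have h2 := (hu0.mul_left_eq_zero).1 h1.symm
    simpa using h2
  have hqc : q.coeff 0 = PowerSeries.constantCoeff u := by
    have h1 := congrArg PowerSeries.constantCoeff hqu
    simpa [hWc] using h1
  refine ⟨W, w, q, P α, s', fun b ↦ P (val b), fun b ↦ W * v b, hW.monic, hqc ▸ hu0, hs'c,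
    fun e' he' ↦ ?_⟩
  rw [← he] at he'
  subst he'
  refine ⟨hw, hq, fun b hb ↦ ?_⟩
  linear_combination hv b hb

namespace MvPowerSeries

/-- The substitution `X 0 ↦ X 0`, `X (i + 1) ↦ X (i + 1) + a i * X 0`. -/
noncomputable def shearVec {k : Type*} [CommRing k] {n : ℕ} (a : Fin n → k) :
    Fin (n + 1) → MvPowerSeries (Fin (n + 1)) k :=
  Fin.cons (X 0) fun i ↦ X i.succ + C (a i) * X 0

theorem constantCoeff_shearVec {k : Type*} [CommRing k] {n : ℕ} (a : Fin n → k) (i : Fin (n + 1)) :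
    constantCoeff (shearVec a i) = 0 := by
  refine Fin.cases ?_ (fun i ↦ ?_) i <;> simp [shearVec]

/-- The ring homomorphism with `X 0 ↦ X 0`, `X (i + 1) ↦ X (i + 1) + a i * X 0`. -/
noncomputable def shear {k : Type*} [CommRing k] {n : ℕ} (a : Fin n → k) :
    MvPowerSeries (Fin (n + 1)) k →ₐ[k] MvPowerSeries (Fin (n + 1)) k :=
  substAlgHom (hasSubst_of_constantCoeff_zero (constantCoeff_shearVec a))

theorem shear_X_zero {k : Type*} [CommRing k] {n : ℕ} (a : Fin n → k) : shear a (X 0) = X 0 := by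
  rw [shear, substAlgHom_X]; rfl

theorem shear_X_succ {k : Type*} [CommRing k] {n : ℕ} (a : Fin n → k) (i : Fin n) :
    shear a (X i.succ) = X i.succ + C (a i) * X 0 := by
  rw [shear, substAlgHom_X]; rfl

theorem shear_C {k : Type*} [CommRing k] {n : ℕ} (a : Fin n → k) (c : k) :
    shear a (C c) = C c := by
  exact (shear a).commutes c

theorem order_le_order_subst {σ τ k : Type*} [Finite σ] [CommRing k] {a : σ → MvPowerSeries τ k}
    (ha : ∀ i, constantCoeff (a i) = 0) (f : MvPowerSeries σ k) :
    f.order ≤ (f.subst a).order := by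
  refine le_trans ?_ (le_order_subst (hasSubst_of_constantCoeff_zero ha) f)
  calc f.order = 1 * f.order := (one_mul _).symm
    _ ≤ _ := by
      gcongr
      exact le_iInf fun i ↦ (one_le_order_iff_constCoeff_eq_zero).2 (ha i)

theorem _root_.MvPolynomial.IsHomogeneous.eval₂_mul {σ R S : Type*} [Fintype σ] [CommRing R]
    [CommRing S] {p : MvPolynomial σ R} {d : ℕ} (hp : p.IsHomogeneous d) (g : R →+* S) (b : σ → R)
    (t : S) : p.eval₂ g (fun i ↦ g (b i) * t) = g (MvPolynomial.eval b p) * t ^ d := by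
  rw [MvPolynomial.eval₂_eq', MvPolynomial.eval_eq', map_sum, Finset.sum_mul]
  refine Finset.sum_congr rfl fun m hm ↦ ?_
  have : ∑ i, m i = d := by
    rw [← Finsupp.degree_eq_sum]
    rw [Finsupp.degree_eq_weight_one]
    exact hp (MvPolynomial.mem_support_iff.1 hm)
  simp only [mul_pow, Finset.prod_mul_distrib, Finset.prod_pow_eq_pow_sum, this, map_mul, map_prod,
    map_pow, mul_assoc]

theorem _root_.MvPolynomial.IsHomogeneous.exists_eval_cons_one_ne_zero {k : Type*} [Field k]
    [Infinite k] {n : ℕ} {p : MvPolynomial (Fin (n + 1)) k} {d : ℕ} (hp : p.IsHomogeneous d)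
    (h0 : p ≠ 0) : ∃ a : Fin n → k, MvPolynomial.eval (Fin.cons 1 a : Fin (n + 1) → k) p ≠ 0 := by
  by_contra! hcon
  have hX : p * MvPolynomial.X 0 ≠ 0 := mul_ne_zero h0 (MvPolynomial.X_ne_zero _)
  apply hX
  apply MvPolynomial.funext
  intro b
  rw [map_mul, MvPolynomial.eval_X, map_zero]
  by_cases hb : b 0 = 0
  · rw [hb, mul_zero]
  have h1 := hp.eval₂_mul (RingHom.id k)
    (Fin.cons 1 fun i ↦ b i.succ / b 0 : Fin (n + 1) → k) (b 0)
  rw [hcon] at h1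
  have h2 : (fun i ↦ (RingHom.id k) ((Fin.cons 1 fun i ↦ b i.succ / b 0 : Fin (n + 1) → k) i) *
      b 0) = b := by
    funext i
    refine Fin.cases ?_ (fun i ↦ ?_) i
    · simp
    · simp [div_mul_cancel₀ _ hb]
  rw [h2, map_zero, zero_mul] at h1
  have h3 : MvPolynomial.eval b p = 0 := h1
  rw [h3, zero_mul]

/-- After a general linear change of coordinates a nonzero power series is regular in the first
variable. -/
theorem exists_shear_map_residue_ne_zero {k : Type*} [Field k] [Infinite k] {n : ℕ}
    {f : MvPowerSeries (Fin (n + 1)) k} (hf : f ≠ 0) :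
    ∃ a : Fin n → k,
      (finSuccEquiv k n (shear a f)).map (residue (MvPowerSeries (Fin n) k)) ≠ 0 := by
  classical
  set d := f.order.toNat with hd
  have hfo : (d : ℕ∞) = f.order := ne_zero_iff_order_finite.1 hf
  obtain ⟨m₀, hm₀, hm₀d⟩ := exists_coeff_ne_zero_and_order hfo
  have hm₀d' : m₀.degree = d := by rw [← hfo] at hm₀d; exact_mod_cast hm₀d
  set p := truncTotal (d + 1) f with hp
  have hph : p.IsHomogeneous d := by
    intro m hm
    have hw : Finsupp.weight (1 : Fin (n + 1) → ℕ) m = m.degree := by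
      rw [Finsupp.degree_eq_weight_one]; rfl
    rw [hw]
    by_contra hmd
    apply hm
    rcases lt_or_gt_of_ne hmd with h | h
    · rw [hp, coeff_truncTotal f (by exact Nat.lt_succ_of_lt h)]
      exact coeff_of_lt_order (by rw [← hfo]; exact_mod_cast h)
    · exact coeff_truncTotal_eq_zero _ h
  have hp0 : p ≠ 0 := by
    intro h
    apply hm₀
    rw [← coeff_truncTotal f (n := d + 1) (by omega), ← hp, h, MvPolynomial.coeff_zero]
  obtain ⟨a, ha⟩ := hph.exists_eval_cons_one_ne_zero hp0
  refine ⟨a, fun hcon ↦ ha ?_⟩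
  have hco : ∀ g : MvPowerSeries (Fin (n + 1)) k,
      (PowerSeries.coeff d ((finSuccEquiv k n (shear a g)).map (constantCoeff (σ := Fin n)))) =
        coeff (Finsupp.cons d 0) (shear a g) := by
    intro g
    rw [PowerSeries.coeff_map, ← coeff_zero_eq_constantCoeff_apply, coeff_coeff_finSuccEquiv]
  have h1 : coeff (Finsupp.cons d 0) (shear a f) = 0 := by
    rw [← hco, PowerSeries.coeff_map]
    have := congrArg (PowerSeries.coeff d) hcon
    rw [PowerSeries.coeff_map, map_zero, residue_eq_zero_iff] at this
    by_contra hne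
    rw [mem_maximalIdeal, mem_nonunits_iff, isUnit_iff_constantCoeff] at this
    exact this (isUnit_iff_ne_zero.2 hne)
  have hdeg : Finsupp.degree (Finsupp.cons d 0 : Fin (n + 1) →₀ ℕ) = d := by
    rw [Finsupp.degree_eq_sum, Fin.sum_univ_succ]
    simp
  have h2 : coeff (Finsupp.cons d 0) (shear a (f - p)) = 0 := by
    apply coeff_of_lt_order
    rw [hdeg]
    rw [shear, substAlgHom_apply]
    refine lt_of_lt_of_le ?_ (order_le_order_subst (constantCoeff_shearVec a) (f - p))
    refine lt_of_lt_of_le (b := ((d + 1 : ℕ) : ℕ∞)) (by exact_mod_cast Nat.lt_succ_self d) ?_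
    apply nat_le_order
    intro m hm
    rw [map_sub, MvPolynomial.coeff_coe, hp, coeff_truncTotal f hm, sub_self]
  have h3 : coeff (Finsupp.cons d 0) (shear a (p : MvPowerSeries (Fin (n + 1)) k)) = 0 := by
    rw [map_sub, map_sub, h1, zero_sub, neg_eq_zero] at h2
    exact h2
  rw [← hco] at h3
  let ρ : MvPolynomial (Fin (n + 1)) k →+* PowerSeries k :=
    (PowerSeries.map (constantCoeff (σ := Fin n) (R := k))).comp
      (((finSuccEquiv k n).toRingEquiv.toRingHom.comp (shear a).toRingHom).comp
        MvPolynomial.coeToMvPowerSeries.ringHom)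
  have hρ : ρ = MvPolynomial.eval₂Hom PowerSeries.C
      fun i ↦ PowerSeries.C ((Fin.cons 1 a : Fin (n + 1) → k) i) * PowerSeries.X := by
    refine MvPolynomial.ringHom_ext (fun r ↦ ?_) (fun i ↦ ?_)
    · simp [ρ, shear_C, finSuccEquiv_C]
    · refine Fin.cases ?_ (fun i ↦ ?_) i
      · simp [ρ, shear_X_zero, finSuccEquiv_X_zero]
      · simp [ρ, shear_X_succ, finSuccEquiv_X_zero, finSuccEquiv_X_succ, finSuccEquiv_C]
  have h4 : (finSuccEquiv k n (shear a (p : MvPowerSeries (Fin (n + 1)) k))).map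
      (constantCoeff (σ := Fin n)) = ρ p := by simp [ρ]
  rw [h4, hρ, MvPolynomial.coe_eval₂Hom, hph.eval₂_mul PowerSeries.C, PowerSeries.coeff_C_mul,
    PowerSeries.coeff_X_pow_self, mul_one] at h3
  exact h3

end MvPowerSeries

theorem exists_algebraicIndependent_between {k D : Type*} [Field k] [CommRing D] [IsDomain D]
    [Algebra k D] {s V : Set D} (hsV : s ⊆ V) (hs : AlgebraicIndepOn k id s) :
    ∃ T : Set D, s ⊆ T ∧ T ⊆ V ∧
      Function.Injective (MvPolynomial.aeval (R := k) (fun t : T ↦ (t : D))) ∧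
      ∀ v ∈ V, ∃ p : Polynomial (MvPolynomial T k), p ≠ 0 ∧
        p.eval₂ (MvPolynomial.aeval (R := k) (fun t : T ↦ (t : D))).toRingHom v = 0 := by
  obtain ⟨T, hsT, hT⟩ := exists_maximal_algebraicIndependent s V hsV hs
  have hTi : AlgebraicIndependent k (fun t : T ↦ (t : D)) := hT.prop.1
  refine ⟨T, hsT, hT.prop.2, algebraicIndependent_iff_injective_aeval.1 hTi, fun v hv ↦ ?_⟩
  by_cases hvT : v ∈ T
  · refine ⟨Polynomial.X - Polynomial.C (MvPolynomial.X ⟨v, hvT⟩), Polynomial.X_sub_C_ne_zero _, ?_⟩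
    simp
  · have h1 : ¬ AlgebraicIndepOn k id (insert v T) := fun h ↦ hvT <|
      hT.le_of_ge ⟨h, Set.insert_subset hv hT.prop.2⟩ (Set.subset_insert v T) (Set.mem_insert v T)
    rw [AlgebraicIndepOn.insert_iff hvT] at h1
    have h2 : ¬ Transcendental (Algebra.adjoin k (id '' T)) (id v) := fun h ↦ h1 ⟨hT.prop.1, h⟩
    rw [Transcendental, not_not] at h2
    have hr : id '' T = Set.range (fun t : T ↦ (t : D)) := by simp
    rw [hr] at h2
    obtain ⟨p, hp0, hp⟩ := h2
    let φ := hTi.repr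
    have hφ : Function.Injective φ := AlgEquiv.injective _
    refine ⟨p.map (φ : _ →+* _), (Polynomial.map_ne_zero_iff hφ).2 hp0, ?_⟩
    rw [Polynomial.eval₂_map]
    have : ((MvPolynomial.aeval (R := k) (fun t : T ↦ (t : D))).toRingHom.comp (φ : _ →+* _)) =
        algebraMap (Algebra.adjoin k (Set.range (fun t : T ↦ (t : D)))) D :=
      RingHom.ext fun x ↦ hTi.aeval_repr x
    rw [this]
    exact hp

theorem MvPowerSeries.algebraicIndependent_X {σ k : Type*} [CommRing k] :
    AlgebraicIndependent k (X : σ → MvPowerSeries σ k) := by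
  rw [algebraicIndependent_iff_injective_aeval]
  have : (MvPolynomial.aeval (R := k) (X : σ → MvPowerSeries σ k)).toRingHom =
      MvPolynomial.coeToMvPowerSeries.ringHom := by
    refine MvPolynomial.ringHom_ext (fun r ↦ ?_) (fun i ↦ ?_) <;> simp
    rfl
  intro p q h
  have h' := (congr($this p)).symm.trans (Eq.trans h (congr($this q)))
  exact MvPolynomial.coe_injective σ k (by simpa using h')

namespace MvPowerSeries

theorem mem_span_range_X_pow {σ A : Type*} [Finite σ] [CommRing A] {N : ℕ} {f : MvPowerSeries σ A}
    (hf : ∀ m : σ →₀ ℕ, m.degree < N → coeff m f = 0) :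
    f ∈ (Ideal.span (Set.range X) : Ideal (MvPowerSeries σ A)) ^ N := by
  have h1 : toAdicCompletionAlgEquiv σ A f ∈
      ((AdicCompletion.eval (MvPolynomial.idealOfVars σ A) (MvPolynomial σ A) N).ker) := by
    rw [LinearMap.mem_ker, AdicCompletion.eval_apply, toAdicCompletionAlgEquiv_apply,
      toAdicCompletion_apply_eq_mk_truncTotal]
    have h0 : truncTotal N f = 0 := by
      ext m
      rw [coeff_truncTotal_eq_ite]
      split_ifs with h
      · simpa using hf m h
      · simp
    rw [h0]
    exact map_zero _
  rw [← AdicCompletion.pow_smul_top_eq_ker_eval (MvPolynomial.idealOfVars_fg σ A)] at h1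
  have hle : ∀ v ∈ (MvPolynomial.idealOfVars σ A ^ N • ⊤ : Submodule (MvPolynomial σ A)
      (AdicCompletion (MvPolynomial.idealOfVars σ A) (MvPolynomial σ A))),
      (toAdicCompletionAlgEquiv σ A).symm v ∈
        (Ideal.span (Set.range X) : Ideal (MvPowerSeries σ A)) ^ N := by
    intro v hv
    refine Submodule.smul_induction_on hv (fun i hi w _ ↦ ?_) (fun a b ha hb ↦ ?_)
    · rw [map_smul, Algebra.smul_def]
      refine Ideal.mul_mem_right _ _ ?_
      have := Ideal.mem_map_of_mem (algebraMap (MvPolynomial σ A) (MvPowerSeries σ A)) hi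
      rw [Ideal.map_pow, MvPolynomial.idealOfVars, Ideal.map_span, ← Set.range_comp] at this
      have hX : (algebraMap (MvPolynomial σ A) (MvPowerSeries σ A)) ∘ MvPolynomial.X = X := by
        funext i
        simp [MvPowerSeries.algebraMap_apply']
      rwa [hX] at this
    · rw [map_add]; exact add_mem ha hb
  have h2 := hle _ h1
  rwa [AlgEquiv.symm_apply_apply] at h2

theorem maximalIdeal_eq_span_range_X {σ k : Type*} [Finite σ] [Field k] :
    maximalIdeal (MvPowerSeries σ k) = Ideal.span (Set.range X) := by
  refine le_antisymm (fun f hf ↦ ?_) ?_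
  · rw [← pow_one (Ideal.span (Set.range X))]
    refine mem_span_range_X_pow fun m hm ↦ ?_
    obtain rfl : m = 0 := (Finsupp.degree_eq_zero_iff m).1 (by omega)
    by_contra h
    exact hf (MvPowerSeries.isUnit_iff_constantCoeff.2 (by simpa using h))
  · rw [Ideal.span_le]
    rintro _ ⟨i, rfl⟩
    intro h
    simpa using MvPowerSeries.isUnit_iff_constantCoeff.1 h

instance isDomain {σ k : Type*} [Field k] : IsDomain (MvPowerSeries σ k) :=
  NoZeroDivisors.to_isDomain _

instance isAdicComplete_maximalIdeal {σ k : Type*} [Finite σ] [Field k] :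
    IsAdicComplete (maximalIdeal (MvPowerSeries σ k)) (MvPowerSeries σ k) := by
  rw [maximalIdeal_eq_span_range_X]; infer_instance

end MvPowerSeries

/-- Finitely many power series over `k` can be mapped to `B` by a ring homomorphism extending `ι`
    and
sending the variables to `x`. -/
def Approximates {k B : Type*} [Field k] [CommRing B] {n : ℕ} (ι : k →+* B) (x : Fin n → B) : Prop
    :=
  ∀ S : Finset (MvPowerSeries (Fin n) k), ∃ (A : Subring (MvPowerSeries (Fin n) k)) (φ : A →+* B),
    (∀ f ∈ S, f ∈ A) ∧ (∀ a, ∃ h : MvPowerSeries.C a ∈ A, φ ⟨_, h⟩ = ι a) ∧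
      ∀ i, ∃ h : MvPowerSeries.X i ∈ A, φ ⟨_, h⟩ = x i

theorem Approximates.zero {k B : Type*} [Field k] [CommRing B] (ι : k →+* B) (x : Fin 0 → B) :
    Approximates ι x := by
  refine fun S ↦ ⟨⊤, (ι.comp (MvPowerSeries.constantCoeff (σ := Fin 0))).comp
    (Subring.topEquiv.toRingHom), fun _ _ ↦ trivial, fun a ↦ ⟨trivial, ?_⟩, fun i ↦ i.elim0⟩
  change ι (MvPowerSeries.constantCoeff (MvPowerSeries.C a)) = ι a
  simp

theorem Polynomial.exists_subring_lift {A : Type*} [CommRing A] (A₀ : Subring A)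
    (P : Finset (Polynomial A)) (hP : ∀ p ∈ P, ∀ i, p.coeff i ∈ A₀) :
    ∃ L : Polynomial A → Polynomial A₀, ∀ p ∈ P, (L p).map A₀.subtype = p := by
  have (p) (hp : p ∈ P) : ∃ q : Polynomial A₀, q.map A₀.subtype = p := by
    refine (Polynomial.mem_lifts (f := A₀.subtype) p).1 ((Polynomial.lifts_iff_coeff_lifts p).2 ?_)
    intro i
    exact ⟨⟨_, hP p hp i⟩, rfl⟩
  choose! L hL using this
  exact ⟨L, hL⟩

/-- The image in `B'` of a polynomial approximate solution. -/
theorem Approximates.exists_ringHom_polynomial {k B : Type*} [Field k] [CommRing B] {n : ℕ}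
    {ι : k →+* B} {x : Fin n → B} (hA : Approximates ι x)
    (P : Finset (Polynomial (MvPowerSeries (Fin n) k))) {r : MvPowerSeries (Fin n) k}
    (hr : IsUnit r) :
    ∃ (A : Subring (MvPowerSeries (Fin n) k)) (φ : A →+* B)
      (L : Polynomial (MvPowerSeries (Fin n) k) → Polynomial A),
      (∃ r₀ : A, IsUnit r₀ ∧ (r₀ : MvPowerSeries (Fin n) k) = r) ∧
      (∀ a, ∃ h : MvPowerSeries.C a ∈ A, φ ⟨_, h⟩ = ι a) ∧
      (∀ i, ∃ h : MvPowerSeries.X i ∈ A, φ ⟨_, h⟩ = x i) ∧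
      ∀ p ∈ P, (L p).map A.subtype = p := by
  classical
  obtain ⟨r', hr'⟩ := hr.exists_right_inv
  obtain ⟨A, φ, hS, hC, hX⟩ := hA (P.biUnion (fun p ↦ p.coeffs) ∪ {0, r, r'})
  obtain ⟨L, hL⟩ := Polynomial.exists_subring_lift A P fun p hp i ↦ by
    by_cases h0 : p.coeff i = 0
    · rw [h0]; exact A.zero_mem
    · exact hS _ (Finset.mem_union_left _ (Finset.mem_biUnion.2
          ⟨p, hp, Polynomial.coeff_mem_coeffs h0⟩))
  have h1 : r ∈ A := hS _ (by simp)
  have h2 : r' ∈ A := hS _ (by simp)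
  exact ⟨A, φ, L, ⟨⟨r, h1⟩, IsUnit.of_mul_eq_one ⟨r', h2⟩ (Subtype.ext hr'), rfl⟩, hC, hX, hL⟩

theorem Approximates.succ {k B : Type*} [Field k] [CharZero k] [CommRing B] {n : ℕ}
    {ι : k →+* B} {x : Fin n → B} (hA : Approximates ι x) {B' : Type*} [CommRing B'] [IsDomain B']
    {𝔫 : Ideal B'} (h𝔫 : IsNewtonIdeal 𝔫) (θ : Polynomial B →+* B')
    (hθ : ∀ p : Polynomial B, p.Monic → θ p ≠ 0) (hθX : θ Polynomial.X ∈ 𝔫)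
    (hσ : ∀ a : Fin n → k, ∃ σ : B' →+* B', σ (θ Polynomial.X) = θ Polynomial.X ∧
      (∀ i, σ (θ (Polynomial.C (x i) + Polynomial.C (ι (a i)) * Polynomial.X)) =
        θ (Polynomial.C (x i))) ∧
      ∀ c, σ (θ (Polynomial.C (ι c))) = θ (Polynomial.C (ι c))) :
    Approximates (n := n + 1) ((θ.comp Polynomial.C).comp ι)
      (Fin.cons (θ Polynomial.X) fun i ↦ θ (Polynomial.C (x i))) := by
  classical
  intro S
  let V : Finset (MvPowerSeries (Fin (n + 1)) k) := S ∪ Finset.univ.image MvPowerSeries.X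
  have hXV (i : Fin (n + 1)) : MvPowerSeries.X i ∈ V :=
    Finset.mem_union_right _ (Finset.mem_image_of_mem _ (Finset.mem_univ i))
  obtain ⟨T, hXT, hTV, hinj, halg⟩ := exists_algebraicIndependent_between (k := k)
    (s := Set.range MvPowerSeries.X) (V := (V : Set (MvPowerSeries (Fin (n + 1)) k)))
    (by rintro _ ⟨i, rfl⟩; exact hXV i) MvPowerSeries.algebraicIndependent_X.coe_range
  have hTfin : Finite T := Finite.Set.subset _ hTV
  have := Fintype.ofFinite T
  let d : MvPolynomial T k →+* MvPowerSeries (Fin (n + 1)) k :=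
    (MvPolynomial.aeval (R := k) (fun t : T ↦ (t : MvPowerSeries (Fin (n + 1)) k))).toRingHom
  have hdX (t : T) : d (MvPolynomial.X t) = t := MvPolynomial.aeval_X _ _
  have hdC (c : k) : d (MvPolynomial.C c) = MvPowerSeries.C c := MvPolynomial.aeval_C _ _
  let _ : Algebra (MvPolynomial T k) (MvPowerSeries (Fin (n + 1)) k) := d.toAlgebra
  obtain ⟨α, f, h, G, hfα, hf'α, hh, hG, hmin⟩ := exists_primitive_presentation
    (Q := MvPolynomial T k) (D := MvPowerSeries (Fin (n + 1)) k) hinj V halg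
  replace hfα : f.eval₂ d α = 0 := hfα
  replace hf'α : f.derivative.eval₂ d α ≠ 0 := hf'α
  replace hG : ∀ v ∈ V, d h * v = (G v).eval₂ d α := hG
  replace hmin : ∀ g : Polynomial (MvPolynomial T k), g.eval₂ d α = 0 → ∃ (N : ℕ)
    (q : Polynomial (MvPolynomial T k)), Polynomial.C (h ^ N) * g = f * q := hmin
  have hdh : d h ≠ 0 := fun h0 ↦ hh (hinj (h0.trans (map_zero d).symm))
  obtain ⟨a₀, ha₀⟩ := MvPowerSeries.exists_shear_map_residue_ne_zero
    (f := MvPowerSeries.X 0 * d h * f.derivative.eval₂ d α ^ 2)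
    (mul_ne_zero (mul_ne_zero (by
      intro h0
      have := congrArg (MvPowerSeries.coeff (Finsupp.single 0 1)) h0
      simp at this) hdh) (pow_ne_zero 2 hf'α))
  let τ : MvPowerSeries (Fin (n + 1)) k →+* PowerSeries (MvPowerSeries (Fin n) k) :=
    (MvPowerSeries.finSuccEquiv k n).toRingEquiv.toRingHom.comp (MvPowerSeries.shear a₀).toRingHom
  have hτC (c : k) : τ (MvPowerSeries.C c) = PowerSeries.C (MvPowerSeries.C c) := by
    simp [τ, MvPowerSeries.shear_C, MvPowerSeries.finSuccEquiv_C]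
  have hτ0 : τ (MvPowerSeries.X 0) = PowerSeries.X := by
    simp [τ, MvPowerSeries.shear_X_zero, MvPowerSeries.finSuccEquiv_X_zero]
  have hτs (i : Fin n) : τ (MvPowerSeries.X i.succ) = PowerSeries.C (MvPowerSeries.X i) +
      PowerSeries.C (MvPowerSeries.C (a₀ i)) * PowerSeries.X := by
    simp [τ, MvPowerSeries.shear_X_succ, MvPowerSeries.finSuccEquiv_X_zero,
      MvPowerSeries.finSuccEquiv_X_succ, MvPowerSeries.finSuccEquiv_C]
  obtain ⟨W, w, q, a, s', y, v, hWm, hqu, hs', hid⟩ := exists_polynomial_approximation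
    (k := k) (MvPowerSeries.C (σ := Fin n)) (fun t : T ↦ τ t) (V := V) (val := fun b ↦ τ b)
    (f := f) (h := h) (G := G) (α := τ α) (d := τ.comp d)
    (MvPolynomial.ringHom_ext (by simp [hdC, hτC]) (by simp [hdX]))
    (by rw [← Polynomial.hom_eval₂, hfα, map_zero])
    (fun b hb ↦ by rw [← Polynomial.hom_eval₂, ← hG b hb, map_mul τ]; rfl)
    (by
      rw [← Polynomial.hom_eval₂, ← hτ0, show (τ.comp d) h = τ (d h) from rfl, ← map_pow τ,
        ← map_mul τ, ← map_mul τ]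
      exact ha₀)
  obtain ⟨hid1, hid2, hid3⟩ := hid _ rfl
  obtain ⟨A, φ, L, ⟨r₀, hr₀u, hr₀⟩, hC, hX, hL⟩ := hA.exists_ringHom_polynomial
    (({W, w, q, a} ∪ Finset.univ.image s') ∪ (V.image y ∪ V.image v)) hqu
  choose hC hφC using hC
  choose hX hφX using hX
  let ψ : Polynomial A →+* Polynomial (MvPowerSeries (Fin n) k) := Polynomial.mapRingHom A.subtype
  have hψ : Function.Injective ψ := Polynomial.map_injective _ Subtype.val_injective
  have hLW : ψ (L W) = W := hL _ (by simp)
  have hLw : ψ (L w) = w := hL _ (by simp)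
  have hLq : ψ (L q) = q := hL _ (by simp)
  have hLa : ψ (L a) = a := hL _ (by simp)
  have hLs (t) : ψ (L (s' t)) = s' t := hL _ (by simp)
  have hLy (b) (hb : b ∈ V) : ψ (L (y b)) = y b := hL _ (by
    exact Finset.mem_union_right _ (Finset.mem_union_left _ (Finset.mem_image_of_mem _ hb)))
  have hLv (b) (hb : b ∈ V) : ψ (L (v b)) = v b := hL _ (by
    exact Finset.mem_union_right _ (Finset.mem_union_right _ (Finset.mem_image_of_mem _ hb)))
  let e₀ : MvPolynomial T k →+* Polynomial A := MvPolynomial.eval₂Hom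
    ((Polynomial.C (R := A)).comp ((MvPowerSeries.C (σ := Fin n) (R := k)).codRestrict A hC))
    fun t ↦ L (s' t)
  have he₀ : ψ.comp e₀ = MvPolynomial.eval₂Hom
      ((Polynomial.C (R := MvPowerSeries (Fin n) k)).comp MvPowerSeries.C) s' :=
    MvPolynomial.ringHom_ext (by intro r; simp [e₀, ψ]) (by intro t; simp [e₀, hLs])
  have heval (g : Polynomial (MvPolynomial T k)) : ψ (g.eval₂ e₀ (L a)) = g.eval₂
      (MvPolynomial.eval₂Hom ((Polynomial.C (R := MvPowerSeries (Fin n) k)).comp MvPowerSeries.C)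
          s')
      a := by
    rw [Polynomial.hom_eval₂, he₀, hLa]
  have hhe : ψ (e₀ h) = MvPolynomial.eval₂Hom
      ((Polynomial.C (R := MvPowerSeries (Fin n) k)).comp MvPowerSeries.C) s' h := congr($he₀ h)
  let Φ : Polynomial A →+* B' := θ.comp (Polynomial.mapRingHom φ)
  have hX𝔫 : Φ Polynomial.X = θ Polynomial.X := by simp [Φ]
  have hWne : Φ (L W) ≠ 0 := by
    refine hθ _ (Polynomial.Monic.map φ ?_)
    exact Polynomial.monic_of_injective Subtype.val_injective (by rw [hL _ (by simp)]; exact hWm)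
  have hqu' : IsUnit (Φ (L q)) := by
    have h0 : (L q).coeff 0 = r₀ := by
      apply Subtype.ext
      have := congr(Polynomial.coeff $hLq 0)
      rw [hr₀, ← this]
      simp [ψ]
    have h1 : L q = Polynomial.C r₀ + Polynomial.X * (L q).divX := by
      rw [← h0, add_comm, Polynomial.X_mul_divX_add]
    obtain ⟨u, hu⟩ := (hr₀u.map Polynomial.C).map Φ
    have h2 : Φ (L q) = u * (1 + ↑u⁻¹ * (θ Polynomial.X * Φ (L q).divX)) := by
      rw [mul_add, mul_one, Units.mul_inv_cancel_left, hu, ← hX𝔫, ← map_mul, ← map_add, ← h1]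
    rw [h2]
    exact u.isUnit.mul (h𝔫.isUnit_one_add _ (Ideal.mul_mem_left _ _ (Ideal.mul_mem_right _ _ hθX)))
  have hX' (i : Fin (n + 1)) : MvPowerSeries.X i ∈ T := hXT ⟨i, rfl⟩
  obtain ⟨hne, a', y', hfa', hy'⟩ := h𝔫.exists_point (Φ.comp e₀) (x := θ Polynomial.X) (f := f)
    (h := h) (G := G) (V := V) (W := Φ (L W)) (w := Φ (L w)) (q := Φ (L q)) (a := Φ (L a))
    (y := fun b ↦ Φ (L (y b))) (v := fun b ↦ Φ (L (v b))) hθX hWne hqu'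
    (by
      rw [← Polynomial.hom_eval₂, ← map_pow, ← map_mul]
      refine congrArg Φ (hψ ?_)
      rw [heval, hid1, map_mul, map_pow, hLW, hLw])
    (by
      rw [← Polynomial.hom_eval₂, ← hX𝔫, show (Φ.comp e₀) h = Φ (e₀ h) from rfl, ← map_pow Φ, ←
          map_mul Φ,
        ← map_mul Φ, ← map_mul Φ]
      refine congrArg Φ (hψ ?_)
      rw [map_mul, map_mul, map_pow, heval, hhe, map_mul, hLW, hLq, ← hid2]
      simp [ψ])
    (fun b hb ↦ by
      rw [← Polynomial.hom_eval₂, show (Φ.comp e₀) h = Φ (e₀ h) from rfl, ← map_mul Φ, ← map_mul Φ,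
          ← map_add Φ]
      refine congrArg Φ (hψ ?_)
      rw [map_add, map_mul, map_mul, heval, hhe, hLy b hb, hLv b hb, hLW, hid3 b hb])
  obtain ⟨A', φ', hV', hQ'⟩ := exists_ringHom_of_presentation d (Φ.comp e₀) V hne hG hmin hfa' hy'
  obtain ⟨σ, hσ1, hσ2, hσ3⟩ := hσ a₀
  refine ⟨A', σ.comp φ', fun b hb ↦ (hV' b (Finset.mem_union_left _ hb)).1, fun c ↦ ?_, fun i ↦ ?_⟩
  · obtain ⟨hq, h⟩ := hQ' (MvPolynomial.C c)
    rw [hdC] at hq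
    refine ⟨hq, ?_⟩
    have h' : φ' ⟨MvPowerSeries.C c, hq⟩ = θ (Polynomial.C (ι c)) := by
      refine Eq.trans (by congr 2; exact (hdC c).symm) (h.trans ?_)
      simp only [e₀, Φ, RingHom.comp_apply, MvPolynomial.coe_eval₂Hom, MvPolynomial.eval₂_C,
        Polynomial.coe_mapRingHom, Polynomial.map_C]
      exact congrArg (fun t ↦ θ (Polynomial.C t)) (hφC c)
    rw [RingHom.comp_apply, h', hσ3]
    rfl
  · obtain ⟨hq, h⟩ := hQ' (MvPolynomial.X ⟨_, hX' i⟩)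
    rw [hdX] at hq
    refine ⟨hq, ?_⟩
    have h' : φ' ⟨MvPowerSeries.X i, hq⟩ = Φ (L (s' ⟨_, hX' i⟩)) := by
      refine Eq.trans (by congr 2; exact (hdX ⟨_, hX' i⟩).symm) (h.trans ?_)
      simp [e₀]
    rw [RingHom.comp_apply, h']
    clear h' hq h
    refine Fin.cases ?_ (fun i ↦ ?_) i
    · have h1 : s' ⟨_, hX' 0⟩ = Polynomial.X := hs' _ _ (hτ0.trans Polynomial.coe_X.symm)
      have h2 : L (s' ⟨_, hX' 0⟩) = Polynomial.X := hψ (by rw [hLs, h1]; simp [ψ])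
      rw [h2, hX𝔫, hσ1]; rfl
    · have h1 : s' ⟨_, hX' i.succ⟩ = Polynomial.C (MvPowerSeries.X i) +
          Polynomial.C (MvPowerSeries.C (a₀ i)) * Polynomial.X :=
        hs' _ _ ((hτs i).trans (by simp))
      have h2 : L (s' ⟨_, hX' i.succ⟩) = Polynomial.C ⟨_, hX i⟩ +
          Polynomial.C ⟨_, hC (a₀ i)⟩ * Polynomial.X := hψ (by rw [hLs, h1]; simp [ψ])
      have h3 : Φ (L (s' ⟨_, hX' i.succ⟩)) =
          θ (Polynomial.C (x i) + Polynomial.C (ι (a₀ i)) * Polynomial.X) := by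
        rw [h2, ← hφX, ← hφC]; simp [Φ]
      rw [h3, hσ2]; rfl

instance isJacobsonRing_int : IsJacobsonRing ℤ := by
  rw [isJacobsonRing_iff_prime_eq]
  intro P hP
  by_cases h0 : P = ⊥
  · subst h0
    refine le_antisymm (fun x hx ↦ ?_) Ideal.le_jacobson
    rw [Ideal.mem_jacobson_bot] at hx
    have := hx (3 * x)
    rw [Int.isUnit_iff] at this
    rw [Ideal.mem_bot]
    by_contra h
    have h1 : 0 < x ^ 2 := by positivity
    rcases this with h | h <;> nlinarith
  · have := hP.isMaximal h0
    exact Ideal.jacobson_eq_self_of_isMaximal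

theorem exists_prime_charP_of_finiteType_int (κ : Type*) [Field κ] [Algebra ℤ κ]
    [Algebra.FiniteType ℤ κ] :
    ∃ p : ℕ, p.Prime ∧ CharP κ p := by
  obtain ⟨p, hp⟩ := CharP.exists κ
  rcases CharP.char_is_prime_or_zero κ p with h | rfl
  · exact ⟨p, h, hp⟩
  · have := CharP.charP_to_charZero κ
    have := finite_of_finite_type_of_isJacobsonRing ℤ κ
    exact (Int.not_isField (isField_of_isIntegral_of_isField (S := κ)
      (RingHom.injective_int _) (Field.toIsField κ))).elim

theorem exists_finite_charP_reductions.{v} (k : Type v) [Field k] :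
    ∃ (κ : Finset k → Type v) (_ : ∀ j, Field (κ j)) (res : ∀ j, k → κ j),
      (∀ j, ∃ p : ℕ, p.Prime ∧ CharP (κ j) p) ∧ (∀ j, res j 1 = 1) ∧
      (∀ j a b, a ∈ j → b ∈ j → res j (a + b) = res j a + res j b) ∧
      ∀ j a b, a ∈ j → b ∈ j → res j (a * b) = res j a * res j b := by
  classical
  let Ω (j : Finset k) : Subalgebra ℤ k := Algebra.adjoin ℤ (j : Set k)
  have hM (j : Finset k) : ∃ M : Ideal (Ω j), M.IsMaximal := Ideal.exists_maximal _
  choose M hM using hM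
  refine ⟨fun j ↦ Ω j ⧸ M j, fun j ↦ Ideal.Quotient.field (M j),
    fun j a ↦ if h : a ∈ Ω j then Ideal.Quotient.mk (M j) ⟨a, h⟩ else 0, fun j ↦ ?_, fun j ↦ ?_,
    fun j a b ha hb ↦ ?_, fun j a b ha hb ↦ ?_⟩
  · let _ := Ideal.Quotient.field (M j)
    have h1 : Algebra.FiniteType ℤ (Ω j) := (Subalgebra.fg_iff_finiteType _).1 ⟨j, rfl⟩
    have h2 : Algebra.FiniteType ℤ (Ω j ⧸ M j) :=
      Algebra.FiniteType.of_surjective (Ideal.Quotient.mkₐ ℤ (M j)) Ideal.Quotient.mk_surjective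
    exact exists_prime_charP_of_finiteType_int (Ω j ⧸ M j)
  · beta_reduce
    rw [dif_pos (one_mem (Ω j))]; exact map_one (Ideal.Quotient.mk (M j))
  · have ha' : a ∈ Ω j := Algebra.subset_adjoin ha
    have hb' : b ∈ Ω j := Algebra.subset_adjoin hb
    beta_reduce
    rw [dif_pos ha', dif_pos hb', dif_pos (add_mem ha' hb')]
    exact map_add (Ideal.Quotient.mk (M j)) ⟨a, ha'⟩ ⟨b, hb'⟩
  · have ha' : a ∈ Ω j := Algebra.subset_adjoin ha
    have hb' : b ∈ Ω j := Algebra.subset_adjoin hb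
    beta_reduce
    rw [dif_pos ha', dif_pos hb', dif_pos (mul_mem ha' hb')]
    exact map_mul (Ideal.Quotient.mk (M j)) ⟨a, ha'⟩ ⟨b, hb'⟩

/-- The families vanishing almost everywhere along a filter. -/
def eventuallyZeroIdeal {J : Type*} (l : Filter J) (D : J → Type*) [∀ j, CommRing (D j)] :
    Ideal (∀ j, D j) where
  carrier := {f | ∀ᶠ j in l, f j = 0}
  zero_mem' := .of_forall fun _ ↦ rfl
  add_mem' {f g} hf hg := by
    filter_upwards [hf, hg] with j h1 h2
    rw [Pi.add_apply, h1, h2, add_zero]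
  smul_mem' c f hf := by
    filter_upwards [hf] with j h1
    rw [Pi.smul_apply', h1, smul_zero]

theorem mem_eventuallyZeroIdeal {J : Type*} {l : Filter J} {D : J → Type*}
    [∀ j, CommRing (D j)] {f : ∀ j, D j} :
    f ∈ eventuallyZeroIdeal l D ↔ ∀ᶠ j in l, f j = 0 := Iff.rfl

/-- The reduced product of a family of rings along a filter. -/
abbrev ReducedProduct {J : Type*} (l : Filter J) (D : J → Type*) [∀ j, CommRing (D j)] :=
  (∀ j, D j) ⧸ eventuallyZeroIdeal l D

namespace ReducedProduct

variable {J : Type*} {l : Filter J} {D : J → Type*} [∀ j, CommRing (D j)]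

/-- The class of a family in the reduced product. -/
abbrev mk (l : Filter J) (D : J → Type*) [∀ j, CommRing (D j)] : (∀ j, D j) →+* ReducedProduct l D
    :=
  Ideal.Quotient.mk (eventuallyZeroIdeal l D)

theorem mk_eq_zero {f : ∀ j, D j} : mk l D f = 0 ↔ ∀ᶠ j in l, f j = 0 :=
  Ideal.Quotient.eq_zero_iff_mem.trans Iff.rfl

theorem mk_eq_mk {f g : ∀ j, D j} : mk l D f = mk l D g ↔ ∀ᶠ j in l, f j = g j := by
  rw [← sub_eq_zero, ← map_sub, mk_eq_zero]
  simp only [Pi.sub_apply, sub_eq_zero]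

instance isDomain {J : Type*} (l : Ultrafilter J) (D : J → Type*) [∀ j, CommRing (D j)]
    [∀ j, IsDomain (D j)] : IsDomain (ReducedProduct (l : Filter J) D) := by
  rw [Ideal.Quotient.isDomain_iff_prime]
  refine ⟨fun h ↦ ?_, fun {f g} hfg ↦ ?_⟩
  · obtain ⟨j, hj⟩ := ((Ideal.eq_top_iff_one _).1 h).exists
    exact one_ne_zero hj
  · have : ∀ᶠ j in (l : Filter J), f j = 0 ∨ g j = 0 := by
      filter_upwards [mem_eventuallyZeroIdeal.1 hfg] with j hj
      exact mul_eq_zero.1 hj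
    exact Ultrafilter.eventually_or.1 this

/-- The map of reduced products induced by a family of ring homomorphisms. -/
noncomputable def map (l : Filter J) {E : J → Type*} [∀ j, CommRing (E j)] (f : ∀ j, D j →+* E j) :
    ReducedProduct l D →+* ReducedProduct l E :=
  Ideal.Quotient.lift _ ((mk l E).comp (RingHom.pi fun j ↦ (f j).comp (Pi.evalRingHom D j)))
    fun x hx ↦ mk_eq_zero.2 <| by
      filter_upwards [mem_eventuallyZeroIdeal.1 hx] with j hj
      exact (congrArg (f j) hj).trans (map_zero (f j))

theorem isNewtonIdeal (𝔫 : ∀ j, Ideal (D j)) (h𝔫 : ∀ j, IsNewtonIdeal (𝔫 j)) :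
    IsNewtonIdeal ((Ideal.pi 𝔫).map (mk l D)) := by
  have hmem (x) (hx : x ∈ (Ideal.pi 𝔫).map (mk l D)) : ∃ f ∈ Ideal.pi 𝔫, mk l D f = x :=
    (Ideal.mem_map_iff_of_surjective _ Ideal.Quotient.mk_surjective).1 hx
  refine ⟨fun x hx ↦ ?_, fun p e he ↦ ?_⟩
  · obtain ⟨f, hf, rfl⟩ := hmem x hx
    rw [← map_one (mk l D), ← map_add]
    exact (Pi.isUnit_iff.2 fun j ↦ (h𝔫 j).isUnit_one_add _ (hf j)).map _
  · obtain ⟨f, hf, rfl⟩ := hmem e he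
    obtain ⟨q, rfl⟩ := Polynomial.map_surjective (mk l D) Ideal.Quotient.mk_surjective p
    choose c hc using fun j ↦ (h𝔫 j).exists_root (q.map (Pi.evalRingHom D j)) (f j) (hf j)
    refine ⟨mk l D c, ?_⟩
    rw [← map_mul, Polynomial.eval_map_apply, ← map_pow, ← map_mul, ← map_add, ← map_add,
        mk_eq_zero]
    refine .of_forall fun j ↦ ?_
    have := hc j
    rw [Polynomial.eval_map, ← Pi.evalRingHom_apply D j f, ← Pi.evalRingHom_apply D j c, ← map_mul,
      Polynomial.eval₂_at_apply] at this
    exact this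

end ReducedProduct

instance MvPowerSeries.henselianLocalRing {σ k : Type*} [Finite σ] [Field k] :
    HenselianLocalRing (MvPowerSeries σ k) where
  is_henselian f hf a₀ h₁ h₂ :=
    HenselianRing.is_henselian (I := maximalIdeal (MvPowerSeries σ k)) f hf a₀ h₁ (h₂.map _)

namespace ReducedProduct

variable {J k : Type*} {l : Ultrafilter J} {κ : J → Type*} [∀ j, Field (κ j)]

/-- The reduced product of rings of power series in `n` variables. -/
abbrev PowerSeriesProduct (l : Ultrafilter J) (κ : J → Type*) [∀ j, Field (κ j)] (n : ℕ) :=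
  ReducedProduct (l : Filter J) fun j ↦ MvPowerSeries (Fin n) (κ j)

/-- The class of a family of power series. -/
noncomputable abbrev mkPowerSeries (l : Ultrafilter J) (κ : J → Type*) [∀ j, Field (κ j)] (n : ℕ) :
    (∀ j, MvPowerSeries (Fin n) (κ j)) →+* PowerSeriesProduct l κ n :=
  mk (l : Filter J) fun j ↦ MvPowerSeries (Fin n) (κ j)

/-- Power series in the first variable as power series in all variables. -/
noncomputable def ofPowerSeries (κ : Type*) [Field κ] (n : ℕ) :
    PowerSeries (MvPowerSeries (Fin n) κ) →+* MvPowerSeries (Fin (n + 1)) κ :=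
  (MvPowerSeries.finSuccEquiv κ n).symm.toRingEquiv.toRingHom

theorem ofPowerSeries_apply (κ : Type*) [Field κ] (n : ℕ)
    (f : PowerSeries (MvPowerSeries (Fin n) κ)) :
    ofPowerSeries κ n f = (MvPowerSeries.finSuccEquiv κ n).symm f := rfl

/-- The adjunction of the first variable, on reduced products of power series rings. -/
noncomputable def ofPolynomial (l : Ultrafilter J) (κ : J → Type*) [∀ j, Field (κ j)] (n : ℕ) :
    Polynomial (PowerSeriesProduct l κ n) →+* PowerSeriesProduct l κ (n + 1) :=
  Polynomial.eval₂RingHom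
    (map (l : Filter J) (D := fun j ↦ MvPowerSeries (Fin n) (κ j))
      (E := fun j ↦ MvPowerSeries (Fin (n + 1)) (κ j)) fun j ↦ (ofPowerSeries (κ j) n).comp
        PowerSeries.C) (mkPowerSeries l κ (n + 1) fun _ ↦ MvPowerSeries.X 0)

theorem ofPolynomial_X (n : ℕ) :
    ofPolynomial l κ n Polynomial.X = mkPowerSeries l κ (n + 1) fun _ ↦ MvPowerSeries.X 0 := by
  simp [ofPolynomial]

theorem ofPolynomial_C (n : ℕ) (f : ∀ j, MvPowerSeries (Fin n) (κ j)) :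
    ofPolynomial l κ n (Polynomial.C (mkPowerSeries l κ n f)) =
      mkPowerSeries l κ (n + 1) fun j ↦ ofPowerSeries (κ j) n (PowerSeries.C (f j)) := by
  simp only [ofPolynomial, Polynomial.coe_eval₂RingHom, Polynomial.eval₂_C]
  rfl

theorem ofPolynomial_map_mk (n : ℕ) (p : Polynomial (∀ j, MvPowerSeries (Fin n) (κ j))) :
    ofPolynomial l κ n (p.map (mkPowerSeries l κ n)) = mkPowerSeries l κ (n + 1) fun j ↦
      ofPowerSeries (κ j) n (p.map (Pi.evalRingHom _ j)) := by
  let Ψ : Polynomial (∀ j, MvPowerSeries (Fin n) (κ j)) →+*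
      PowerSeriesProduct l κ (n + 1) :=
    (mkPowerSeries l κ (n + 1)).comp (RingHom.pi fun j ↦
      ((ofPowerSeries (κ j) n).comp
        Polynomial.coeToPowerSeries.ringHom).comp (Polynomial.mapRingHom (Pi.evalRingHom _ j)))
  have : (ofPolynomial l κ n).comp (Polynomial.mapRingHom (mkPowerSeries l κ n)) = Ψ := by
    refine Polynomial.ringHom_ext (fun f ↦ ?_) ?_
    · rw [RingHom.comp_apply, Polynomial.coe_mapRingHom, Polynomial.map_C, ofPolynomial_C]
      refine congrArg (mkPowerSeries l κ (n + 1)) (funext fun j ↦ ?_)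
      simp
    · rw [RingHom.comp_apply, Polynomial.coe_mapRingHom, Polynomial.map_X, ofPolynomial_X]
      refine congrArg (mkPowerSeries l κ (n + 1)) (funext fun j ↦ ?_)
      simp [ofPowerSeries_apply, AlgEquiv.eq_symm_apply, MvPowerSeries.finSuccEquiv_X_zero]
  exact congr($this p)

theorem ofPolynomial_ne_zero {n : ℕ}
    {p : Polynomial (PowerSeriesProduct l κ n)}
    (hp : p.Monic) : ofPolynomial l κ n p ≠ 0 := by
  obtain ⟨q, rfl, -, hq⟩ := Polynomial.lifts_and_natDegree_eq_and_monic
    ((Polynomial.mem_lifts _).2 (Polynomial.map_surjective (mkPowerSeries l κ n)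
        Ideal.Quotient.mk_surjective p))
    hp
  rw [ofPolynomial_map_mk, Ne, mk_eq_zero]
  intro h
  obtain ⟨j, hj⟩ := h.exists
  have h0 := (MvPowerSeries.finSuccEquiv (κ j) n).symm.injective (hj.trans (map_zero _).symm)
  exact (hq.map _).ne_zero (Polynomial.coe_eq_zero_iff.1 h0)

/-- The shear transformation on a reduced product of power series rings. -/
noncomputable def shear (l : Ultrafilter J) (κ : J → Type*) [∀ j, Field (κ j)] (n : ℕ)
    (a : ∀ j, Fin n → κ j) : PowerSeriesProduct l κ (n + 1) →+* PowerSeriesProduct l κ (n + 1) :=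
  map (l : Filter J) (D := fun j ↦ MvPowerSeries (Fin (n + 1)) (κ j))
    (E := fun j ↦ MvPowerSeries (Fin (n + 1)) (κ j)) fun j ↦
      (MvPowerSeries.shear (a j) : MvPowerSeries (Fin (n + 1)) (κ j) →+* _)

theorem shear_mk (n : ℕ) (a : ∀ j, Fin n → κ j) (f : ∀ j, MvPowerSeries (Fin (n + 1)) (κ j)) :
    shear l κ n a (mkPowerSeries l κ (n + 1) f) =
      mkPowerSeries l κ (n + 1) fun j ↦ MvPowerSeries.shear (a j) (f j) := rfl

variable [Field k] [CharZero k]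

theorem approximates (res : ∀ j, k → κ j) (n : ℕ)
    (ι : ∀ n, k →+* PowerSeriesProduct l κ n)
    (hι : ∀ n a, ι n a = mkPowerSeries l κ n fun j ↦ MvPowerSeries.C (res j a)) :
    Approximates (ι n) fun i ↦ mkPowerSeries l κ n fun _ ↦ MvPowerSeries.X i := by
  induction n with
  | zero => exact .zero _ _
  | succ n ih =>
    have hCC (a : k) : ofPolynomial l κ n (Polynomial.C (ι n a)) = ι (n + 1) a := by
      rw [hι, ofPolynomial_C, hι]
      refine congrArg (mkPowerSeries l κ (n + 1)) (funext fun j ↦ ?_)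
      rw [ofPowerSeries_apply, AlgEquiv.symm_apply_eq, MvPowerSeries.finSuccEquiv_C]
    have hCX (i : Fin n) : ofPolynomial l κ n (Polynomial.C (mkPowerSeries l κ n fun _ ↦
        MvPowerSeries.X i)) =
        mkPowerSeries l κ (n + 1) fun _ ↦ MvPowerSeries.X i.succ := by
      rw [ofPolynomial_C]
      refine congrArg (mkPowerSeries l κ (n + 1)) (funext fun j ↦ ?_)
      rw [ofPowerSeries_apply, AlgEquiv.symm_apply_eq, MvPowerSeries.finSuccEquiv_X_succ]
    have h𝔫 : IsNewtonIdeal ((Ideal.pi fun j ↦ maximalIdeal (MvPowerSeries (Fin (n + 1)) (κ j))).map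
        (mkPowerSeries l κ (n + 1))) :=
      isNewtonIdeal (l := (l : Filter J)) (D := fun j ↦ MvPowerSeries (Fin (n + 1)) (κ j)) _
        fun j ↦ isNewtonIdeal_maximalIdeal _
    have key := ih.succ h𝔫 (ofPolynomial l κ n) (fun p ↦ ofPolynomial_ne_zero)
      (by
        rw [ofPolynomial_X]
        refine Ideal.mem_map_of_mem _ fun j ↦ ?_
        change MvPowerSeries.X 0 ∈ maximalIdeal (MvPowerSeries (Fin (n + 1)) (κ j))
        rw [MvPowerSeries.maximalIdeal_eq_span_range_X]
        exact Ideal.subset_span ⟨0, rfl⟩)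
      (fun a ↦ by
        refine ⟨shear l κ n fun j i ↦ - res j (a i), ?_,
          fun i ↦ ?_, fun c ↦ ?_⟩
        · rw [ofPolynomial_X, shear_mk]
          exact congrArg (mkPowerSeries l κ (n + 1)) (funext fun j ↦ MvPowerSeries.shear_X_zero _)
        · rw [map_add, map_mul, hCX, hCC, ofPolynomial_X, hι, ← map_mul, ← map_add, shear_mk]
          refine congrArg (mkPowerSeries l κ (n + 1)) (funext fun j ↦ ?_)
          simp [MvPowerSeries.shear_X_zero, MvPowerSeries.shear_X_succ, MvPowerSeries.shear_C]
        · rw [hCC, hι, shear_mk]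
          exact congrArg (mkPowerSeries l κ (n + 1)) (funext fun j ↦ MvPowerSeries.shear_C _ _))
    convert key using 1
    · ext a
      exact (hCC a).symm
    · funext i
      refine Fin.cases ?_ (fun i ↦ ?_) i
      · exact (ofPolynomial_X n).symm
      · exact (hCX i).symm

end ReducedProduct

namespace ReducedProduct

/-- A ring homomorphism to a reduced product from a ring of finite type over `ℤ` lifts, on a member
of the filter, to ring homomorphisms to the factors. -/
theorem exists_lift_of_finite {J : Type*} {l : Filter J} {D : J → Type*} [∀ j, CommRing (D j)]
    {σ P : Type*} [Finite σ] [CommRing P] (v : σ → P) (A : Subring P) (hv : ∀ i, v i ∈ A)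
    (φ : A →+* ReducedProduct l D) (g : σ → ∀ j, D j) (hg : ∀ i, φ ⟨v i, hv i⟩ = mk l D (g i)) :
    ∃ A' : Subring P, ∃ hv' : ∀ i, v i ∈ A',
      ∀ᶠ j in l, ∃ η : A' →+* D j, ∀ i, η ⟨v i, hv' i⟩ = g i j := by
  let Φ : MvPolynomial σ ℤ →+* P := MvPolynomial.eval₂Hom (Int.castRingHom P) v
  let Φ' : MvPolynomial σ ℤ →+* A := MvPolynomial.eval₂Hom (Int.castRingHom A) fun i ↦ ⟨v i, hv i⟩
  have hΦ : A.subtype.comp Φ' = Φ := by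
    refine MvPolynomial.ringHom_ext (fun _ ↦ by simp) fun i ↦ by simp [Φ, Φ']
  let Ψ : MvPolynomial σ ℤ →+* (∀ j, D j) := MvPolynomial.eval₂Hom (Int.castRingHom _) g
  have hΨ : (mk l D).comp Ψ = φ.comp Φ' := by
    refine MvPolynomial.ringHom_ext (fun _ ↦ by simp) fun i ↦ by simp [Ψ, Φ', hg]
  have hker (p) (hp : p ∈ RingHom.ker Φ) : ∀ᶠ j in l, Ψ p j = 0 := by
    rw [← mk_eq_zero]
    have h1 : Φ' p = 0 := Subtype.ext (congr($hΦ p).trans hp)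
    exact (congr($hΨ p)).trans (by simp [h1])
  obtain ⟨s, hs⟩ := (isNoetherianRing_iff_ideal_fg _).1 inferInstance (RingHom.ker Φ)
  have hev : ∀ᶠ j in l, ∀ p ∈ s, Ψ p j = 0 :=
    (Filter.eventually_all_finset s).2 fun p hp ↦ hker p (hs ▸ Ideal.subset_span hp)
  have hvr (i) : v i ∈ Φ.range := ⟨MvPolynomial.X i, by simp [Φ]⟩
  refine ⟨Φ.range, hvr, ?_⟩
  filter_upwards [hev] with j hj
  have hle : RingHom.ker Φ.rangeRestrict ≤ RingHom.ker ((Pi.evalRingHom D j).comp Ψ) := by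
    rw [RingHom.ker_rangeRestrict, ← hs, Ideal.span_le]
    exact fun p hp ↦ hj p hp
  refine ⟨RingHom.liftOfSurjective _ Φ.rangeRestrict_surjective ⟨_, hle⟩, fun i ↦ ?_⟩
  have h1 : (⟨v i, hvr i⟩ : Φ.range) = Φ.rangeRestrict (MvPolynomial.X i) :=
    Subtype.ext (by simp [Φ])
  rw [h1, RingHom.liftOfRightInverse_comp_apply]
  simp [Ψ]

end ReducedProduct

theorem exists_ringHom_charP.{v} {k : Type v} [Field k] [CharZero k] {n : ℕ}
    (S : Finset (MvPowerSeries (Fin n) k)) :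
    ∃ (κ : Type v) (_ : Field κ) (p : ℕ) (_ : p.Prime) (_ : CharP κ p)
      (A : Subring (MvPowerSeries (Fin n) k)) (η : A →+* MvPowerSeries (Fin n) κ),
      (∀ f ∈ S, f ∈ A) ∧
        ∀ i, ∃ h : MvPowerSeries.X i ∈ A, η ⟨MvPowerSeries.X i, h⟩ = MvPowerSeries.X i := by
  obtain ⟨κ, _, res, hκ, h1, hadd, hmul⟩ := exists_finite_charP_reductions k
  let l : Ultrafilter (Finset k) := Ultrafilter.of Filter.atTop
  have hl (a : k) : ∀ᶠ j in (l : Filter (Finset k)), a ∈ j := by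
    refine Ultrafilter.of_le _ ?_
    filter_upwards [Filter.eventually_ge_atTop {a}] with j hj
    exact hj (Finset.mem_singleton_self a)
  let ι (n : ℕ) : k →+* ReducedProduct.PowerSeriesProduct l κ n :=
    RingHom.mk'
      { toFun a := ReducedProduct.mkPowerSeries l κ n fun j ↦ MvPowerSeries.C (res j a)
        map_one' := by simp only [h1, map_one]; exact map_one _
        map_mul' a b := by
          rw [← map_mul, ReducedProduct.mk_eq_mk]
          filter_upwards [hl a, hl b] with j ha hb
          simp [hmul j a b ha hb] }
      fun a b ↦ by
        change ReducedProduct.mkPowerSeries l κ n _ = ReducedProduct.mkPowerSeries l κ n _ +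
          ReducedProduct.mkPowerSeries l κ n _
        rw [← map_add, ReducedProduct.mk_eq_mk]
        filter_upwards [hl a, hl b] with j ha hb
        simp [hadd j a b ha hb]
  obtain ⟨A, φ, hA, -, hX⟩ := ReducedProduct.approximates res n ι (fun _ _ ↦ rfl) S
  choose hXA hXφ using hX
  choose g hg using fun f : S ↦ Ideal.Quotient.mk_surjective (φ ⟨f, hA f f.2⟩)
  obtain ⟨A', hv', hη⟩ := ReducedProduct.exists_lift_of_finite
    (Sum.elim MvPowerSeries.X ((↑) : S → MvPowerSeries (Fin n) k)) A
    (Sum.rec hXA fun f ↦ hA f f.2) φ (Sum.elim (fun i _ ↦ MvPowerSeries.X i) g)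
    (Sum.rec hXφ fun f ↦ (hg f).symm)
  obtain ⟨j, η, hη⟩ := hη.exists
  obtain ⟨p, hp, hpκ⟩ := hκ j
  exact ⟨κ j, inferInstance, p, hp, hpκ, A', η, fun f hf ↦ hv' (.inr ⟨f, hf⟩),
    fun i ↦ ⟨hv' (.inl i), hη (.inl i)⟩⟩

namespace RingTheory.Sequence

theorem isWeaklyRegular_append_singleton_iff {R : Type*} [CommRing R] (rs : List R) (r : R) :
    IsWeaklyRegular R (rs ++ [r]) ↔ IsWeaklyRegular R rs ∧
      ∀ u, r * u ∈ Ideal.ofList rs → u ∈ Ideal.ofList rs := by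
  rw [isWeaklyRegular_append_iff, isWeaklyRegular_singleton_iff,
    isSMulRegular_quotient_iff_mem_of_smul_mem]
  simp

variable {R : Type*} [CommRing R] [IsLocalRing R] [IsNoetherianRing R]

theorem IsWeaklyRegular.append_pow_cons {rs ts : List R} {r : R}
    (h : IsWeaklyRegular R (rs ++ r :: ts)) (hm : ∀ x ∈ rs ++ r :: ts, x ∈ maximalIdeal R) (a : ℕ) :
    IsWeaklyRegular R (rs ++ r ^ (a + 1) :: ts) := by
  have hp (x : R) : List.Perm (rs ++ x :: ts) ((rs ++ ts) ++ [x]) :=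
    List.perm_middle.trans (List.perm_append_singleton x (rs ++ ts)).symm
  have h1 := isWeaklyRegular_of_perm_of_subset_maximalIdeal h (hp r) hm
  refine isWeaklyRegular_of_perm_of_subset_maximalIdeal (rs := (rs ++ ts) ++ [r ^ (a + 1)]) ?_
    (hp _).symm fun x hx ↦ ?_
  · rw [isWeaklyRegular_append_iff, isWeaklyRegular_singleton_iff] at h1 ⊢
    exact ⟨h1.1, h1.2.pow _⟩
  · simp only [List.mem_append, List.mem_cons, List.not_mem_nil, or_false] at hx hm
    rcases hx with (hx | hx) | rfl
    · exact hm x (.inl hx)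
    · exact hm x (.inr (.inr hx))
    · exact Ideal.pow_mem_of_mem _ (hm r (.inr (.inl rfl))) _ (by omega)

/-- Monomial property of regular sequences: `rs` is the colon ideal of the ideal of powers by the
product of the lower powers. -/
theorem IsWeaklyRegular.mem_of_mul_prod_pow_mem (a : ℕ) (ts : List R) :
    ∀ (rs : List R) (_ : IsWeaklyRegular R (rs ++ ts)) (_ : ∀ x ∈ rs ++ ts, x ∈ maximalIdeal R)
      (u : R), u * (ts.map (· ^ a)).prod ∈ Ideal.ofList (rs ++ ts.map (· ^ (a + 1))) →
      u ∈ Ideal.ofList (rs ++ ts) := by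
  induction ts with
  | nil => intro rs _ _ u hu; simpa using hu
  | cons r ts ih =>
    intro rs h hm u hu
    have h1 := h.append_pow_cons hm a
    have hm1 : ∀ x ∈ rs ++ r ^ (a + 1) :: ts, x ∈ maximalIdeal R := by
      simp only [List.mem_append, List.mem_cons] at hm ⊢
      rintro x (hx | rfl | hx)
      · exact hm x (.inl hx)
      · exact Ideal.pow_mem_of_mem _ (hm r (.inr (.inl rfl))) _ (by omega)
      · exact hm x (.inr (.inr hx))
    have h2 := ih (rs ++ [r ^ (a + 1)]) (by simpa using h1) (by simpa using hm1) (u * r ^ a)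
      (by simpa [mul_assoc] using hu)
    have hreg := isWeaklyRegular_of_perm_of_subset_maximalIdeal h
      (List.perm_middle.trans (List.perm_append_singleton r (rs ++ ts)).symm) hm
    rw [isWeaklyRegular_append_singleton_iff] at hreg
    have hpow (m : ℕ) (v : R) : r ^ m * v ∈ Ideal.ofList (rs ++ ts) → v ∈ Ideal.ofList (rs ++ ts)
        := by
      induction m with
      | zero => simp
      | succ m ihm => exact fun hv ↦ ihm (hreg.2 _ (by rwa [← mul_assoc, ← pow_succ']))
    simp only [Ideal.ofList_append, Ideal.ofList_cons, Ideal.ofList_nil] at h2 hpow ⊢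
    rw [show Ideal.ofList rs ⊔ (Ideal.span {r ^ (a + 1)} ⊔ ⊥) ⊔ Ideal.ofList ts =
      Ideal.span {r ^ (a + 1)} ⊔ (Ideal.ofList rs ⊔ Ideal.ofList ts) by
        rw [sup_bot_eq, sup_comm (Ideal.ofList rs), sup_assoc]] at h2
    rw [show Ideal.ofList rs ⊔ (Ideal.span {r} ⊔ Ideal.ofList ts) =
      Ideal.span {r} ⊔ (Ideal.ofList rs ⊔ Ideal.ofList ts) by
        rw [← sup_assoc, sup_comm (Ideal.ofList rs), sup_assoc]]
    obtain ⟨v, hv, w, hw, hvw⟩ := Submodule.mem_sup.1 h2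
    obtain ⟨t, rfl⟩ := Ideal.mem_span_singleton'.1 hv
    have h3 := hpow a (u - t * r) (by convert hw using 1; linear_combination -hvw)
    exact Submodule.mem_sup.2 ⟨t * r, Ideal.mem_span_singleton'.2 ⟨t, rfl⟩, _, h3, by ring⟩

end RingTheory.Sequence

theorem WeakReg.prod_pow_notMem {R : Type*} [CommRing R] [IsLocalRing R] [IsNoetherianRing R]
    {n : ℕ} {z : Fin n → R} (hz : WeakReg z R) (hm : ∀ i, z i ∈ maximalIdeal R) (a : ℕ) {u : R}
    (hu : IsUnit u) :
    u * ∏ i, z i ^ a ∉ Ideal.span (Set.range fun i ↦ z i ^ (a + 1)) := by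
  intro h
  have h1 := (weakReg_iff_isWeaklyRegular.1 hz).mem_of_mul_prod_pow_mem a (List.ofFn z) []
    (by simpa [List.mem_ofFn]) u (by
      simpa [Ideal.ofList, List.map_ofFn, List.prod_ofFn, List.mem_ofFn, Set.range] using h)
  refine (maximalIdeal.isMaximal R).ne_top (Ideal.eq_top_of_isUnit_mem _ ?_ hu)
  refine (Ideal.span_le.2 ?_ : Ideal.ofList ([] ++ List.ofFn z) ≤ maximalIdeal R) h1
  rintro x hx
  obtain ⟨i, rfl⟩ := (List.mem_ofFn' _ _).1 hx
  exact hm i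

theorem MvPowerSeries.ringKrullDim_fin (k : Type*) [Field k] (n : ℕ) :
    ringKrullDim (MvPowerSeries (Fin n) k) = n := by
  refine le_antisymm ?_ ?_
  · have h2 := ringKrullDim_le_spanFinrank_maximalIdeal (MvPowerSeries (Fin n) k)
    have h3 := (Submodule.spanFinrank_span_le_ncard_of_finite (R := MvPowerSeries (Fin n) k)
      (Set.finite_range (X : Fin n → MvPowerSeries (Fin n) k))).trans
        ((Finite.card_range_le _).trans (Nat.card_fin n).le)
    rw [show Submodule.span _ (Set.range (X : Fin n → MvPowerSeries (Fin n) k)) = maximalIdeal _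
      from maximalIdeal_eq_span_range_X.symm] at h3
    exact h2.trans (by exact_mod_cast h3)
  · induction n with
    | zero => simpa using ringKrullDim_nonneg_of_nontrivial
    | succ n ih =>
      rw [ringKrullDim_eq_of_ringEquiv (finSuccEquiv k n).toRingEquiv]
      refine le_trans ?_ ringKrullDim_succ_le_ringKrullDim_powerseries
      push_cast
      gcongr

theorem MvPowerSeries.weakReg_X (k : Type*) [Field k] (n : ℕ) :
    WeakReg (X : Fin n → MvPowerSeries (Fin n) k) (MvPowerSeries (Fin n) k) :=
  (isDomain_and_weakReg_of_regular _ maximalIdeal_eq_span_range_X.symm (ringKrullDim_fin k n)).2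

open MvPolynomial in
/-- A regular system of parameters is quasi-regular. -/
theorem WeakReg.mem_pow_idealOfVars {R k : Type*} [CommRing R] [IsLocalRing R] [IsNoetherianRing R]
    [Field k] {n N : ℕ} {z : Fin n → R} (hz : WeakReg z R)
    (hm : Ideal.span (Set.range z) = maximalIdeal R) (σ : k →+* R ⧸ maximalIdeal R ^ N)
    (p : MvPolynomial (Fin n) k) (hp : p.eval₂ σ (fun i ↦ Ideal.Quotient.mk _ (z i)) = 0) :
    p ∈ idealOfVars (Fin n) k ^ N := by
  classical
  rw [mem_pow_idealOfVars_iff']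
  by_contra! hcon
  obtain ⟨β, ⟨hβN, hβ⟩, hmin⟩ := exists_minimal_of_wellFoundedLT
    (fun β : Fin n →₀ ℕ ↦ β.degree < N ∧ coeff β p ≠ 0) (by simpa using hcon)
  obtain ⟨a, rfl⟩ : ∃ a, N = a + 1 := ⟨N - 1, by omega⟩
  have hβi (i) : β i ≤ a := by
    have := Finsupp.le_degree i β
    omega
  let W : R := ∏ i, z i ^ (a - β i)
  have hmon (γ : Fin n →₀ ℕ) (hγ : ¬ γ ≤ β) :
      (∏ i, z i ^ γ i) * W ∈ Ideal.span (Set.range fun i ↦ z i ^ (a + 1)) := by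
    obtain ⟨i, hi⟩ : ∃ i, β i < γ i := by simpa [Finsupp.le_def] using hγ
    refine Ideal.mem_of_dvd _ ?_ (Ideal.subset_span ⟨i, rfl⟩)
    calc z i ^ (a + 1) ∣ z i ^ γ i * z i ^ (a - β i) := by
          rw [← pow_add]; exact pow_dvd_pow _ (by have := hβi i; omega)
      _ ∣ _ := mul_dvd_mul (Finset.dvd_prod_of_mem (fun i ↦ z i ^ γ i) (Finset.mem_univ i))
          (Finset.dvd_prod_of_mem (fun i ↦ z i ^ (a - β i)) (Finset.mem_univ i))
  have hpow (r) (hr : r ∈ maximalIdeal R ^ (a + 1)) :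
      r * W ∈ Ideal.span (Set.range fun i ↦ z i ^ (a + 1)) := by
    rw [← hm, Ideal.mem_span_pow_iff_exists_isHomogeneous] at hr
    obtain ⟨F, hF, rfl⟩ := hr
    rw [eval_eq', Finset.sum_mul]
    refine Ideal.sum_mem _ fun γ hγ ↦ ?_
    rw [mul_assoc]
    refine Ideal.mul_mem_left _ _ (hmon γ fun hle ↦ ?_)
    have h1 : γ.degree = a + 1 := by
      rw [Finsupp.degree_eq_weight_one]
      exact hF (mem_support_iff.1 hγ)
    have h2 : γ.degree ≤ β.degree := Finsupp.degree_mono hle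
    omega
  choose u hu using fun α ↦ Ideal.Quotient.mk_surjective (σ (coeff α p))
  have hsum : ∑ α ∈ p.support, u α * ∏ i, z i ^ α i ∈ maximalIdeal R ^ (a + 1) := by
    rw [← Ideal.Quotient.eq_zero_iff_mem, ← hp, eval₂_eq']
    simp [hu]
  have hβs : β ∈ p.support := mem_support_iff.2 hβ
  have h1 := hpow _ hsum
  rw [← Finset.add_sum_erase _ _ hβs, add_mul, Finset.sum_mul] at h1
  have h2 : u β * ∏ i, z i ^ a ∈ Ideal.span (Set.range fun i ↦ z i ^ (a + 1)) := by
    have h3 : (∏ i, z i ^ β i) * W = ∏ i, z i ^ a := by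
      rw [← Finset.prod_mul_distrib]
      refine Finset.prod_congr rfl fun i _ ↦ ?_
      rw [← pow_add]
      congr 1
      have := hβi i
      omega
    rw [← h3, ← mul_assoc]
    refine (Ideal.add_mem_iff_left _ (Ideal.sum_mem _ fun α hα ↦ ?_)).1 h1
    rw [Finset.mem_erase] at hα
    rw [mul_assoc]
    refine Ideal.mul_mem_left _ _ (hmon α fun hle ↦ hα.1 (le_antisymm hle (hmin ⟨?_, ?_⟩ hle)))
    · exact (Finsupp.degree_mono hle).trans_lt hβN
    · exact mem_support_iff.1 hα.2
  refine hz.prod_pow_notMem (fun i ↦ hm ▸ Ideal.subset_span ⟨i, rfl⟩) a ?_ h2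
  by_contra hun
  have : Nontrivial (R ⧸ maximalIdeal R ^ (a + 1)) :=
    Ideal.Quotient.nontrivial_iff.2 fun h ↦ (maximalIdeal.isMaximal R).ne_top
      (top_le_iff.1 (h.symm.le.trans (Ideal.pow_le_self (by omega))))
  have h4 : σ (coeff β p ^ (a + 1)) = 0 := by
    rw [map_pow, ← hu, ← map_pow, Ideal.Quotient.eq_zero_iff_mem]
    exact Ideal.pow_mem_pow hun _
  exact pow_ne_zero _ hβ ((map_eq_zero σ).1 h4)

theorem MvPowerSeries.coeff_eq_zero_of_mem_maximalIdeal_pow {n : ℕ} {k : Type*} [Field k] {N : ℕ}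
    {f : MvPowerSeries (Fin n) k} (hf : f ∈ maximalIdeal (MvPowerSeries (Fin n) k) ^ N)
    (m : Fin n →₀ ℕ) (hm : m.degree < N) : coeff m f = 0 := by
  rw [maximalIdeal_eq_span_range_X, Ideal.mem_span_pow_iff_exists_isHomogeneous] at hf
  obtain ⟨F, hF, rfl⟩ := hf
  rw [MvPolynomial.eval_eq', map_sum]
  refine Finset.sum_eq_zero fun γ hγ ↦ ?_
  have h1 : γ.degree = N := by
    rw [Finsupp.degree_eq_weight_one]
    exact hF (MvPolynomial.mem_support_iff.1 hγ)
  have h2 : (∏ i, (X i : MvPowerSeries (Fin n) k) ^ γ i) = monomial γ 1 := by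
    rw [monomial_one_eq, Finsupp.prod_fintype _ _ (by simp)]
  rw [h2, coeff_mul_monomial, if_neg]
  exact fun hle ↦ by have := Finsupp.degree_mono hle; omega

open MvPolynomial in
theorem exists_ringHom_mvPowerSeries {R k : Type*} [CommRing R] [IsLocalRing R]
    [IsNoetherianRing R] [Field k] {n : ℕ} {z : Fin n → R} (hz : WeakReg z R)
    (hm : Ideal.span (Set.range z) = maximalIdeal R) (σ : ∀ N, k →+* R ⧸ maximalIdeal R ^ N)
    (hσ : ∀ M N (h : M ≤ N) a, Ideal.Quotient.factorPow (maximalIdeal R) h (σ N a) = σ M a)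
    (hσ1 : ∀ r, ∃ a, σ 1 a = Ideal.Quotient.mk _ r) :
    ∃ ρ : R →+* MvPowerSeries (Fin n) k, (∀ i, ρ (z i) = MvPowerSeries.X i) ∧
      (∀ N r, ρ r ∈ maximalIdeal (MvPowerSeries (Fin n) k) ^ N → r ∈ maximalIdeal R ^ N) ∧
      ∀ N f, ∃ r, f - ρ r ∈ maximalIdeal (MvPowerSeries (Fin n) k) ^ N := by
  let E (N : ℕ) : MvPolynomial (Fin n) k →+* R ⧸ maximalIdeal R ^ N :=
    eval₂Hom (σ N) fun i ↦ Ideal.Quotient.mk _ (z i)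
  have hE (M N) (h : M ≤ N) (p) :
      Ideal.Quotient.factorPow (maximalIdeal R) h (E N p) = E M p := by
    have : (Ideal.Quotient.factorPow (maximalIdeal R) h).comp (E N) = E M :=
      ringHom_ext (fun a ↦ by simp [E, hσ]) fun i ↦ by simp [E]
    exact congr($this p)
  have hEX (N i) : E N (X i) = Ideal.Quotient.mk _ (z i) := by simp [E]
  have hEker (N p) (hp : E N p = 0) : p ∈ idealOfVars (Fin n) k ^ N :=
    hz.mem_pow_idealOfVars hm (σ N) p hp
  have hEpow (N p) (hp : p ∈ idealOfVars (Fin n) k ^ N) : E N p = 0 := by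
    have h1 := Ideal.mem_map_of_mem (E N) hp
    have h2 : (idealOfVars (Fin n) k).map (E N) = (maximalIdeal R).map (Ideal.Quotient.mk _) := by
      rw [idealOfVars, Ideal.map_span, ← congrArg (Ideal.map (Ideal.Quotient.mk _)) hm,
        Ideal.map_span, ← Set.range_comp, ← Set.range_comp]
      exact congrArg _ (congrArg _ (funext fun i ↦ by simp [hEX]))
    rw [Ideal.map_pow, h2, ← Ideal.map_pow, Ideal.map_quotient_self] at h1
    exact h1
  have hcoe (N) (p : MvPolynomial (Fin n) k) :
      (p : MvPowerSeries (Fin n) k) ∈ maximalIdeal (MvPowerSeries (Fin n) k) ^ N ↔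
        p ∈ idealOfVars (Fin n) k ^ N := by
    rw [mem_pow_idealOfVars_iff']
    refine ⟨fun h x hx ↦ ?_, fun h ↦ ?_⟩
    · rw [← coeff_coe]
      exact MvPowerSeries.coeff_eq_zero_of_mem_maximalIdeal_pow h x hx
    · rw [MvPowerSeries.maximalIdeal_eq_span_range_X]
      exact MvPowerSeries.mem_span_range_X_pow fun m hm ↦ by rw [coeff_coe]; exact h m hm
  have hsurj (j : ℕ) : ∀ N (r : R), ∃ p, ∃ s ∈ maximalIdeal R ^ j,
      Ideal.Quotient.mk (maximalIdeal R ^ N) r = E N p + Ideal.Quotient.mk _ s := by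
    induction j with
    | zero => exact fun N r ↦ ⟨0, r, by simp, by simp⟩
    | succ j ih =>
      intro N r
      obtain ⟨a, ha⟩ := hσ1 r
      obtain ⟨r0, hr1⟩ := Ideal.Quotient.mk_surjective (σ (N + 1) a)
      have hr0 : Ideal.Quotient.mk _ r0 = σ N a := by
        rw [← hσ N (N + 1) (by omega) a, ← hr1]; simp
      have h1 : r - r0 ∈ maximalIdeal R := by
        rw [← pow_one (maximalIdeal R), ← Ideal.Quotient.eq, ← ha, ← hσ 1 (N + 1) (by omega) a, ←
            hr1]
        simp
      rw [← hm, Ideal.mem_span_range_iff_exists_fun] at h1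
      obtain ⟨c, hc⟩ := h1
      choose p s hs hps using fun i ↦ ih N (c i)
      refine ⟨C a + ∑ i, p i * X i, ∑ i, s i * z i, Ideal.sum_mem _ fun i _ ↦ ?_, ?_⟩
      · rw [pow_succ]
        exact Ideal.mul_mem_mul (hs i) (hm ▸ Ideal.subset_span ⟨i, rfl⟩)
      · rw [show r = r0 + ∑ i, c i * z i by rw [hc]; ring]
        have : E N (C a) = σ N a := by simp [E]
        simp only [map_add, map_sum, map_mul, hEX, hps, this, hr0, add_mul, Finset.sum_add_distrib]
        ring
  have hEs (N) : Function.Surjective (E N) := by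
    intro y
    obtain ⟨r, rfl⟩ := Ideal.Quotient.mk_surjective y
    obtain ⟨p, s, hs, h⟩ := hsurj N N r
    exact ⟨p, by rw [h, Ideal.Quotient.eq_zero_iff_mem.2 hs, add_zero]⟩
  let f (N : ℕ) : R →+* MvPowerSeries (Fin n) k ⧸ maximalIdeal (MvPowerSeries (Fin n) k) ^ N :=
    ((E N).liftOfSurjective (hEs N) ⟨(Ideal.Quotient.mk _).comp coeToMvPowerSeries.ringHom,
      fun p hp ↦ Ideal.Quotient.eq_zero_iff_mem.2 ((hcoe N p).2 (hEker N p hp))⟩).comp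
        (Ideal.Quotient.mk _)
  have hf (N r p) (h : E N p = Ideal.Quotient.mk _ r) :
      f N r = Ideal.Quotient.mk _ (p : MvPowerSeries (Fin n) k) := by
    simp only [f, RingHom.comp_apply, ← h]
    rw [RingHom.liftOfRightInverse_comp_apply]
    rfl
  have hfc {M N : ℕ} (h : M ≤ N) : (Ideal.Quotient.factorPow _ h).comp (f N) = f M := by
    ext r
    obtain ⟨p, hp⟩ := hEs N (Ideal.Quotient.mk _ r)
    rw [RingHom.comp_apply, hf N r p hp, hf M r p]
    · simp
    · rw [← hE M N h, hp]; simp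
  let ρ : R →+* MvPowerSeries (Fin n) k := IsAdicComplete.liftRingHom _ f hfc
  have hρ (N r p) (h : E N p = Ideal.Quotient.mk _ r) :
      (p : MvPowerSeries (Fin n) k) - ρ r ∈ maximalIdeal (MvPowerSeries (Fin n) k) ^ N := by
    rw [← Ideal.Quotient.eq, ← hf N r p h]
    exact (IsAdicComplete.mk_liftRingHom _ f hfc N r).symm
  refine ⟨ρ, fun i ↦ ?_, fun N r hr ↦ ?_, fun N f ↦ ?_⟩
  · symm
    rw [← sub_eq_zero]
    refine IsHausdorff.haus (I := maximalIdeal (MvPowerSeries (Fin n) k)) inferInstance _ fun N ↦ ?_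
    rw [SModEq.zero, smul_eq_mul, Ideal.mul_top]
    simpa using hρ N (z i) (X i) (hEX N i)
  · obtain ⟨p, hp⟩ := hEs N (Ideal.Quotient.mk _ r)
    have h1 := add_mem (hρ N r p hp) hr
    rw [sub_add_cancel, hcoe] at h1
    rw [← Ideal.Quotient.eq_zero_iff_mem, ← hp, hEpow N p h1]
  · let p : MvPolynomial (Fin n) k := MvPowerSeries.truncTotal N f
    obtain ⟨r, hr⟩ := Ideal.Quotient.mk_surjective (E N p)
    refine ⟨r, ?_⟩
    have h1 : f - (p : MvPowerSeries (Fin n) k) ∈ maximalIdeal (MvPowerSeries (Fin n) k) ^ N := by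
      rw [MvPowerSeries.maximalIdeal_eq_span_range_X]
      refine MvPowerSeries.mem_span_range_X_pow fun m hm ↦ ?_
      rw [map_sub, coeff_coe, MvPowerSeries.coeff_truncTotal _ hm, sub_self]
    convert add_mem h1 (hρ N r p hr.symm) using 1
    ring

theorem Algebra.FormallySmooth.of_charZero (K L : Type*) [Field K] [Field L] [Algebra K L]
    [CharZero K] : Algebra.FormallySmooth K L := by
  obtain ⟨s, hs⟩ := exists_isTranscendenceBasis K L
  have := hs.isAlgebraic_field
  have : Algebra.IsSeparable (IntermediateField.adjoin K (Set.range ((↑) : s → L))) L :=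
      inferInstance
  exact .of_algebraicIndependent_of_isSeparable hs.1

theorem exists_ringHom_mvPowerSeries_of_charZero {R : Type*} [CommRing R] [IsLocalRing R]
    [IsNoetherianRing R] [CharZero (ResidueField R)] {n : ℕ} {z : Fin n → R} (hz : WeakReg z R)
    (hm : Ideal.span (Set.range z) = maximalIdeal R) :
    ∃ ρ : R →+* MvPowerSeries (Fin n) (ResidueField R), (∀ i, ρ (z i) = MvPowerSeries.X i) ∧
      (∀ N r, ρ r ∈ maximalIdeal (MvPowerSeries (Fin n) (ResidueField R)) ^ N →
        r ∈ maximalIdeal R ^ N) ∧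
      ∀ N f, ∃ r, f - ρ r ∈ maximalIdeal (MvPowerSeries (Fin n) (ResidueField R)) ^ N := by
  have halg : Nonempty (Algebra ℚ R) := by
    refine (EqualCharZero.nonempty_algebraRat_iff R).2 fun I hI ↦ ⟨fun a b hab ↦ ?_⟩
    have h1 : ((a : R) - b) ∈ maximalIdeal R := le_maximalIdeal hI (by
      rw [← Ideal.Quotient.eq]; simpa using hab)
    have h2 := (residue_eq_zero_iff _).2 h1
    rw [map_sub, map_natCast, map_natCast, sub_eq_zero] at h2
    exact_mod_cast h2
  obtain ⟨_⟩ := halg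
  have : Algebra.FormallySmooth ℚ (ResidueField R) := .of_charZero _ _
  let f : ResidueField R →ₐ[ℚ] R ⧸ maximalIdeal R :=
    { toFun := fun a ↦ a
      map_one' := rfl
      map_mul' := fun _ _ ↦ rfl
      map_zero' := rfl
      map_add' := fun _ _ ↦ rfl
      commutes' := fun a ↦ by
        have : algebraMap ℚ (ResidueField R) = algebraMap ℚ (R ⧸ maximalIdeal R) :=
          Subsingleton.elim (α := ℚ →+* ResidueField R) _ _
        exact congr($this a) }
  obtain ⟨g, hg⟩ := Algebra.FormallySmooth.exists_adicCompletionEvalOneₐ_comp_eq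
    (R := ℚ) (A := ResidueField R) (S := R) (I := maximalIdeal R) f
  refine exists_ringHom_mvPowerSeries hz hm
    (fun N ↦ (AdicCompletion.evalₐ (maximalIdeal R) N).toRingHom.comp g.toRingHom) ?_ ?_
  · intro M N h a
    obtain ⟨x, hx⟩ := AdicCompletion.mk_surjective (maximalIdeal R) R (g a)
    have h1 : ∀ N, (AdicCompletion.evalₐ (maximalIdeal R) N).toRingHom.comp g.toRingHom a =
      Ideal.Quotient.mk _ (x.val N) := fun N ↦ by
        rw [← AdicCompletion.evalₐ_mk, hx]; rfl
    rw [h1, h1]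
    change Ideal.Quotient.factorPow _ h (Ideal.Quotient.mk _ _) = _
    rw [Ideal.Quotient.factor_mk, Ideal.Quotient.eq]
    simpa [← neg_mem_iff (x := x.val N - x.val M)] using (SModEq.sub_mem.1 (x.2 h))
  · intro r
    refine ⟨residue R r, ?_⟩
    have h1 : AdicCompletion.evalOneₐ (maximalIdeal R) (g (residue R r)) = Ideal.Quotient.mk _ r :=
      congr($hg (residue R r))
    rw [← AdicCompletion.factorₐ_evalₐ_one] at h1
    obtain ⟨x, hx⟩ := Ideal.Quotient.mk_surjective
      (AdicCompletion.evalₐ (maximalIdeal R) 1 (g (residue R r)))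
    change (AdicCompletion.evalₐ (maximalIdeal R) 1 (g (residue R r))) = _
    rw [← hx] at h1 ⊢
    rw [Ideal.Quotient.factor_mk, Ideal.Quotient.eq] at h1
    rw [Ideal.Quotient.eq]
    simpa using h1

namespace MvPowerSeries

theorem mem_span_range_X_pow_of_coeff {σ A : Type*} [Fintype σ] [CommRing A] {a : ℕ}
    {f : MvPowerSeries σ A} (hf : ∀ m : σ →₀ ℕ, (∀ i, m i ≤ a) → coeff m f = 0) :
    f ∈ Ideal.span (Set.range fun i ↦ (X i : MvPowerSeries σ A) ^ (a + 1)) := by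
  classical
  have hex (m : σ →₀ ℕ) (h : ¬ ∀ i, m i ≤ a) : ∃ i, a + 1 ≤ m i := by
    push Not at h; exact h
  let w (i : σ) : MvPowerSeries σ A := fun m ↦
    if h : ∃ h : ¬ ∀ j, (m + Finsupp.single i (a + 1)) j ≤ a, (hex _ h).choose = i then
      coeff (m + Finsupp.single i (a + 1)) f else 0
  have hw : f = ∑ i, X i ^ (a + 1) * w i := by
    ext m
    have h1 (i : σ) : coeff m (X i ^ (a + 1) * w i) =
        if h : ∃ h : ¬ ∀ j, m j ≤ a, (hex _ h).choose = i then coeff m f else 0 := by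
      rw [X_pow_eq, coeff_monomial_mul, one_mul]
      have h2 : Finsupp.single i (a + 1) ≤ m ↔ a + 1 ≤ m i := by
        rw [Finsupp.single_le_iff]
      split_ifs with h3 h4 h4
      · change w i (m - Finsupp.single i (a + 1)) = _
        simp only [w, tsub_add_cancel_of_le h3]
        rw [dif_pos h4]
      · change w i (m - Finsupp.single i (a + 1)) = _
        simp only [w, tsub_add_cancel_of_le h3]
        rw [dif_neg h4]
      · obtain ⟨h5, rfl⟩ := h4
        exact absurd (h2.2 (hex _ h5).choose_spec) h3
      · rfl
    rw [map_sum, Finset.sum_congr rfl fun i _ ↦ h1 i]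
    by_cases h : ∀ j, m j ≤ a
    · simp [hf m h]
    · rw [Finset.sum_eq_single (hex m h).choose]
      · rw [dif_pos ⟨h, rfl⟩]
      · intro i _ hi
        rw [dif_neg]
        rintro ⟨_, h'⟩
        exact hi h'.symm
      · simp
  rw [hw]
  exact Ideal.sum_mem _ fun i _ ↦ Ideal.mul_mem_right _ _ (Ideal.subset_span ⟨i, rfl⟩)

/-- Duality for the Gorenstein ring `k⟦X⟧ ⧸ (Xᵢ ^ (a + 1))`: an element outside an ideal is sent to
the generator of the socle by multiplication with some element annihilating the ideal. -/
theorem exists_mul_sub_prod_mem {σ k : Type*} [Fintype σ] [Field k] {a : ℕ}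
    {J : Ideal (MvPowerSeries σ k)} {c : MvPowerSeries σ k}
    (hc : c ∉ Ideal.span (Set.range fun i ↦ (X i : MvPowerSeries σ k) ^ (a + 1)) ⊔ J) :
    ∃ b, (∀ y ∈ J, b * y ∈ Ideal.span (Set.range fun i ↦ (X i : MvPowerSeries σ k) ^ (a + 1))) ∧
      b * c - ∏ i, X i ^ a ∈ Ideal.span (Set.range fun i ↦ (X i : MvPowerSeries σ k) ^ (a + 1)) :=
          by
  classical
  set Q := Ideal.span (Set.range fun i ↦ (X i : MvPowerSeries σ k) ^ (a + 1)) with hQ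
  let W := Q ⊔ J ⊔ maximalIdeal (MvPowerSeries σ k) * Ideal.span {c}
  have hcW : c ∉ W := by
    intro h
    obtain ⟨q, hq, t, ht, hqt⟩ := Submodule.mem_sup.1 h
    obtain ⟨μ, hμ, rfl⟩ := Ideal.mem_mul_span_singleton.1 ht
    have hu : IsUnit (1 - μ) := by
      by_contra hn
      refine (maximalIdeal.isMaximal (MvPowerSeries σ k)).ne_top ((Ideal.eq_top_iff_one _).2 ?_)
      simpa using add_mem ((mem_maximalIdeal _).2 hn) hμ
    refine hc ((Ideal.unit_mul_mem_iff_mem _ hu).1 ?_)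
    convert hq using 1
    linear_combination -hqt
  obtain ⟨φ, hφc, hφW⟩ := Submodule.exists_le_ker_of_notMem (K := k) (p := W.restrictScalars k) hcW
  have hφ0 {f} (hf : f ∈ W) : φ f = 0 := hφW hf
  let e : σ →₀ ℕ := Finsupp.equivFunOnFinite.symm fun _ ↦ a
  have he {m : σ →₀ ℕ} : m ≤ e ↔ ∀ i, m i ≤ a := Iff.rfl
  let b : MvPowerSeries σ k :=
    ∑ m ∈ Finset.Iic e, monomial (e - m) ((φ c)⁻¹ * φ (monomial m 1))
  have hb (f) : coeff e (b * f) = (φ c)⁻¹ * φ f := by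
    have h1 : coeff e (b * f) = (φ c)⁻¹ * φ (∑ m ∈ Finset.Iic e, monomial m (coeff m f)) := by
      rw [Finset.sum_mul, map_sum, map_sum, Finset.mul_sum]
      refine Finset.sum_congr rfl fun m hm ↦ ?_
      rw [coeff_monomial_mul, if_pos tsub_le_self, tsub_tsub_cancel_of_le (Finset.mem_Iic.1 hm),
        ← mul_one (coeff m f), ← smul_eq_mul (coeff m f), map_smul, map_smul, smul_eq_mul,
        smul_eq_mul]
      ring
    rw [h1]
    congr 1
    rw [← sub_eq_zero, ← map_sub]
    refine hφ0 (Submodule.mem_sup_left (Submodule.mem_sup_left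
      (mem_span_range_X_pow_of_coeff fun m hm ↦ ?_)))
    rw [map_sub, map_sum, Finset.sum_eq_single m, coeff_monomial_same, sub_self]
    · exact fun i _ hi ↦ coeff_monomial_ne hi.symm _
    · exact fun h ↦ absurd (Finset.mem_Iic.2 (he.2 hm)) h
  have hbm {m : σ →₀ ℕ} (hm : m ≤ e) (f) :
      coeff m (b * f) = (φ c)⁻¹ * φ (f * monomial (e - m) 1) := by
    rw [← hb, ← mul_assoc, ← add_tsub_cancel_of_le hm, add_tsub_cancel_left,
      coeff_add_mul_monomial, mul_one]
  refine ⟨b, fun y hy ↦ mem_span_range_X_pow_of_coeff fun m hm ↦ ?_,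
    mem_span_range_X_pow_of_coeff fun m hm ↦ ?_⟩
  · rw [hbm (he.2 hm), hφ0 (Submodule.mem_sup_left (Submodule.mem_sup_right
      (Ideal.mul_mem_right _ _ hy))), mul_zero]
  · have hX : (∏ i, X i ^ a : MvPowerSeries σ k) = monomial e 1 := by
      rw [Finset.prod_congr rfl fun i _ ↦ X_pow_eq i a, prod_monomial, Finset.prod_const_one]
      congr 2
      ext i
      simp [e, Finsupp.single_apply, Finsupp.finsetSum_apply]
    rw [map_sub, hX]
    rcases eq_or_ne m e with rfl | hme
    · rw [hb, inv_mul_cancel₀ hφc, coeff_monomial_same, sub_self]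
    · rw [hbm (he.2 hm), coeff_monomial_ne hme, hφ0 (f := c * _), mul_zero, sub_zero]
      refine Submodule.mem_sup_right ?_
      rw [mul_comm c]
      refine Ideal.mul_mem_mul ?_ (Ideal.mem_span_singleton_self c)
      rw [mem_maximalIdeal, mem_nonunits_iff, isUnit_iff_constantCoeff, ←
          coeff_zero_eq_constantCoeff_apply,
        coeff_monomial_ne]
      · simp
      · intro h
        exact hme (le_antisymm (he.2 hm) (tsub_eq_zero_iff_le.1 h.symm))

end MvPowerSeries

section Descent

variable {B : Type*} [CommRing B] {n r s M g : ℕ} {b : ℕ → ℕ} {U : Finset (Fin s)}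

/-- A certificate is defined over every subring containing a suitable finite set. -/
theorem KoszulCert.exists_finset (C : KoszulCert B n r s M b U) :
    ∃ S : Finset B, ∀ A : Subring B, (∀ f ∈ S, f ∈ A) → ∃ C' : KoszulCert A n r s M b U,
      (∀ j, (C'.z j : B) = C.z j) ∧ ∀ j, (C'.x j : B) = C.x j := by
  have hfin : (Set.range C.z ∪ Set.range C.x ∪ Set.range C.lam ∪
      (Set.range fun q : Fin n × Fin (b (r + 1)) ↦ C.mu q.1 q.2) ∪
      (Set.range fun q : Σ i : Fin (n + 1), Fin (b i) × Fin (b (i + 1)) ↦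
        C.D q.1 q.2.1 q.2.2) ∪
      (Set.range fun q : Σ i : Fin (n + 1), Fin n × Fin (b (i + 1)) × Fin (b i) ↦
        C.h q.2.1 q.1 q.2.2.1 q.2.2.2) ∪
      (Set.range fun q : Σ i : Fin (n + 1), Finset (Fin s) × Fin (b i) ↦
        C.ψ q.1 q.2.1 q.2.2)).Finite := Set.toFinite _
  refine ⟨hfin.toFinset, fun A hA ↦ ?_⟩
  simp only [Set.Finite.mem_toFinset, Set.mem_union, or_imp, forall_and, Set.forall_mem_range,
    Prod.forall, Sigma.forall] at hA
  obtain ⟨⟨⟨⟨⟨⟨hz, hx⟩, hl⟩, hm⟩, hD⟩, hh⟩, hψ⟩ := hA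
  have hi {i : ℕ} (a : Fin (b i)) : i < n + 1 := by
    by_contra h
    exact (Fin.cast (C.b_eq i (by omega)) a).elim0
  exact C.exists_map_eq A.subtype Subtype.val_injective (by simpa using hz) (by simpa using hx)
    (fun i a c ↦ by simpa using hD ⟨i, hi a⟩ a c)
    (fun j i a c ↦ by simpa using hh ⟨i, hi c⟩ j a c)
    (fun i T a ↦ by simpa using hψ ⟨i, hi a⟩ T a) (by simpa using hl) (by simpa using hm)

/-- A colon family is defined over every subring containing a suitable finite set. -/
theorem IsColonFamily.exists_finset {y : Fin g → B} {x : Fin s → B} {c : B}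
    {χ : ℕ → Finset (Fin g) → Finset (Fin s) → B} (h : IsColonFamily y x U c χ) :
    ∃ S : Finset B, ∀ A : Subring B, (∀ f ∈ S, f ∈ A) → ∀ (y' : Fin g → A) (x' : Fin s → A)
      (c' : A), (∀ j, (y' j : B) = y j) → (∀ j, (x' j : B) = x j) → (c' : B) = c →
      ∃ χ', IsColonFamily y' x' U c' χ' := by
  have hfin : (Set.range fun q : Fin (U.card + 1) × Finset (Fin g) × Finset (Fin s) ↦
    χ q.1 q.2.1 q.2.2).Finite := Set.toFinite _
  refine ⟨hfin.toFinset, fun A hA y' x' c' hy hx hc ↦ ?_⟩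
  simp only [Set.Finite.mem_toFinset, Set.forall_mem_range, Prod.forall] at hA
  let χ' (i : ℕ) (S : Finset (Fin g)) (T : Finset (Fin s)) : A :=
    if hi : i < U.card + 1 then ⟨χ i S T, hA ⟨i, hi⟩ S T⟩ else 0
  have hχ {i S T} (hi : i < U.card + 1) : (χ' i S T : B) = χ i S T := by simp only [χ', dif_pos hi]
  refine ⟨χ', fun i S T hS hT hTU ↦ Subtype.val_injective ?_, Subtype.val_injective ?_⟩
  · have := h.comm i S T hS hT hTU
    simpa [kbd, ksgn, hy, hx, hχ (show i + 1 < U.card + 1 by omega),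
      hχ (show i < U.card + 1 by omega)] using this
  · rw [hχ (by omega), hc, h.top]

end Descent

theorem KoszulCert.mem_of_charZero {k : Type*} [Field k] [CharZero k] {n r s M g : ℕ} {b : ℕ → ℕ}
    {U : Finset (Fin s)} (C : KoszulCert (MvPowerSeries (Fin n) k) n r s M b U) (hU : U.card = r)
    (hz : ∀ i, C.z i = MvPowerSeries.X i) {y : Fin g → MvPowerSeries (Fin n) k}
    {c : MvPowerSeries (Fin n) k} {χ : ℕ → Finset (Fin g) → Finset (Fin s) → MvPowerSeries (Fin n)
        k}
    (hχ : IsColonFamily y C.x U c χ) (hg : g + 2 ≤ r) (a : ℕ) :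
    c ∈ Ideal.span (Set.range fun i ↦ (MvPowerSeries.X i : MvPowerSeries (Fin n) k) ^ (a + 1)) ⊔
      Ideal.span (Set.range y) := by
  classical
  by_contra hc
  obtain ⟨t, hty, htc⟩ := MvPowerSeries.exists_mul_sub_prod_mem hc
  have hty (j) := Ideal.mem_span_range_iff_exists_fun.1 (hty (y j) (Ideal.subset_span ⟨j, rfl⟩))
  choose w hw using hty
  obtain ⟨v, hv⟩ := Ideal.mem_span_range_iff_exists_fun.1 htc
  obtain ⟨S₁, hS₁⟩ := C.exists_finset
  obtain ⟨S₂, hS₂⟩ := hχ.exists_finset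
  obtain ⟨κ, _, p, hp, _, A, η, hA, hX⟩ := exists_ringHom_charP
    (S₁ ∪ S₂ ∪ {t, c} ∪ Finset.univ.image y ∪ Finset.univ.image v ∪
      Finset.univ.image (fun q : Fin g × Fin n ↦ w q.1 q.2))
  simp only [Finset.mem_union, or_imp, forall_and, Finset.mem_insert, Finset.mem_singleton,
    forall_eq, Finset.mem_image, Finset.mem_univ, true_and, forall_exists_index,
    forall_apply_eq_imp_iff, Prod.forall] at hA
  obtain ⟨⟨⟨⟨⟨hA₁, hA₂⟩, hAt, hAc⟩, hAy⟩, hAv⟩, hAw⟩ := hA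
  choose hXA hηX using hX
  obtain ⟨C', hCz, hCx⟩ := hS₁ A hA₁
  obtain ⟨χ', hχ'⟩ := hS₂ A hA₂ (fun j ↦ ⟨y j, hAy j⟩) C'.x ⟨c, hAc⟩ (fun _ ↦ rfl) hCx rfl
  have hz' (i) : (C'.map η).z i = MvPowerSeries.X i := by
    rw [← hηX]
    exact congrArg η (Subtype.ext ((hCz i).trans (hz i)))
  have := Fact.mk hp
  have : CharP (MvPowerSeries (Fin n) κ) p :=
    charP_of_injective_ringHom (MvPowerSeries.C (σ := Fin n) (R := κ)).injective p
  have : ExpChar (MvPowerSeries (Fin n) κ) p := .prime hp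
  have h1 := (C'.map η).mem_of_expChar hU p (List.ofFn MvPowerSeries.X)
    (weakReg_iff_isWeaklyRegular.1 (MvPowerSeries.weakReg_X κ n)) (by simp)
    (by
      intro f hf
      obtain ⟨i, rfl⟩ := (List.mem_ofFn' _ _).1 hf
      exact Ideal.subset_span ⟨i, hz' i⟩) (hχ'.map η) hg (a + 1)
  set Q := Ideal.span (Set.range fun i ↦ (MvPowerSeries.X i : MvPowerSeries (Fin n) κ) ^ (a + 1))
    with hQ
  have hXQ (i) : (MvPowerSeries.X i : MvPowerSeries (Fin n) κ) ^ (a + 1) ∈ Q :=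
    Ideal.subset_span ⟨i, rfl⟩
  have hty (j) : η ⟨t, hAt⟩ * η ⟨y j, hAy j⟩ ∈ Q := by
    have : (⟨t, hAt⟩ * ⟨y j, hAy j⟩ : A) = ∑ i, ⟨w j i, hAw _ j i rfl⟩ * ⟨_, hXA i⟩ ^ (a + 1) :=
      Subtype.val_injective (by simp [hw])
    rw [← map_mul, this, map_sum]
    exact Ideal.sum_mem _ fun i _ ↦ by
      rw [map_mul, map_pow, hηX]
      exact Ideal.mul_mem_left _ _ (hXQ i)
  have htc : η ⟨t, hAt⟩ * η ⟨c, hAc⟩ - ∏ i, MvPowerSeries.X i ^ a ∈ Q := by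
    have : (⟨t, hAt⟩ * ⟨c, hAc⟩ - ∏ i, ⟨_, hXA i⟩ ^ a : A) =
        ∑ i, ⟨v i, hAv i⟩ * ⟨_, hXA i⟩ ^ (a + 1) := Subtype.val_injective (by simp [hv])
    have h3 := congrArg η this
    simp only [map_sub, map_mul, map_prod, map_pow, map_sum, hηX] at h3
    rw [h3]
    exact Ideal.sum_mem _ fun i _ ↦ Ideal.mul_mem_left _ _ (hXQ i)
  have h2 : η ⟨t, hAt⟩ * η ⟨c, hAc⟩ ∈ Q := by
    obtain ⟨u, hu, v, hv, huv⟩ := Submodule.mem_sup.1 h1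
    rw [← huv, mul_add]
    refine add_mem (Ideal.mul_mem_left _ _ ((Ideal.span_le.2 ?_) hu)) ?_
    · rintro _ ⟨j, rfl⟩
      dsimp only
      rw [hz']
      exact Ideal.pow_mem_of_pow_mem _ (hXQ j) (Nat.lt_pow_self hp.one_lt).le
    · obtain ⟨l, rfl⟩ := Ideal.mem_span_range_iff_exists_fun.1 hv
      rw [Finset.mul_sum]
      exact Ideal.sum_mem _ fun j _ ↦ by
        rw [mul_left_comm]
        exact Ideal.mul_mem_left _ _ (hty j)
  refine (MvPowerSeries.weakReg_X κ n).prod_pow_notMem (fun i ↦ ?_) a isUnit_one ?_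
  · rw [MvPowerSeries.maximalIdeal_eq_span_range_X]
    exact Ideal.subset_span ⟨i, rfl⟩
  · rw [one_mul, ← hQ]
    simpa using sub_mem h2 htc

/-- Over a regular local ring of residue characteristic zero there is no certificate of a
nonzero Koszul map two steps above the height. -/
theorem KoszulCert.false_of_residue_charZero {R : Type*} [CommRing R] [IsLocalRing R]
    [IsNoetherianRing R] [CharZero (ResidueField R)] {n r s M d : ℕ} {b : ℕ → ℕ}
    {U : Finset (Fin s)} (C : KoszulCert R n r s M b U) (hU : U.card = r)
    (hz : Ideal.span (Set.range C.z) = maximalIdeal R) (hdim : ringKrullDim R = n) (P : Ideal R)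
    [P.IsPrime] (hx : ∀ j, C.x j ∈ P) (hP : ringKrullDim (Localization.AtPrime P) = d)
    (hdr : d + 2 ≤ r) : False := by
  obtain ⟨_, hreg⟩ := isDomain_and_weakReg_of_regular C.z hz hdim
  obtain ⟨g, y, c, hg, hy, hc, hcx⟩ := exists_colon_multiplier (Ideal.span (Set.range C.x)) d
    (by
      intro ys h1 h2
      have := length_le_ringKrullDim_localization h1 P fun y hy =>
        (Ideal.span_le (I := P)).2 (by rintro _ ⟨j, rfl⟩; exact hx j) (h2 y hy)
      rw [hP] at this
      exact_mod_cast this)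
  obtain ⟨χ, hχ⟩ := exists_isColonFamily (x := C.x) (U := U) hy
    (fun j _ => hcx _ (Ideal.subset_span ⟨j, rfl⟩))
  obtain ⟨L, hL⟩ := exists_pow_notMem_sup hc
  obtain ⟨ρ, hρz, hρ, happ⟩ := exists_ringHom_mvPowerSeries_of_charZero hreg hz
  set 𝔫 := maximalIdeal (MvPowerSeries (Fin n) (ResidueField R)) with h𝔫
  obtain ⟨q, hq, v, hv, hqv⟩ := Submodule.mem_sup.1
    ((C.map ρ).mem_of_charZero hU hρz (hχ.map ρ) (by omega) L)
  obtain ⟨l, rfl⟩ := Ideal.mem_span_range_iff_exists_fun.1 hv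
  choose l' hl' using fun j ↦ happ L (l j)
  have hq' : q ∈ 𝔫 ^ L := by
    refine Ideal.span_le.2 ?_ hq
    rintro _ ⟨i, rfl⟩
    refine Ideal.pow_le_pow_right L.le_succ (Ideal.pow_mem_pow ?_ _)
    rw [h𝔫, MvPowerSeries.maximalIdeal_eq_span_range_X]
    exact Ideal.subset_span ⟨i, rfl⟩
  have hc' : c - ∑ j, l' j * y j ∈ maximalIdeal R ^ L := by
    refine hρ L _ ?_
    have : ρ (c - ∑ j, l' j * y j) = q + ∑ j, (l j - ρ (l' j)) * ρ (y j) := by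
      simp only [map_sub, map_sum, map_mul, sub_mul, Finset.sum_sub_distrib, ← hqv]
      ring
    rw [this]
    exact add_mem hq' (Ideal.sum_mem _ fun j _ ↦ Ideal.mul_mem_right _ _ (hl' j))
  refine hL (Submodule.mem_sup.2 ⟨_, hc', _, ?_, sub_add_cancel c (∑ j, l' j * y j)⟩)
  exact Ideal.sum_mem _ fun j _ ↦ Ideal.mul_mem_left _ _ (Ideal.subset_span ⟨j, rfl⟩)

/-- Let `(R,m,k)` be a regular local ring (of any
characteristic) and let `I` be an ideal of height `d` with minimal set of
generators `x₁,…,x_s`.  Then for every `i ≥ 2` the natural map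
`K_{d+i}(x;R) ⊗_R k → Tor_{d+i}^R(R/I, k)` is the zero map. -/
theorem statement4
    (R : Type u) [CommRing R] [IsLocalRing R] (hreg : IsRegularLocal R)
    (I : Ideal R) (d : ℕ) (hht : HeightEq R I d)
    {s : ℕ} (x : Fin s → R) (hmin : MinimalGenerators R x I)
    (i : ℕ) (hi : 2 ≤ i) :
    KoszulTorMapZero R x I (d + i) := by
  obtain ⟨_, n, z, hz, hdim⟩ := hreg
  obtain ⟨⟨P, hP, hIP, hPd⟩, -⟩ := hht
  have hxP (j) : x j ∈ P := hIP (hmin.1 ▸ Ideal.subset_span ⟨j, rfl⟩)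
  refine koszulTorMapZero_of_forall_koszulCert (isDomain_and_weakReg_of_regular z hz hdim).2 hz
    (fun j ↦ le_maximalIdeal hP.ne_top (hxP j)) fun M b U C hU hCz hCx ↦ ?_
  subst hCz hCx
  rcases CharP.exists' (ResidueField R) with h0 | ⟨p, hp, hpR⟩
  · exact C.false_of_residue_charZero hU hz hdim P hxP hPd (by omega)
  · refine C.false_of_residue_charP hU hz hdim P hxP hPd (by omega) p ?_
    rw [← residue_eq_zero_iff, map_natCast, CharP.cast_eq_zero]
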